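/- Let A ≅ kQ_A/I_A be a representation-finite toupie algebra with three branches of lengths n_1 = 1, n_2, n_3, and only commutative relations (all three paths from the source a to the sink b are equal in A). Let B_1 be the hereditary algebra obtained from Q_A by deleting the source vertex, and B_2 that obtained by deleting the sink vertex. Then r_A = 2r_{B_1} − 1 = 2r_{B_2} − 1. -/

import Mathlib

open CategoryTheory
open scoped Classical

/-! ## Quiver combinatorics -/

/-- Paths in a quiver given by source and target maps. -/
inductive QPath {V E : Type} (src tgt : E → V) : V → V → Type
  | nil (a : V) : QPath src tgt a a
  | cons {a b : V} (p : QPath src tgt a b) (α : E) (h : src α = b) : QPath src tgt a (tgt α)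

namespace QPath

variable {V E : Type} {src tgt : E → V}

def length : ∀ {a b : V}, QPath src tgt a b → ℕ
  | _, _, .nil _ => 0
  | _, _, .cons p _ _ => p.length + 1

def comp : ∀ {a b c : V}, QPath src tgt a b → QPath src tgt b c → QPath src tgt a c
  | _, _, _, p, .nil _ => p
  | _, _, _, p, .cons q α h => .cons (p.comp q) α h

/-- The list of vertices visited by a path, in order. -/
def verts : ∀ {a b : V}, QPath src tgt a b → List V
  | a, _, .nil _ => [a]
  | _, _, .cons p α _ => p.verts ++ [tgt α]

/-- The interior (intermediate) vertices of a path. -/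
def interior {a b : V} (p : QPath src tgt a b) : List V :=
  (p.verts.dropLast).drop 1

/-- The list of arrows of a path, in walk order. -/
def arrows : ∀ {a b : V}, QPath src tgt a b → List E
  | _, _, .nil _ => []
  | _, _, .cons p α _ => p.arrows ++ [α]

end QPath

/-- A presentation of the algebra `A` by the (ordinary) quiver with vertex set `V`
and arrow set `E` : a complete family of orthogonal primitive idempotents indexed by
the vertices together with generators indexed by the arrows. -/
structure QuiverPresentation (k A V E : Type) [Field k] [Ring A] [Algebra k A]
    [Fintype V] [Fintype E] where
  src : E → V
  tgt : E → V
  idem : V → A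
  arrow : E → A
  idem_idem : ∀ a : V, idem a * idem a = idem a
  idem_orth : ∀ a b : V, a ≠ b → idem a * idem b = 0
  sum_idem : ∑ a : V, idem a = 1
  idem_ne : ∀ a : V, idem a ≠ 0
  idem_primitive : ∀ (v : V) (f g : A), f * f = f → g * g = g → f * g = 0 → g * f = 0 →
    f + g = idem v → f = 0 ∨ g = 0
  arrow_mem : ∀ α : E, idem (tgt α) * arrow α * idem (src α) = arrow α
  arrow_ne : ∀ α : E, arrow α ≠ 0
  generates : Algebra.adjoin k (Set.range idem ∪ Set.range arrow) = ⊤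

namespace QuiverPresentation

variable {k A V E : Type} [Field k] [Ring A] [Algebra k A] [Fintype V] [Fintype E]

/-- The product in `A` of the arrows along a path (paths are written right to left). -/
def qprod (P : QuiverPresentation k A V E) :
    ∀ {a b : V}, QPath P.src P.tgt a b → A
  | _, _, .nil a => P.idem a
  | _, _, .cons p α _ => P.arrow α * P.qprod p

/-- The ideal of relations is admissible: all sufficiently long paths vanish. -/
def Admissible (P : QuiverPresentation k A V E) : Prop :=
  ∃ N : ℕ, ∀ (a b : V) (p : QPath P.src P.tgt a b), N ≤ p.length → P.qprod p = 0

/-- The presentation is minimal: the idempotents and the arrows are linearly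
independent modulo the span of the products of paths of length at least two,
so that `(V, E)` really is the ordinary quiver of `A`. -/
def Minimal (P : QuiverPresentation k A V E) : Prop :=
  ∀ (c : V → k) (d : E → k),
    ((∑ a : V, c a • P.idem a) + ∑ α : E, d α • P.arrow α) ∈
      Submodule.span k {x : A | ∃ (a b : V) (p : QPath P.src P.tgt a b),
        2 ≤ p.length ∧ P.qprod p = x} →
    (∀ a, c a = 0) ∧ (∀ α, d α = 0)

/-- The algebra is monomial: the ideal of relations is generated by paths; equivalently,
the images of the paths which do not vanish are linearly independent. -/
def Monomial (P : QuiverPresentation k A V E) : Prop :=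
  LinearIndependent k
    (fun q : {q : Σ a : V, Σ b : V, QPath P.src P.tgt a b // P.qprod q.2.2 ≠ 0} =>
      P.qprod q.1.2.2)

/-- A (minimal) zero-relation: a path of length at least two whose product vanishes
while the product along every proper subpath does not. -/
def IsZeroRel (P : QuiverPresentation k A V E) {a b : V} (p : QPath P.src P.tgt a b) : Prop :=
  P.qprod p = 0 ∧ 2 ≤ p.length ∧
  ∀ (x y : V) (q : QPath P.src P.tgt x y) (p₁ : QPath P.src P.tgt a x)
    (p₂ : QPath P.src P.tgt y b),
      p = p₁.comp (q.comp p₂) → q.length < p.length → P.qprod q ≠ 0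

/-- A vertex `u` is involved in a zero-relation `α_m ⋯ α_1` if `u = s(α_i)`
for some `i = 2, …, m`, i.e. `u` is an interior vertex of the relation. -/
def InvolvedInZeroRel (P : QuiverPresentation k A V E) (u : V) : Prop :=
  ∃ (a b : V) (p : QPath P.src P.tgt a b), P.IsZeroRel p ∧ u ∈ p.interior

/-! ### Walks (for strings and for connectivity) -/

/-- The starting vertex of a step (an arrow traversed forwards or backwards). -/
def stepSrc (P : QuiverPresentation k A V E) (s : E × Bool) : V :=
  if s.2 then P.src s.1 else P.tgt s.1

/-- The ending vertex of a step. -/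
def stepTgt (P : QuiverPresentation k A V E) (s : E × Bool) : V :=
  if s.2 then P.tgt s.1 else P.src s.1

/-- `l` is a walk from `a` to `b` in the underlying graph of the quiver. -/
def IsWalkFrom (P : QuiverPresentation k A V E) : V → List (E × Bool) → V → Prop
  | a, [], b => a = b
  | a, s :: l, b => P.stepSrc s = a ∧ P.IsWalkFrom (P.stepTgt s) l b

/-- The product in `A` of a list of arrows (listed in walk order). -/
def wprod (P : QuiverPresentation k A V E) (l : List E) : A :=
  ((l.map P.arrow).reverse).prod

/-- A reduced walk: no step is immediately followed by its inverse. -/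
def Reduced (l : List (E × Bool)) : Prop :=
  ¬ ∃ (l₁ : List (E × Bool)) (s : E × Bool) (l₂ : List (E × Bool)),
      l = l₁ ++ s :: (s.1, !s.2) :: l₂

/-- No direct subwalk of `l` nor the inverse of such lies in the ideal of relations. -/
def NoZeroSub (P : QuiverPresentation k A V E) (l : List (E × Bool)) : Prop :=
  ∀ (l₁ : List (E × Bool)) (r : List E) (l₂ : List (E × Bool)),
    (l = l₁ ++ (r.map (fun e => (e, true))) ++ l₂ → P.wprod r ≠ 0) ∧
    (l = l₁ ++ (r.map (fun e => (e, false))) ++ l₂ → P.wprod r.reverse ≠ 0)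

/-- A string from `a` to `b`. -/
def IsStringWalk (P : QuiverPresentation k A V E) (a : V) (l : List (E × Bool)) (b : V) : Prop :=
  P.IsWalkFrom a l b ∧ Reduced l ∧ P.NoZeroSub l

/-- `(Q_u^s)_0` : the strings starting at `u` that are trivial or start with an arrow. -/
def QSset (P : QuiverPresentation k A V E) (u : V) : Set (List (E × Bool)) :=
  {l | ∃ b : V, P.IsStringWalk u l b ∧ (l = [] ∨ ∃ (α : E) (l' : List (E × Bool)),
    l = (α, true) :: l')}

/-- `(Q_u^e)_0` : the strings ending at `u` that are trivial or end with an arrow. -/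
def QEset (P : QuiverPresentation k A V E) (u : V) : Set (List (E × Bool)) :=
  {l | ∃ a : V, P.IsStringWalk a l u ∧ (l = [] ∨ ∃ (α : E) (l' : List (E × Bool)),
    l = l' ++ [(α, true)])}

/-- `S_γ` : the strings starting with the arrow `γ`. -/
def Sarr (P : QuiverPresentation k A V E) (γ : E) : Set (List (E × Bool)) :=
  {l | ∃ b : V, P.IsStringWalk (P.src γ) l b ∧ ∃ l' : List (E × Bool), l = (γ, true) :: l'}

/-- `E_γ` : the strings ending with the arrow `γ`. -/
def Earr (P : QuiverPresentation k A V E) (γ : E) : Set (List (E × Bool)) :=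
  {l | ∃ a : V, P.IsStringWalk a l (P.tgt γ) ∧ ∃ l' : List (E × Bool), l = l' ++ [(γ, true)]}

/-- The defining conditions of a string algebra. -/
def IsStringAlgebra (P : QuiverPresentation k A V E) : Prop :=
  P.Monomial ∧
  (∀ v : V, Nat.card {α : E // P.src α = v} ≤ 2) ∧
  (∀ v : V, Nat.card {α : E // P.tgt α = v} ≤ 2) ∧
  (∀ γ : E, Nat.card {β : E // P.src β = P.tgt γ ∧ P.arrow β * P.arrow γ ≠ 0} ≤ 1) ∧
  (∀ β : E, Nat.card {γ : E // P.src β = P.tgt γ ∧ P.arrow β * P.arrow γ ≠ 0} ≤ 1)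

/-- Connectivity in the underlying graph, avoiding a given set of arrows. -/
def ConnAvoid (P : QuiverPresentation k A V E) (avoid : Set E) (a b : V) : Prop :=
  ∃ l : List (E × Bool), P.IsWalkFrom a l b ∧ ∀ s ∈ l, s.1 ∉ avoid

def Connected (P : QuiverPresentation k A V E) : Prop := ∀ a b : V, P.ConnAvoid ∅ a b

/-- The underlying graph of the quiver is a tree. -/
def IsTreeQuiver (P : QuiverPresentation k A V E) : Prop :=
  P.Connected ∧ Fintype.card E + 1 = Fintype.card V

/-- The underlying (undirected) graph of the quiver is given by the edge-endpoint
specification `ends` on `nV` vertices and `nE` edges. -/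
def GraphSpec (P : QuiverPresentation k A V E) (nV nE : ℕ) (ends : Fin nE → ℕ × ℕ) : Prop :=
  ∃ (v : Fin nV ≃ V) (ar : Fin nE ≃ E), ∀ i : Fin nE, ∃ a b : Fin nV,
    (a : ℕ) = (ends i).1 ∧ (b : ℕ) = (ends i).2 ∧
    ((P.src (ar i) = v a ∧ P.tgt (ar i) = v b) ∨ (P.src (ar i) = v b ∧ P.tgt (ar i) = v a))

/-- The directed quiver is given by the arrow specification `ends`. -/
def DirGraphSpec (P : QuiverPresentation k A V E) (nV nE : ℕ) (ends : Fin nE → ℕ × ℕ) : Prop :=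
  ∃ (v : Fin nV ≃ V) (ar : Fin nE ≃ E), ∀ i : Fin nE, ∃ a b : Fin nV,
    (a : ℕ) = (ends i).1 ∧ (b : ℕ) = (ends i).2 ∧
    P.src (ar i) = v a ∧ P.tgt (ar i) = v b

/-- The underlying graph of the full subquiver on vertices `S` and arrows `T`. -/
def SubGraphSpec (P : QuiverPresentation k A V E) (S : Set V) (T : Set E)
    (nV nE : ℕ) (ends : Fin nE → ℕ × ℕ) : Prop :=
  ∃ (v : Fin nV ≃ S) (ar : Fin nE ≃ T), ∀ i : Fin nE, ∃ a b : Fin nV,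
    (a : ℕ) = (ends i).1 ∧ (b : ℕ) = (ends i).2 ∧
    ((P.src (ar i) = v a ∧ P.tgt (ar i) = v b) ∨ (P.src (ar i) = v b ∧ P.tgt (ar i) = v a))

end QuiverPresentation

/-- Edge endpoints of the Dynkin graph `A_n`. -/
def typeAEnds (n : ℕ) : Fin (n - 1) → ℕ × ℕ := fun i => ((i : ℕ), (i : ℕ) + 1)

/-- Edge endpoints of the Dynkin graph `D_n`. -/
def typeDEnds (n : ℕ) : Fin (n - 1) → ℕ × ℕ := fun i =>
  if (i : ℕ) = 0 then (0, 2) else if (i : ℕ) = 1 then (1, 2) else ((i : ℕ), (i : ℕ) + 1)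

/-- Edge endpoints of the Dynkin graph `E_m` for `m = 6, 7, 8`. -/
def typeEEnds (m : ℕ) : Fin (m - 1) → ℕ × ℕ := fun i =>
  if (i : ℕ) = m - 2 then (2, m - 1) else ((i : ℕ), (i : ℕ) + 1)

/-! ## The module category, its radical and the nilpotency index -/

section ModuleSide

variable (A : Type) [Ring A]

/-- An indecomposable module: non-zero, with no non-trivial idempotent endomorphism. -/
def Indec (M : ModuleCat.{0} A) : Prop :=
  Nontrivial M ∧ ∀ f : M ⟶ M, f ≫ f = f → f = 0 ∨ f = 𝟙 M

/-- A finitely generated indecomposable module. -/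
def FinIndec (M : ModuleCat.{0} A) : Prop := Module.Finite A M ∧ Indec A M

/-- `A` is representation-finite: finitely many finitely generated indecomposables
up to isomorphism. -/
def RepFinite : Prop :=
  ∃ (n : ℕ) (T : Fin n → ModuleCat.{0} A),
    ∀ M : ModuleCat.{0} A, FinIndec A M → ∃ i, Nonempty (M ≅ T i)

/-- `A` is (left) hereditary. -/
def Hereditary : Prop := ∀ I : Submodule A A, Module.Projective A I

/-- An irreducible morphism: it does not split, and in any factorization one of
the factors splits. -/
def IrredMor {X Y : ModuleCat.{0} A} (f : X ⟶ Y) : Prop :=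
  (¬ ∃ g : Y ⟶ X, f ≫ g = 𝟙 X) ∧ (¬ ∃ g : Y ⟶ X, g ≫ f = 𝟙 Y) ∧
  ∀ (Z : ModuleCat.{0} A), Module.Finite A Z → ∀ (u : X ⟶ Z) (v : Z ⟶ Y), f = u ≫ v →
    (∃ r : Z ⟶ X, u ≫ r = 𝟙 X) ∨ (∃ s : Y ⟶ Z, s ≫ v = 𝟙 Y)

/-- The radical of `Hom(X, Y)`. -/
def radSet (X Y : ModuleCat.{0} A) : Set (X ⟶ Y) :=
  {f | ∀ M : ModuleCat.{0} A, FinIndec A M →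
    ∀ (h : M ⟶ X) (h' : Y ⟶ M), ¬ IsIso (h ≫ f ≫ h')}

/-- Compositions of `n` radical morphisms. -/
def radPowSet : ℕ → ∀ (X Y : ModuleCat.{0} A), Set (X ⟶ Y)
  | 0, _, _ => Set.univ
  | n + 1, X, Y => {f | ∃ (M : ModuleCat.{0} A) (g : X ⟶ M) (h : M ⟶ Y),
      Module.Finite A M ∧ g ∈ radSet A X M ∧ h ∈ radPowSet n M Y ∧ f = g ≫ h}

/-- The `n`-th power of the radical of `mod A` vanishes. -/
def RadVanishes (n : ℕ) : Prop :=
  ∀ X Y : ModuleCat.{0} A, Module.Finite A X → Module.Finite A Y →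
    ∀ f ∈ radPowSet A n X Y, f = 0

/-- `m` is the nilpotency index of the radical of `mod A`. -/
def NilpotencyIndex (m : ℕ) : Prop :=
  1 ≤ m ∧ RadVanishes A m ∧ ∀ l : ℕ, RadVanishes A l → m ≤ l

/-- A path of irreducible morphisms between (f.g.) indecomposable modules,
together with its composite morphism and its length. -/
inductive IrrPath : ∀ (M N : ModuleCat.{0} A), (M ⟶ N) → ℕ → Prop
  | nil (M : ModuleCat.{0} A) : FinIndec A M → IrrPath M M (𝟙 M) 0
  | cons {M X N : ModuleCat.{0} A} (f : M ⟶ X) (g : X ⟶ N) (n : ℕ) :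
      FinIndec A M → IrredMor A f → IrrPath X N g n → IrrPath M N (f ≫ g) (n + 1)

/-- The Auslander–Reiten quiver of `A` is a component with length : parallel paths
of irreducible morphisms have the same length. -/
def WithLength : Prop :=
  ∀ (M N : ModuleCat.{0} A) (n m : ℕ),
    (∃ f : M ⟶ N, IrrPath A M N f n) → (∃ g : M ⟶ N, IrrPath A M N g m) → n = m

/-- `N` is a successor of `M` (a path of non-zero morphisms between f.g.
indecomposables from `M` to `N`). -/
inductive Reach : ModuleCat.{0} A → ModuleCat.{0} A → Prop
  | refl (M : ModuleCat.{0} A) : FinIndec A M → Reach M M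
  | cons {M X N : ModuleCat.{0} A} : FinIndec A M → FinIndec A X →
      (∃ f : M ⟶ X, f ≠ 0) → Reach X N → Reach M N

/-- `N` is a direct summand of `M`. -/
def IsSummand (N M : ModuleCat.{0} A) : Prop :=
  ∃ (i : N ⟶ M) (p : M ⟶ N), i ≫ p = 𝟙 N

/-- The radical of a module (intersection of the maximal submodules). -/
def radOf (M : ModuleCat.{0} A) : Submodule A M := sInf {N | IsCoatom N}

/-- The socle of a module (sum of the simple submodules). -/
def socOf (M : ModuleCat.{0} A) : Submodule A M := sSup {N | IsAtom N}

/-- `0 → X → E → Y → 0` is an almost split (Auslander–Reiten) sequence. -/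
def IsAlmostSplit {X E Y : ModuleCat.{0} A} (f : X ⟶ E) (g : E ⟶ Y) : Prop :=
  FinIndec A X ∧ FinIndec A Y ∧ Module.Finite A E ∧
  Function.Injective f ∧ Function.Surjective g ∧
  (∀ x : X, g (f x) = 0) ∧ (∀ e : E, g e = 0 → ∃ x : X, f x = e) ∧
  (¬ ∃ s : Y ⟶ E, s ≫ g = 𝟙 Y) ∧
  (∀ (M : ModuleCat.{0} A) (h : X ⟶ M), (¬ ∃ r : M ⟶ X, h ≫ r = 𝟙 X) →
    ∃ t : E ⟶ M, f ≫ t = h) ∧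
  (∀ (M : ModuleCat.{0} A) (h : M ⟶ Y), (¬ ∃ s : Y ⟶ M, s ≫ h = 𝟙 Y) →
    ∃ t : M ⟶ E, t ≫ g = h)

/-- `X = τ Y` : there is an almost split sequence `0 → X → E → Y → 0`. -/
def IsTauOf (X Y : ModuleCat.{0} A) : Prop :=
  ∃ (E : ModuleCat.{0} A) (f : X ⟶ E) (g : E ⟶ Y), IsAlmostSplit A f g

/-- A sectional path of irreducible morphisms of length `n` from `M` to `N`. -/
def SectionalPath (M N : ModuleCat.{0} A) (n : ℕ) : Prop :=
  ∃ Y : Fin (n + 1) → ModuleCat.{0} A,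
    Y 0 = M ∧ Y (Fin.last n) = N ∧ (∀ i, FinIndec A (Y i)) ∧
    (∀ i : Fin n, ∃ f : Y i.castSucc ⟶ Y i.succ, IrredMor A f) ∧
    ∀ (i : ℕ) (h : i + 2 ≤ n),
      ¬ IsTauOf A (Y ⟨i, by omega⟩) (Y ⟨i + 2, by omega⟩)

end ModuleSide

/-! ## Modules attached to vertices -/

section Vertices

variable {k A V E : Type} [Field k] [Ring A] [Algebra k A] [Fintype V] [Fintype E]

/-- `S` is the simple module at the vertex `a`. -/
def IsSimpleAt (P : QuiverPresentation k A V E) (a : V) (S : ModuleCat.{0} A) : Prop :=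
  IsSimpleModule A S ∧ ∃ x : S, P.idem a • x ≠ 0

/-- `Pm` is the indecomposable projective at the vertex `a`. -/
def IsProjAt (P : QuiverPresentation k A V E) (a : V) (Pm : ModuleCat.{0} A) : Prop :=
  Module.Projective A Pm ∧ FinIndec A Pm ∧
  ∃ (S : ModuleCat.{0} A) (f : Pm ⟶ S), IsSimpleAt P a S ∧ Function.Surjective f

/-- `Im` is the indecomposable injective at the vertex `a`. -/
def IsInjAt (P : QuiverPresentation k A V E) (a : V) (Im : ModuleCat.{0} A) : Prop :=
  Module.Injective A Im ∧ FinIndec A Im ∧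
  ∃ (S : ModuleCat.{0} A) (f : S ⟶ Im), IsSimpleAt P a S ∧ Function.Injective f

/-- `RVal P a n` : `n` is the length of a non-zero path of irreducible morphisms
between indecomposable modules from `P_a` to `I_a` going through `S_a`. -/
def RVal (P : QuiverPresentation k A V E) (a : V) (n : ℕ) : Prop :=
  ∃ (Pm S Im : ModuleCat.{0} A) (f : Pm ⟶ S) (g : S ⟶ Im) (n₁ n₂ : ℕ),
    IsProjAt P a Pm ∧ IsSimpleAt P a S ∧ IsInjAt P a Im ∧
    IrrPath A Pm S f n₁ ∧ IrrPath A S Im g n₂ ∧ f ≫ g ≠ 0 ∧ n = n₁ + n₂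

end Vertices


/-- Arrow endpoints of the toupie quiver with three branches, the first of length one. -/
def toupie3Ends (n2 n3 : ℕ) : Fin (n2 + n3 + 4) → ℕ × ℕ := fun i =>
  let N := n2 + n3 + 3
  let kk := (i : ℕ)
  if kk = 0 then (0, 1)
  else if kk = 1 then (1, N - 1)
  else if kk ≤ n2 + 2 then (if kk = 2 then 0 else kk - 1, if kk = n2 + 2 then N - 1 else kk)
  else (if kk = n2 + 3 then 0 else kk - 2, if kk = n2 + n3 + 3 then N - 1 else kk - 1)

/-- Arrow endpoints of the quiver obtained from the toupie by deleting the source. -/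
def delSrcEnds (n2 n3 : ℕ) : Fin (1 + n2 + n3) → ℕ × ℕ := fun i =>
  if (i : ℕ) = 0 then (0, n2 + n3 + 1)
  else ((i : ℕ), if (i : ℕ) = n2 ∨ (i : ℕ) = n2 + n3 then n2 + n3 + 1 else (i : ℕ) + 1)

/-- Arrow endpoints of the quiver obtained from the toupie by deleting the sink. -/
def delSnkEnds (n2 n3 : ℕ) : Fin (1 + n2 + n3) → ℕ × ℕ := fun i =>
  if (i : ℕ) = 0 then (0, 1)
  else if (i : ℕ) = 1 ∨ (i : ℕ) = n2 + 1 then (0, (i : ℕ) + 1)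
  else ((i : ℕ), (i : ℕ) + 1)

namespace Toupie

/-! ## Chains of non-isomorphisms between indecomposable objects -/

section Chains

variable {C D : Type*} [Category C] [Category D]

/-- An indecomposable object: non-zero, with no non-trivial idempotent endomorphism. -/
def IndecObj [Limits.HasZeroMorphisms C] (X : C) : Prop :=
  𝟙 X ≠ 0 ∧ ∀ e : X ⟶ X, e ≫ e = e → e = 0 ∨ e = 𝟙 X

/-- `Chain Q f n` : `f` is, up to isomorphism, a composite of `n` non-isomorphisms between
objects satisfying `Q`. -/
inductive Chain (Q : C → Prop) : ∀ {X Y : C}, (X ⟶ Y) → ℕ → Prop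
  | nil {X Y : C} (f : X ⟶ Y) : Q X → Q Y → IsIso f → Chain Q f 0
  | cons {X Y Z : C} (f : X ⟶ Y) (g : Y ⟶ Z) {n : ℕ} :
      Q X → ¬ IsIso f → Chain Q g n → Chain Q (f ≫ g) (n + 1)

variable {Q : C → Prop}

theorem Chain.left {X Y : C} {f : X ⟶ Y} {n : ℕ} (h : Chain Q f n) : Q X := by
  cases h <;> assumption

theorem Chain.right {X Y : C} {f : X ⟶ Y} {n : ℕ} (h : Chain Q f n) : Q Y := by
  induction h <;> assumption

theorem Chain.mono {Q' : C → Prop} (hQ : ∀ X, Q X → Q' X) {X Y : C} {f : X ⟶ Y} {n : ℕ}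
    (h : Chain Q f n) : Chain Q' f n := by
  induction h with
  | nil f h1 h2 h3 => exact .nil f (hQ _ h1) (hQ _ h2) h3
  | cons f g h1 h2 _ ih => exact .cons f g (hQ _ h1) h2 ih

theorem Chain.iso_comp {X Y Z : C} (f : X ⟶ Y) {g : Y ⟶ Z} {n : ℕ} (hX : Q X) (hf : IsIso f)
    (h : Chain Q g n) : Chain Q (f ≫ g) n := by
  cases h with
  | nil g h1 h2 h3 => exact .nil _ hX h2 inferInstance
  | cons g k h1 h2 h3 =>
    rw [← Category.assoc]
    refine .cons _ _ hX (fun hi => h2 ?_) h3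
    exact IsIso.of_isIso_comp_left f g

theorem Chain.trans {X Y Z : C} {f : X ⟶ Y} {g : Y ⟶ Z} {m n : ℕ} (hf : Chain Q f m)
    (hg : Chain Q g n) : Chain Q (f ≫ g) (m + n) := by
  induction hf with
  | nil f h1 h2 h3 => simpa using hg.iso_comp f h1 h3
  | cons f k h1 h2 h3 ih =>
    rw [Category.assoc, Nat.add_right_comm]
    exact .cons _ _ h1 h2 (ih hg)

theorem Chain.snoc {X Y Z : C} {f : X ⟶ Y} (g : Y ⟶ Z) {m : ℕ} (hf : Chain Q f m)
    (hZ : Q Z) (hg : ¬ IsIso g) : Chain Q (f ≫ g) (m + 1) := by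
  have : Chain Q (g ≫ 𝟙 Z) (0 + 1) := .cons _ _ hf.right hg (.nil _ hZ hZ inferInstance)
  simpa using hf.trans this

theorem Chain.exists_of_le [Limits.HasZeroMorphisms C] {X Y : C} {f : X ⟶ Y} {m n : ℕ}
    (hf : Chain Q f m) (h0 : f ≠ 0) (hn : n ≤ m) :
    ∃ (X' : C) (f' : X' ⟶ Y), Chain Q f' n ∧ f' ≠ 0 := by
  induction hf with
  | nil f h1 h2 h3 =>
    obtain rfl : n = 0 := by omega
    exact ⟨_, f, .nil f h1 h2 h3, h0⟩
  | @cons X Y Z f g m h1 h2 h3 ih =>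
    rcases Nat.lt_or_ge m n with h | h
    · obtain rfl : n = m + 1 := by omega
      exact ⟨_, _, .cons f g h1 h2 h3, h0⟩
    · refine ih ?_ h
      rintro rfl
      simp at h0

theorem Chain.map (F : C ⥤ D) [F.Full] [F.Faithful] {Q' : D → Prop}
    (hQ : ∀ X, Q X → Q' (F.obj X)) {X Y : C} {f : X ⟶ Y} {n : ℕ} (h : Chain Q f n) :
    Chain Q' (F.map f) n := by
  induction h with
  | nil f h1 h2 h3 => exact .nil _ (hQ _ h1) (hQ _ h2) inferInstance
  | cons f g h1 h2 h3 ih =>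
    rw [F.map_comp]
    exact .cons _ _ (hQ _ h1) (fun hi => h2 (isIso_of_reflects_iso f F)) ih

theorem Chain.lift (F : C ⥤ D) [F.Full] [F.Faithful] {Q' : D → Prop}
    (hQ : ∀ X, Q' X → ∃ M, Q M ∧ Nonempty (F.obj M ≅ X)) {X Y : D} {f : X ⟶ Y} {n : ℕ}
    (h : Chain Q' f n) (M : C) (hM : Q M) (φ : F.obj M ≅ X) :
    ∃ (N : C) (ψ : F.obj N ≅ Y) (c : M ⟶ N), Chain Q c n ∧ F.map c = φ.hom ≫ f ≫ ψ.inv := by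
  induction h generalizing M with
  | nil f h1 h2 h3 =>
    refine ⟨M, φ ≪≫ asIso f, 𝟙 M, .nil _ hM hM inferInstance, by simp⟩
  | @cons X Y Z f g n h1 h2 h3 ih =>
    obtain ⟨M', hM', ⟨φ'⟩⟩ := hQ _ h3.left
    obtain ⟨N, ψ, c, hc, hc'⟩ := ih M' hM' φ'
    refine ⟨N, ψ, F.preimage (φ.hom ≫ f ≫ φ'.inv) ≫ c, .cons _ _ hM (fun hi => h2 ?_) hc,
      by simp [hc']⟩
    have : IsIso (F.map (F.preimage (φ.hom ≫ f ≫ φ'.inv))) := inferInstance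
    rw [F.map_preimage] at this
    have h4 : IsIso (f ≫ φ'.inv) := IsIso.of_isIso_comp_left φ.hom _
    exact IsIso.of_isIso_comp_right f φ'.inv

theorem indecObj_of_iso [Limits.HasZeroMorphisms C] {X Y : C} (φ : X ≅ Y) (h : IndecObj X) :
    IndecObj Y := by
  refine ⟨fun h0 => h.1 ?_, fun e he => ?_⟩
  · have : φ.hom ≫ 𝟙 Y ≫ φ.inv = 0 := by rw [h0]; simp
    simpa using this
  · rcases h.2 (φ.hom ≫ e ≫ φ.inv) (by simp [reassoc_of% he]) with h1 | h1
    · left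
      have : φ.inv ≫ (φ.hom ≫ e ≫ φ.inv) ≫ φ.hom = 0 := by rw [h1]; simp
      simpa using this
    · right
      have : φ.inv ≫ (φ.hom ≫ e ≫ φ.inv) ≫ φ.hom = 𝟙 Y := by rw [h1]; simp
      simpa using this

theorem indecObj_map [Limits.HasZeroMorphisms C] [Limits.HasZeroMorphisms D] (F : C ⥤ D) [F.Full]
    [F.Faithful] [F.PreservesZeroMorphisms] (X : C) : IndecObj (F.obj X) ↔ IndecObj X := by
  constructor
  · rintro ⟨h1, h2⟩
    refine ⟨fun h => h1 ?_, fun e he => ?_⟩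
    · rw [← F.map_id, h, F.map_zero]
    · rcases h2 (F.map e) (by rw [← F.map_comp, he]) with h | h
      · left; exact F.map_injective (by rw [h, F.map_zero])
      · right; exact F.map_injective (by rw [h, F.map_id])
  · rintro ⟨h1, h2⟩
    refine ⟨fun h => h1 (F.map_injective (by rw [F.map_id, h, F.map_zero])), fun e he => ?_⟩
    rcases h2 (F.preimage e) (F.map_injective (by simp [he])) with h | h
    · left
      rw [← F.map_preimage e, h, F.map_zero]
    · right
      rw [← F.map_preimage e, h, F.map_id]

/-- A retract of an indecomposable object which is non-zero is isomorphic to it. -/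
theorem IndecObj.isIso_of_retract [Limits.HasZeroMorphisms C] {X Y : C} (hX : IndecObj X)
    (hY : 𝟙 Y ≠ 0) (i : Y ⟶ X) (p : X ⟶ Y) (h : i ≫ p = 𝟙 Y) : p ≫ i = 𝟙 X := by
  rcases hX.2 (p ≫ i) (by simp [reassoc_of% h]) with h1 | h1
  · exfalso
    apply hY
    have : i ≫ (p ≫ i) ≫ p = 0 := by rw [h1]; simp
    simpa [reassoc_of% h, h] using this
  · exact h1

end Chains

/-! ## The radical of a module category in terms of chains -/

section Radical

variable {R : Type} [Ring R]

theorem indec_iff (M : ModuleCat.{0} R) : Indec R M ↔ IndecObj M := by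
  unfold Indec IndecObj
  refine and_congr_left fun _ => ?_
  rw [← not_subsingleton_iff_nontrivial, not_iff_not]
  constructor
  · intro h
    ext x
    exact Subsingleton.elim _ _
  · intro h
    refine ⟨fun x y => ?_⟩
    have hx : ∀ x : M, x = 0 := fun x => by
      have := congrArg (fun f : M ⟶ M => f x) h
      simpa using this
    rw [hx x, hx y]

/-- A non-zero composite through an Artinian module stays non-zero after passing through a
suitable indecomposable summand. -/
theorem exists_indec_summand {X Z Y : ModuleCat.{0} R} [IsArtinian R Z] (f : X ⟶ Z) (g : Z ⟶ Y)
    (h : f ≫ g ≠ 0) : ∃ (M : ModuleCat.{0} R) (i : M ⟶ Z) (p : Z ⟶ M),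
      IndecObj M ∧ i ≫ p = 𝟙 M ∧ f ≫ p ≫ i ≫ g ≠ 0 := by
  let S : Set (Submodule R Z) := {N | ∃ e : Z ⟶ Z, e ≫ e = e ∧ f ≫ e ≫ g ≠ 0 ∧
    LinearMap.range e.hom = N}
  have hS : S.Nonempty := ⟨_, 𝟙 Z, by simp, by simpa using h, rfl⟩
  obtain ⟨N, ⟨e, he, hne, rfl⟩, hmin⟩ := IsArtinian.set_has_minimal S hS
  let M : ModuleCat.{0} R := ModuleCat.of R (LinearMap.range e.hom)
  let i : M ⟶ Z := ModuleCat.ofHom (LinearMap.range e.hom).subtype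
  let p : Z ⟶ M := ModuleCat.ofHom e.hom.rangeRestrict
  have hpi : p ≫ i = e := by ext x; rfl
  have hip : i ≫ p = 𝟙 M := by
    ext ⟨x, y, rfl⟩
    exact congrArg (fun q : Z ⟶ Z => q y) he
  refine ⟨M, i, p, ⟨?_, ?_⟩, hip, by rwa [reassoc_of% hpi]⟩
  · intro h0
    apply hne
    have : e = 0 := by rw [← hpi, ← Category.comp_id p, h0]; simp
    rw [this]; simp
  · intro q hq
    by_contra hcon
    push Not at hcon
    have key : ∀ q : M ⟶ M, q ≫ q = q → q ≠ 𝟙 M → f ≫ (p ≫ q ≫ i) ≫ g = 0 := by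
      intro q hq hq1
      by_contra hne'
      refine hmin (LinearMap.range (p ≫ q ≫ i).hom) ⟨p ≫ q ≫ i, ?_, hne', rfl⟩ ?_
      · simp [reassoc_of% hip, reassoc_of% hq]
      · refine lt_of_le_of_ne ?_ fun heq => hq1 ?_
        · rintro _ ⟨x, rfl⟩
          exact (q (p x)).2
        · have h1 : ∀ m : M, q m = m := by
            intro m
            have hm : (m : Z) ∈ LinearMap.range (p ≫ q ≫ i).hom := by rw [heq]; exact m.2
            obtain ⟨x, hx⟩ := hm
            have hm' : m = q (p x) := Subtype.ext hx.symm
            rw [hm']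
            exact congrArg (fun r : M ⟶ M => r (p x)) hq
          ext m
          exact congrArg Subtype.val (h1 m)
    have h1 := key q hq hcon.2
    have h2 := key (𝟙 M - q) (by simp [hq]) (by
      intro h; apply hcon.1; simpa using h)
    apply hne
    have h3 : e = p ≫ q ≫ i + p ≫ (𝟙 M - q) ≫ i := by simp [hpi]
    rw [h3, Preadditive.add_comp, Preadditive.comp_add, h1, h2, add_zero]

theorem chain_mem_radPowSet {X Y : ModuleCat.{0} R} {f : X ⟶ Y} {n : ℕ}
    (h : Chain (FinIndec R) f n) : f ∈ radPowSet R n X Y := by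
  induction h with
  | nil f => exact Set.mem_univ _
  | @cons X Y Z f g n hX hf hg ih =>
    refine ⟨Y, f, g, hg.left.1, ?_, ih, rfl⟩
    intro M hM a b hab
    apply hf
    have hX' := (indec_iff X).1 hX.2
    have hY' := (indec_iff Y).1 hg.left.2
    have hM' := ((indec_iff M).1 hM.2).1
    have e1 := hX'.isIso_of_retract hM' a (f ≫ b ≫ inv (a ≫ f ≫ b)) (by
      have := IsIso.hom_inv_id (a ≫ f ≫ b)
      simpa only [Category.assoc] using this)
    have e2 := hY'.isIso_of_retract hM' (inv (a ≫ f ≫ b) ≫ a ≫ f) b (by simp)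
    exact ⟨b ≫ inv (a ≫ f ≫ b) ≫ a, by simpa using e1, by simpa using e2⟩

theorem exists_chain_of_mem_radPowSet [IsArtinianRing R] {n : ℕ} {X Y : ModuleCat.{0} R}
    {f : X ⟶ Y} (hf : f ∈ radPowSet R n X Y) {Z M : ModuleCat.{0} R} (hM : FinIndec R M)
    (z : Z ⟶ M) (a : M ⟶ X) (hne : z ≫ a ≫ f ≠ 0) :
    ∃ (N : ModuleCat.{0} R) (c : M ⟶ N), Chain (FinIndec R) c n ∧ z ≫ c ≠ 0 := by
  induction n generalizing X Z M with
  | zero =>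
    refine ⟨M, 𝟙 M, .nil _ hM hM inferInstance, fun h => hne ?_⟩
    rw [Category.comp_id] at h
    rw [h]; simp
  | succ n ih =>
    obtain ⟨L, g, h, hL, hg, hh, rfl⟩ := hf
    obtain ⟨M', i, p, hM', hip, hne'⟩ := exists_indec_summand (z ≫ a ≫ g) h (by simpa using hne)
    have hfin : FinIndec R M' := by
      refine ⟨Module.Finite.of_surjective p.hom fun x => ⟨i x, ?_⟩, (indec_iff _).2 hM'⟩
      exact congrArg (fun r : M' ⟶ M' => r x) hip
    obtain ⟨N, c, hc, hcne⟩ := ih hh hfin (z ≫ a ≫ g ≫ p) i (by simpa using hne')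
    refine ⟨N, (a ≫ g ≫ p) ≫ c, .cons _ _ hM (fun hi => ?_) hc, by simpa using hcne⟩
    refine hg M hM a (p ≫ inv (a ≫ g ≫ p)) ?_
    have : a ≫ g ≫ p ≫ inv (a ≫ g ≫ p) = 𝟙 M := by
      have := IsIso.hom_inv_id (a ≫ g ≫ p)
      simpa only [Category.assoc] using this
    rw [this]
    infer_instance

theorem radVanishes_iff [IsArtinianRing R] (n : ℕ) :
    RadVanishes R n ↔ ∀ (X Y : ModuleCat.{0} R) (f : X ⟶ Y), Chain (FinIndec R) f n → f = 0 := by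
  constructor
  · intro h X Y f hf
    exact h X Y hf.left.1 hf.right.1 f (chain_mem_radPowSet hf)
  · intro h X Y hX hY f hf
    by_contra hne
    obtain ⟨M, i, p, hM, hip, hne'⟩ := exists_indec_summand (𝟙 X) f (by simpa using hne)
    have hfin : FinIndec R M := by
      refine ⟨Module.Finite.of_surjective p.hom fun x => ⟨i x, ?_⟩, (indec_iff _).2 hM⟩
      exact congrArg (fun r : M ⟶ M => r x) hip
    obtain ⟨N, c, hc, hcne⟩ := exists_chain_of_mem_radPowSet hf hfin p i (by simpa using hne')
    exact hcne (by rw [h _ _ c hc]; simp)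

end Radical


/-! ## Representations of a finite poset -/

/-- A representation of the poset `P` over `k`. -/
structure Rep (k P : Type) [Field k] [PartialOrder P] where
  V : P → Type
  [acg : ∀ i, AddCommGroup (V i)]
  [mod : ∀ i, Module k (V i)]
  map : ∀ {i j : P}, i ≤ j → (V i →ₗ[k] V j)
  map_refl : ∀ (i : P) (x : V i), map (le_refl i) x = x
  map_map : ∀ {i j l : P} (h : i ≤ j) (h' : j ≤ l) (x : V i),
    map h' (map h x) = map (h.trans h') x

attribute [instance] Rep.acg Rep.mod
attribute [simp] Rep.map_refl Rep.map_map

namespace Rep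

variable {k P : Type} [Field k] [PartialOrder P]

/-- Morphisms of representations. -/
@[ext]
structure Hom (X Y : Rep k P) where
  app : ∀ i, X.V i →ₗ[k] Y.V i
  nat : ∀ {i j : P} (h : i ≤ j) (x : X.V i), app j (X.map h x) = Y.map h (app i x)

instance : Category (Rep k P) where
  Hom := Hom
  id X := ⟨fun _ => LinearMap.id, fun _ _ => rfl⟩
  comp f g := ⟨fun i => (g.app i).comp (f.app i), fun h x => by
    simp [f.nat, g.nat]⟩

@[ext]
theorem hom_ext {X Y : Rep k P} {f g : X ⟶ Y} (h : ∀ i x, f.app i x = g.app i x) : f = g :=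
  Hom.ext (funext fun i => LinearMap.ext (h i))

@[simp] theorem id_app (X : Rep k P) (i : P) (x : X.V i) : Hom.app (𝟙 X) i x = x := rfl

@[simp] theorem comp_app {X Y Z : Rep k P} (f : X ⟶ Y) (g : Y ⟶ Z) (i : P) (x : X.V i) :
    (f ≫ g).app i x = g.app i (f.app i x) := rfl

instance {X Y : Rep k P} : Zero (X ⟶ Y) := ⟨⟨fun _ => 0, fun _ _ => by simp⟩⟩

@[simp] theorem zero_app {X Y : Rep k P} (i : P) (x : X.V i) : (0 : X ⟶ Y).app i x = 0 := rfl

instance : Limits.HasZeroMorphisms (Rep k P) where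
  zero X Y := inferInstance
  comp_zero f Z := by ext; simp
  zero_comp X Y Z f := by ext; simp

theorem nat_apply {X Y : Rep k P} (f : X ⟶ Y) {i j : P} (h : i ≤ j) (x : X.V i) :
    f.app j (X.map h x) = Y.map h (f.app i x) := f.nat h x

theorem exists_ne_zero {X Y : Rep k P} {f : X ⟶ Y} (h : f ≠ 0) : ∃ i x, f.app i x ≠ 0 := by
  by_contra hcon
  push Not at hcon
  exact h (by ext i x; simpa using hcon i x)

/-- Isomorphisms from vertexwise linear equivalences. -/
def isoMk {X Y : Rep k P} (e : ∀ i, X.V i ≃ₗ[k] Y.V i)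
    (h : ∀ {i j : P} (hij : i ≤ j) (x : X.V i), e j (X.map hij x) = Y.map hij (e i x)) :
    X ≅ Y where
  hom := ⟨fun i => e i, fun hij x => h hij x⟩
  inv := ⟨fun i => (e i).symm, fun {i j} hij x => by
    apply (e j).injective
    simp [h]⟩
  hom_inv_id := by ext i x; exact (e i).symm_apply_apply x
  inv_hom_id := by ext i x; exact (e i).apply_symm_apply x

theorem isIso_iff {X Y : Rep k P} (f : X ⟶ Y) :
    IsIso f ↔ ∀ i, Function.Bijective (f.app i) := by
  constructor
  · intro hf i
    refine Function.bijective_iff_has_inverse.2 ⟨(inv f).app i, fun x => ?_, fun x => ?_⟩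
    · rw [← comp_app, IsIso.hom_inv_id, id_app]
    · rw [← comp_app, IsIso.inv_hom_id, id_app]
  · intro h
    let φ : X ≅ Y := isoMk (fun i => LinearEquiv.ofBijective (f.app i) (h i)) (fun hij x => f.nat hij x)
    have : f = φ.hom := rfl
    rw [this]
    infer_instance

/-- Pointwise finite-dimensional representations. -/
def FD (X : Rep k P) : Prop := ∀ i, Module.Finite k (X.V i)

/-- Representations supported in `S`. -/
def SuppIn (S : Set P) (X : Rep k P) : Prop := ∀ i, i ∉ S → ∀ x : X.V i, x = 0

/-- The finite-dimensional indecomposable representations supported in `S`. -/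
def Ind (S : Set P) (X : Rep k P) : Prop := X.FD ∧ IndecObj X ∧ X.SuppIn S

end Rep

/-! ## Modules over an algebra with a system of path elements -/

/-- Elements `p i j` of `R` multiplying like the incidence algebra of `P`, non-zero on `S`. -/
structure IncSys (k R P : Type) [Field k] [Ring R] [Algebra k R] [PartialOrder P] [Fintype P]
    (S : Set P) where
  p : P → P → R
  mul_same : ∀ {i j l : P}, i ≤ j → j ≤ l → p j l * p i j = p i l
  mul_ne : ∀ {i j j' l : P}, i ≤ j → j' ≤ l → j ≠ j' → p j' l * p i j = 0
  sum_one : ∑ i, p i i = 1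
  span_top : Submodule.span k {r | ∃ i j, i ≤ j ∧ p i j = r} = ⊤
  ne_zero : ∀ {i j}, i ≤ j → i ∈ S → j ∈ S → p i j ≠ 0
  zero_of_notMem : ∀ {i}, i ∉ S → p i i = 0

namespace IncSys

open scoped ModuleCat

variable {k R P : Type} [Field k] [Ring R] [Algebra k R] [PartialOrder P] [Fintype P]
  {S : Set P} (σ : IncSys k R P S)

/-- The representation of a module. -/
def repOf (M : ModuleCat.{0} R) : Rep k P where
  V i := ({ carrier := {x : M | σ.p i i • x = x}
            add_mem' := fun {x y} hx hy => by
              simp only [Set.mem_ofPred_eq] at *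
              rw [smul_add, hx, hy]
            zero_mem' := smul_zero _
            smul_mem' := fun c x hx => by
              simp only [Set.mem_ofPred_eq] at *
              rw [smul_comm, hx] } : Submodule k M)
  map {i j} h :=
    { toFun := fun x => ⟨σ.p i j • (x : M), by
        change σ.p j j • σ.p i j • (x : M) = _
        rw [← mul_smul, σ.mul_same h le_rfl]⟩
      map_add' := fun x y => Subtype.ext (smul_add _ _ _)
      map_smul' := fun c x => Subtype.ext (smul_comm _ _ _) }
  map_refl i x := Subtype.ext x.2
  map_map {i j l} h h' x := Subtype.ext (by
    change σ.p j l • σ.p i j • (x : M) = σ.p i l • (x : M)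
    rw [← mul_smul, σ.mul_same h h'])

theorem mem_repOf {M : ModuleCat.{0} R} {i : P} (x : (σ.repOf M).V i) :
    σ.p i i • (x.1 : M) = x.1 := x.2

/-- The functor from modules to representations. -/
def functor : ModuleCat.{0} R ⥤ Rep k P where
  obj M := σ.repOf M
  map {M N} f :=
    ⟨fun i =>
      { toFun := fun x => ⟨f x.1, by
          change σ.p i i • f x.1 = f x.1
          rw [← map_smul, σ.mem_repOf x]⟩
        map_add' := fun x y => Subtype.ext (map_add f.hom _ _)
        map_smul' := fun c x => Subtype.ext (by
          change f (c • x.1) = c • f x.1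
          rw [← algebraMap_smul R c x.1, map_smul, algebraMap_smul]) },
      fun {i j} h x => Subtype.ext (map_smul f.hom _ _)⟩

theorem functor_app_val {M N : ModuleCat.{0} R} (f : M ⟶ N) (i : P) (x : (σ.repOf M).V i) :
    ((σ.functor.map f).app i x).1 = f x.1 := rfl

/-- The component of an element at a vertex. -/
def proj (M : ModuleCat.{0} R) (i : P) : M →ₗ[k] (σ.repOf M).V i where
  toFun x := ⟨σ.p i i • x, by
    change σ.p i i • σ.p i i • x = _
    rw [← mul_smul, σ.mul_same le_rfl le_rfl]⟩
  map_add' x y := Subtype.ext (smul_add _ _ _)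
  map_smul' c x := Subtype.ext (smul_comm _ _ _)

theorem sum_proj {M : ModuleCat.{0} R} (x : M) : ∑ i, (σ.proj M i x).1 = x := by
  change ∑ i, σ.p i i • x = x
  rw [← Finset.sum_smul, σ.sum_one, one_smul]

instance : σ.functor.Faithful where
  map_injective {M N} f g h := by
    ext x
    have h1 : ∀ i, f (σ.proj M i x).1 = g (σ.proj M i x).1 := fun i => by
      rw [← σ.functor_app_val, ← σ.functor_app_val, h]
    rw [← σ.sum_proj x, map_sum, map_sum]
    exact Finset.sum_congr rfl fun i _ => h1 i

theorem proj_smul {M : ModuleCat.{0} R} {i j : P} (h : i ≤ j) (x : M) (l : P) :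
    σ.proj M l (σ.p i j • x) =
      if e : j = l then (σ.repOf M).map (e ▸ h) (σ.proj M i x) else 0 := by
  apply Subtype.ext
  change σ.p l l • σ.p i j • x = _
  rw [← mul_smul]
  split_ifs with e
  · subst e
    change _ = σ.p i j • σ.p i i • x
    rw [← mul_smul, σ.mul_same h le_rfl, σ.mul_same le_rfl h]
  · rw [σ.mul_ne h le_rfl e, zero_smul]
    rfl

instance : σ.functor.Full where
  map_surjective {M N} (g : σ.repOf M ⟶ σ.repOf N) := by
    let f0 : M →ₗ[k] N := ∑ i, (Submodule.subtype _).comp ((g.app i).comp (σ.proj M i))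
    have hf0 : ∀ x, f0 x = ∑ i, (g.app i (σ.proj M i x)).1 := fun x => by
      simp [f0]
      rfl
    have hlin : ∀ (r : R) (x : M), f0 (r • x) = r • f0 x := by
      intro r
      have hr : r ∈ Submodule.span k {r | ∃ i j, i ≤ j ∧ σ.p i j = r} := by
        rw [σ.span_top]; trivial
      induction hr using Submodule.span_induction with
      | zero => intro x; simp
      | add a b _ _ ha hb => intro x; rw [add_smul, map_add, ha, hb, add_smul]
      | smul c a _ ha => intro x; rw [smul_assoc, map_smul, ha, smul_assoc]
      | mem r hr =>
        obtain ⟨i, j, h, rfl⟩ := hr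
        intro x
        rw [hf0, hf0, Finset.smul_sum]
        have e1 : ∀ l, (g.app l (σ.proj M l (σ.p i j • x))).1 =
            if j = l then σ.p i j • (g.app i (σ.proj M i x)).1 else 0 := by
          intro l
          rw [σ.proj_smul h]
          split_ifs with e
          · subst e
            rw [Rep.nat_apply]; rfl
          · rw [map_zero]; rfl
        have e2 : ∀ l, σ.p i j • (g.app l (σ.proj M l x)).1 =
            if i = l then σ.p i j • (g.app i (σ.proj M i x)).1 else 0 := by
          intro l
          split_ifs with e
          · subst e; rfl
          · rw [← σ.mem_repOf (g.app l (σ.proj M l x)), ← mul_smul,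
              σ.mul_ne le_rfl h (Ne.symm e), zero_smul]
        rw [Finset.sum_congr rfl fun l _ => e1 l, Finset.sum_congr rfl fun l _ => e2 l]
        simp
    refine ⟨ModuleCat.ofHom { toFun := f0, map_add' := map_add f0, map_smul' := hlin }, ?_⟩
    ext i x
    apply Subtype.ext
    change f0 x.1 = _
    rw [hf0, Finset.sum_eq_single i]
    · congr 2
      exact Subtype.ext (σ.mem_repOf x)
    · intro j _ hj
      have : σ.proj M j x.1 = 0 := Subtype.ext (by
        change σ.p j j • x.1 = 0
        rw [← σ.mem_repOf x, ← mul_smul, σ.mul_ne le_rfl le_rfl (Ne.symm hj), zero_smul])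
      rw [this, map_zero]; rfl
    · simp

instance : σ.functor.PreservesZeroMorphisms where
  map_zero M N := by ext i x; rfl

end IncSys


namespace IncSys

open scoped ModuleCat

variable {k R P : Type} [Field k] [Ring R] [Algebra k R] [PartialOrder P] [Fintype P]
  {S : Set P} (σ : IncSys k R P S)

theorem exists_coeff_ite (i j : P) (r : R) :
    ∃ c : k, σ.p j j * r * σ.p i i = if i ≤ j then c • σ.p i j else 0 := by
  have hr : r ∈ Submodule.span k {r | ∃ i j, i ≤ j ∧ σ.p i j = r} := by
    rw [σ.span_top]; trivial
  induction hr using Submodule.span_induction with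
  | zero => exact ⟨0, by simp⟩
  | add a b _ _ ha hb =>
    obtain ⟨c, hc⟩ := ha
    obtain ⟨d, hd⟩ := hb
    refine ⟨c + d, ?_⟩
    rw [mul_add, add_mul, hc, hd]
    split_ifs
    · rw [add_smul]
    · simp
  | smul a x _ hx =>
    obtain ⟨c, hc⟩ := hx
    refine ⟨a * c, ?_⟩
    rw [mul_smul_comm, smul_mul_assoc, hc]
    split_ifs
    · rw [mul_smul]
    · simp
  | mem r hr =>
    obtain ⟨a, b, h, rfl⟩ := hr
    by_cases ha : i = a
    · subst ha
      by_cases hb : b = j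
      · subst hb
        refine ⟨1, ?_⟩
        rw [if_pos h, one_smul, σ.mul_same h le_rfl, σ.mul_same le_rfl h]
      · exact ⟨0, by rw [σ.mul_ne h le_rfl hb]; simp⟩
    · exact ⟨0, by rw [mul_assoc, σ.mul_ne le_rfl h ha]; simp⟩

theorem exists_coeff (i j : P) (r : R) : ∃ c : k, (i ≤ j → σ.p j j * r * σ.p i i = c • σ.p i j) ∧
    (¬ i ≤ j → σ.p j j * r * σ.p i i = 0) := by
  obtain ⟨c, hc⟩ := σ.exists_coeff_ite i j r
  exact ⟨c, fun h => by rw [hc, if_pos h], fun h => by rw [hc, if_neg h]⟩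

/-- The coefficient of an element of the algebra at `p i j`. -/
noncomputable def coeff (i j : P) (r : R) : k :=
  if i ≤ j ∧ σ.p i j ≠ 0 then (σ.exists_coeff i j r).choose else 0

theorem coeff_spec {i j : P} (h : i ≤ j) (r : R) :
    σ.p j j * r * σ.p i i = σ.coeff i j r • σ.p i j := by
  have := (σ.exists_coeff i j r).choose_spec.1 h
  unfold coeff
  split_ifs with h1
  · exact this
  · rw [this]
    have : σ.p i j = 0 := by simpa [h] using h1
    simp [this]

theorem coeff_unique {i j : P} (h : i ≤ j) (h0 : σ.p i j ≠ 0) {r : R} {c : k}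
    (hc : σ.p j j * r * σ.p i i = c • σ.p i j) : σ.coeff i j r = c := by
  rw [σ.coeff_spec h] at hc
  exact smul_left_injective k h0 hc

theorem coeff_not_le {i j : P} (h : ¬ i ≤ j) (r : R) : σ.coeff i j r = 0 := by
  simp [coeff, h]

theorem coeff_eq_zero {i j : P} (h0 : σ.p i j = 0) (r : R) : σ.coeff i j r = 0 := by
  simp [coeff, h0]

theorem coeff_add (i j : P) (r s : R) : σ.coeff i j (r + s) = σ.coeff i j r + σ.coeff i j s := by
  by_cases h : i ≤ j
  · by_cases h0 : σ.p i j = 0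
    · simp [σ.coeff_eq_zero h0]
    · apply σ.coeff_unique h h0
      rw [mul_add, add_mul, add_smul, σ.coeff_spec h, σ.coeff_spec h]
  · simp [σ.coeff_not_le h]

theorem coeff_zero (i j : P) : σ.coeff i j 0 = 0 := by
  have := σ.coeff_add i j 0 0
  simpa using this

theorem coeff_algebraMap {i : P} (h0 : σ.p i i ≠ 0) (c : k) :
    σ.coeff i i (algebraMap k R c) = c := by
  apply σ.coeff_unique le_rfl h0
  rw [← Algebra.commutes, mul_assoc, σ.mul_same le_rfl le_rfl, Algebra.smul_def]

theorem coeff_mul {i l : P} (h : i ≤ l) (h0 : σ.p i l ≠ 0) (r s : R) :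
    σ.coeff i l (r * s) = ∑ j, σ.coeff j l r * σ.coeff i j s := by
  apply σ.coeff_unique h h0
  have e : r * s = ∑ j, r * (σ.p j j * σ.p j j) * s := by
    rw [← Finset.sum_mul, ← Finset.mul_sum]
    simp only [σ.mul_same le_rfl le_rfl]
    rw [σ.sum_one, mul_one]
  rw [e, Finset.mul_sum, Finset.sum_mul, Finset.sum_smul]
  refine Finset.sum_congr rfl fun j _ => ?_
  have e2 : σ.p l l * (r * (σ.p j j * σ.p j j) * s) * σ.p i i =
      (σ.p l l * r * σ.p j j) * (σ.p j j * s * σ.p i i) := by simp only [mul_assoc]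
  rw [e2]
  by_cases h1 : i ≤ j
  · by_cases h2 : j ≤ l
    · rw [σ.coeff_spec h1, σ.coeff_spec h2, smul_mul_smul_comm, σ.mul_same h1 h2]
    · have := (σ.exists_coeff j l r).choose_spec.2 h2
      rw [this, σ.coeff_not_le h2]; simp
  · have := (σ.exists_coeff i j s).choose_spec.2 h1
    rw [this, σ.coeff_not_le h1]; simp

variable (X : Rep k P)

/-- The structure map of a representation, or zero. -/
noncomputable def mapOrZero (i j : P) : X.V i →ₗ[k] X.V j := if h : i ≤ j then X.map h else 0

omit [Fintype P] in
theorem mapOrZero_of_le {i j : P} (h : i ≤ j) : mapOrZero X i j = X.map h := dif_pos h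

/-- The action of an algebra element on the total space of a representation. -/
noncomputable def act (r : R) : (∀ i, X.V i) →ₗ[k] (∀ i, X.V i) :=
  LinearMap.pi fun l => ∑ i, σ.coeff i l r • (mapOrZero X i l).comp (LinearMap.proj i)

theorem act_apply (r : R) (x : ∀ i, X.V i) (l : P) :
    σ.act X r x l = ∑ i, σ.coeff i l r • mapOrZero X i l (x i) := by
  simp [act]

variable {X}

theorem ne_zero_of_supp (hX : X.SuppIn S) {i j : P} (h : i ≤ j) (x : X.V i) (y : X.V j)
    (hx : x ≠ 0) (hy : y ≠ 0) : σ.p i j ≠ 0 := by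
  apply σ.ne_zero h
  · by_contra hc; exact hx (hX i hc x)
  · by_contra hc; exact hy (hX j hc y)

theorem act_mul (hX : X.SuppIn S) (r s : R) (x : ∀ i, X.V i) :
    σ.act X (r * s) x = σ.act X r (σ.act X s x) := by
  funext l
  simp only [act_apply, map_sum, map_smul, Finset.smul_sum]
  rw [Finset.sum_comm]
  refine Finset.sum_congr rfl fun i _ => ?_
  have key : ∀ j, σ.coeff j l r • σ.coeff i j s • mapOrZero X j l (mapOrZero X i j (x i)) =
      (σ.coeff j l r * σ.coeff i j s) • mapOrZero X i l (x i) := by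
    intro j
    rw [← mul_smul]
    by_cases h1 : i ≤ j
    · by_cases h2 : j ≤ l
      · rw [mapOrZero_of_le X h1, mapOrZero_of_le X h2, mapOrZero_of_le X (h1.trans h2),
          X.map_map]
      · simp [σ.coeff_not_le h2]
    · simp [σ.coeff_not_le h1]
  rw [Finset.sum_congr rfl fun j _ => key j, ← Finset.sum_smul]
  by_cases h : i ≤ l
  · rw [mapOrZero_of_le X h]
    by_cases h0 : X.map h (x i) = 0
    · simp [h0]
    · rw [σ.coeff_mul h]
      refine σ.ne_zero_of_supp hX h (x i) _ (fun h' => h0 ?_) h0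
      rw [h', map_zero]
  · simp [mapOrZero, h]

theorem act_algebraMap (hX : X.SuppIn S) (c : k) (x : ∀ i, X.V i) :
    σ.act X (algebraMap k R c) x = c • x := by
  funext l
  rw [act_apply, Finset.sum_eq_single l]
  · rw [mapOrZero_of_le X le_rfl, X.map_refl, Pi.smul_apply]
    by_cases h0 : x l = 0
    · simp [h0]
    · rw [σ.coeff_algebraMap (σ.ne_zero_of_supp hX le_rfl (x l) _ h0 h0)]
  · intro i _ hi
    by_cases h : i ≤ l
    · by_cases h0 : σ.p i l = 0
      · simp [σ.coeff_eq_zero h0]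
      · have : σ.coeff i l (algebraMap k R c) = 0 := by
          apply σ.coeff_unique h h0
          rw [← Algebra.commutes, mul_assoc, σ.mul_ne le_rfl le_rfl hi, mul_zero, zero_smul]
        rw [this, zero_smul]
    · simp [σ.coeff_not_le h]
  · simp

theorem act_p (hX : X.SuppIn S) {i j : P} (h : i ≤ j) (x : ∀ i, X.V i) :
    σ.act X (σ.p i j) x = Pi.single j (X.map h (x i)) := by
  funext l
  rw [act_apply, Finset.sum_eq_single i]
  · by_cases hl : i ≤ l
    · rw [mapOrZero_of_le X hl]
      by_cases h0 : X.map hl (x i) = 0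
      · by_cases e : l = j
        · subst e; simp [h0]
        · simp [h0, Pi.single_eq_of_ne e]
      · have hne := σ.ne_zero_of_supp hX hl (x i) _ (fun h' => h0 (by rw [h', map_zero])) h0
        by_cases e : l = j
        · subst e
          have : σ.coeff i l (σ.p i l) = 1 := by
            apply σ.coeff_unique h hne
            rw [one_smul, σ.mul_same h le_rfl, σ.mul_same le_rfl h]
          rw [this, one_smul, Pi.single_eq_same]
        · have : σ.coeff i l (σ.p i j) = 0 := by
            apply σ.coeff_unique hl hne
            rw [zero_smul, σ.mul_ne h le_rfl (Ne.symm e), zero_mul]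
          rw [this, zero_smul, Pi.single_eq_of_ne e]
    · have e : l ≠ j := by rintro rfl; exact hl h
      rw [σ.coeff_not_le hl, zero_smul, Pi.single_eq_of_ne e]
  · intro a _ ha
    have : σ.coeff a l (σ.p i j) = 0 := by
      by_cases hl : a ≤ l
      · by_cases h0 : σ.p a l = 0
        · exact σ.coeff_eq_zero h0 _
        · apply σ.coeff_unique hl h0
          rw [zero_smul, mul_assoc, σ.mul_ne le_rfl h ha, mul_zero]
      · exact σ.coeff_not_le hl _
    rw [this, zero_smul]
  · simp

/-- The action as a ring homomorphism. -/
noncomputable def actHom (hX : X.SuppIn S) : R →+* Module.End k (∀ i, X.V i) where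
  toFun := σ.act X
  map_one' := by
    refine LinearMap.ext fun x => ?_
    have := σ.act_algebraMap hX 1 x
    rw [map_one, one_smul] at this
    rw [this]; rfl
  map_mul' r s := LinearMap.ext fun x => σ.act_mul hX r s x
  map_zero' := by
    refine LinearMap.ext fun x => funext fun l => ?_
    simp [act_apply, coeff_zero]
  map_add' r s := by
    refine LinearMap.ext fun x => funext fun l => ?_
    rw [LinearMap.add_apply, Pi.add_apply]
    simp only [act_apply, coeff_add, add_smul, Finset.sum_add_distrib]

/-- The module attached to a representation supported in `S`. -/
noncomputable def modOf (hX : X.SuppIn S) : ModuleCat.{0} R :=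
  letI : Module R (∀ i, X.V i) := Module.compHom _ (σ.actHom hX)
  ModuleCat.of R (∀ i, X.V i)

theorem modOf_ksmul (hX : X.SuppIn S) (c : k) (x : σ.modOf hX) :
    (c • x : σ.modOf hX) = (c • (show ∀ i, X.V i from x) : ∀ i, X.V i) := by
  rw [← algebraMap_smul R c x]
  exact σ.act_algebraMap hX c x

/-- The representation of the module attached to a representation is the original one. -/
noncomputable def repOfModOf (hX : X.SuppIn S) : X ≅ σ.functor.obj (σ.modOf hX) :=
  Rep.isoMk (fun i =>
    LinearEquiv.ofBijective (M := X.V i) (M₂ := (σ.repOf (σ.modOf hX)).V i)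
      { toFun := fun x => ⟨(Pi.single i x : ∀ i, X.V i), by
          change σ.act X (σ.p i i) _ = _
          rw [σ.act_p hX le_rfl, Pi.single_eq_same, X.map_refl]⟩
        map_add' := fun x y => Subtype.ext (Pi.single_add i x y)
        map_smul' := fun c x => Subtype.ext (by
          refine Eq.trans ?_ (σ.modOf_ksmul hX c _).symm
          exact Pi.single_smul i c x) }
      ⟨fun x y h => Pi.single_injective i (congrArg Subtype.val h), fun y => by
        have h : σ.act X (σ.p i i) y.1 = y.1 := y.2
        have h' := σ.act_p hX (le_refl i) y.1
        rw [X.map_refl] at h'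
        exact ⟨(show ∀ i, X.V i from y.1) i, Subtype.ext (h'.symm.trans h)⟩⟩)
    (fun {i j} hij x => Subtype.ext (by
      change (Pi.single j (X.map hij x) : ∀ i, X.V i) = σ.act X (σ.p i j) (Pi.single i x)
      rw [σ.act_p hX hij, Pi.single_eq_same]))

theorem suppIn_functor (M : ModuleCat.{0} R) : (σ.functor.obj M).SuppIn S := fun i hi x => by
  have h := σ.mem_repOf (M := M) x
  have h0 : σ.p i i • (x.1 : M) = 0 := 
    (congrArg (fun r : R => r • (x.1 : M)) (σ.zero_of_notMem hi)).trans (zero_smul R _)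
  exact Subtype.ext (h.symm.trans h0)

theorem ind_functor [FiniteDimensional k R] {M : ModuleCat.{0} R} (hM : FinIndec R M) :
    (σ.functor.obj M).Ind S := by
  refine ⟨fun i => ?_, (indecObj_map _ _).2 ((indec_iff M).1 hM.2), σ.suppIn_functor M⟩
  have := hM.1
  have : Module.Finite k M := Module.Finite.trans R M
  exact Module.Finite.of_surjective (σ.proj M i) fun x => ⟨x.1, Subtype.ext (σ.mem_repOf x)⟩

theorem finite_modOf (hX : X.SuppIn S) (hfd : X.FD) : Module.Finite R (σ.modOf hX) := by
  have : ∀ i, Module.Finite k (X.V i) := hfd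
  have h1 : Module.Finite k (σ.modOf hX) := by
    let e : (∀ i, X.V i) →ₗ[k] σ.modOf hX :=
      { toFun := fun x => x
        map_add' := fun _ _ => rfl
        map_smul' := fun c x => (σ.modOf_ksmul hX c x).symm }
    exact Module.Finite.of_surjective e fun x => ⟨x, rfl⟩
  exact Module.Finite.of_restrictScalars_finite k R _

theorem exists_finIndec (hX : X.Ind S) :
    ∃ M : ModuleCat.{0} R, FinIndec R M ∧ Nonempty (σ.functor.obj M ≅ X) :=
  ⟨σ.modOf hX.2.2, ⟨σ.finite_modOf hX.2.2 hX.1, (indec_iff _).2 ((indecObj_map σ.functor _).1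
    (indecObj_of_iso (σ.repOfModOf hX.2.2) hX.2.1))⟩, ⟨(σ.repOfModOf hX.2.2).symm⟩⟩

theorem radVanishes_iff_rep (σ : IncSys k R P S) [FiniteDimensional k R] (n : ℕ) :
    RadVanishes R n ↔ ∀ (X Y : Rep k P) (f : X ⟶ Y), Chain (Rep.Ind S) f n → f = 0 := by
  have : IsArtinianRing R := IsArtinianRing.of_finite k R
  rw [radVanishes_iff]
  constructor
  · intro h X Y f hf
    obtain ⟨M, hM, ⟨φ⟩⟩ := σ.exists_finIndec hf.left
    obtain ⟨N, ψ, c, hc, hc'⟩ := hf.lift σ.functor (fun X hX => σ.exists_finIndec hX) M hM φ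
    rw [h _ _ c hc, Functor.map_zero] at hc'
    have : φ.inv ≫ (φ.hom ≫ f ≫ ψ.inv) ≫ ψ.hom = 0 := by rw [← hc']; simp
    simpa using this
  · intro h M N f hf
    apply σ.functor.map_injective
    rw [Functor.map_zero]
    exact h _ _ _ (hf.map σ.functor fun X hX => σ.ind_functor hX)

/-- A non-zero composite through a finite-dimensional representation stays non-zero after
passing through a suitable indecomposable summand. -/
theorem exists_ind_summand (σ : IncSys k R P S) [FiniteDimensional k R] {X Z Y : Rep k P} (hX : X.SuppIn S)
    (hY : Y.SuppIn S) (hZ : Z.SuppIn S)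
    (hfd : Z.FD) (f : X ⟶ Z) (g : Z ⟶ Y) (h : f ≫ g ≠ 0) :
    ∃ (M : Rep k P) (i : M ⟶ Z) (p : Z ⟶ M), M.Ind S ∧ i ≫ p = 𝟙 M ∧ f ≫ p ≫ i ≫ g ≠ 0 := by
  have : IsArtinianRing R := IsArtinianRing.of_finite k R
  have := σ.finite_modOf hZ hfd
  let φ := σ.repOfModOf hX
  let ψ := σ.repOfModOf hY
  let θ := σ.repOfModOf hZ
  let f' := σ.functor.preimage (φ.inv ≫ f ≫ θ.hom)
  let g' := σ.functor.preimage (θ.inv ≫ g ≫ ψ.hom)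
  obtain ⟨M, i, p, hM, hip, hne⟩ := exists_indec_summand f' g' (fun h0 => h (by
    have h1 : σ.functor.map (f' ≫ g') = 0 := by rw [h0, Functor.map_zero]
    simp only [f', g', Functor.map_comp, Functor.map_preimage] at h1
    have h2 : φ.hom ≫ ((φ.inv ≫ f ≫ θ.hom) ≫ θ.inv ≫ g ≫ ψ.hom) ≫ ψ.inv = 0 := by
      rw [h1]; simp
    simpa using h2))
  have hfin : FinIndec R M := by
    refine ⟨Module.Finite.of_surjective p.hom fun x => ⟨i x, ?_⟩, (indec_iff _).2 hM⟩
    exact congrArg (fun r : M ⟶ M => r x) hip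
  refine ⟨σ.functor.obj M, σ.functor.map i ≫ θ.inv, θ.hom ≫ σ.functor.map p,
    σ.ind_functor hfin, ?_, ?_⟩
  · simp [← Functor.map_comp, hip]
  · intro h0
    apply hne
    apply σ.functor.map_injective
    simp only [f', g', Functor.map_comp, Functor.map_preimage, Functor.map_zero]
    have h2 : φ.inv ≫ (f ≫ (θ.hom ≫ σ.functor.map p) ≫ (σ.functor.map i ≫ θ.inv) ≫ g) ≫ ψ.hom
        = 0 := by
      rw [h0]; simp
    simpa using h2

end IncSys


/-! ## Duality -/

namespace Rep

variable {k P : Type} [Field k] [PartialOrder P] {ρ : P → P}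
  (hρ : ∀ {i j : P}, i ≤ j → ρ j ≤ ρ i) (hinv : ∀ i, ρ (ρ i) = i)

/-- The dual representation along an order-reversing map. -/
def dual (X : Rep k P) : Rep k P where
  V i := Module.Dual k (X.V (ρ i))
  map h := (X.map (hρ h)).dualMap
  map_refl i l := by ext x; simp [LinearMap.dualMap_apply]
  map_map h h' l := by ext x; simp [LinearMap.dualMap_apply]

/-- A vector of the dual representation, as a linear form. -/
def ev {X : Rep k P} {i : P} (l : (dual hρ X).V i) : Module.Dual k (X.V (ρ i)) := l

/-- The dual of a morphism. -/
def dualHom {X Y : Rep k P} (f : X ⟶ Y) : dual hρ Y ⟶ dual hρ X where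
  app i := (f.app (ρ i)).dualMap
  nat {i j} h l := by
    refine LinearMap.ext fun x => ?_
    change ev hρ l (Y.map _ (f.app (ρ j) x)) = ev hρ l (f.app (ρ i) (X.map _ x))
    rw [f.nat]

theorem dualHom_id (X : Rep k P) : dualHom hρ (𝟙 X) = 𝟙 (dual hρ X) := rfl

theorem dualHom_comp {X Y Z : Rep k P} (f : X ⟶ Y) (g : Y ⟶ Z) :
    dualHom hρ (f ≫ g) = dualHom hρ g ≫ dualHom hρ f := rfl

theorem dualHom_zero (X Y : Rep k P) : dualHom hρ (0 : X ⟶ Y) = 0 := by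
  ext i l
  refine LinearMap.ext fun x => ?_
  exact map_zero (ev hρ l)

theorem dual_separates (k : Type) [Field k] {V : Type} [AddCommGroup V] [Module k V] {x y : V}
    (h : ∀ l : Module.Dual k V, l x = l y) : x = y := by
  rw [← sub_eq_zero, ← Module.forall_dual_apply_eq_zero_iff k]
  intro l
  rw [map_sub, h l, sub_self]

include hinv in
theorem dualHom_injective {X Y : Rep k P} {f g : X ⟶ Y} (h : dualHom hρ f = dualHom hρ g) :
    f = g := by
  ext i x
  obtain ⟨j, rfl⟩ : ∃ j, ρ j = i := ⟨_, hinv i⟩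
  refine dual_separates k fun l => ?_
  exact congrArg (fun q : dual hρ Y ⟶ dual hρ X => ev hρ (q.app j l) x) h

theorem exists_dualMap_eq {V W : Type} [AddCommGroup V] [Module k V] [AddCommGroup W] [Module k W]
    [Module.Finite k W] (g : Module.Dual k W →ₗ[k] Module.Dual k V) :
    ∃ φ : V →ₗ[k] W, ∀ l x, l (φ x) = g l x := by
  refine ⟨(Module.evalEquiv k W).symm.toLinearMap.comp (g.dualMap.comp (Module.Dual.eval k V)),
    fun l x => ?_⟩
  simp [LinearMap.dualMap_apply]

include hinv in
theorem dualHom_surjective {X Y : Rep k P} (hY : Y.FD) (g : dual hρ Y ⟶ dual hρ X) :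
    ∃ f : X ⟶ Y, dualHom hρ f = g := by
  have : ∀ i, Module.Finite k (Y.V i) := hY
  choose φ hφ using fun i => exists_dualMap_eq
    (show Module.Dual k (Y.V (ρ i)) →ₗ[k] Module.Dual k (X.V (ρ i)) from g.app i)
  have nat : ∀ {v v' : P} (h : v ≤ v') (x : X.V (ρ v')),
      φ v (X.map (hρ h) x) = Y.map (hρ h) (φ v' x) := by
    intro v v' h x
    refine dual_separates k fun l => ?_
    rw [hφ]
    refine Eq.trans ?_ (hφ v' ((dual hρ Y).map h l) x).symm
    exact congrArg (fun q : Module.Dual k (X.V (ρ v')) => q x) (nat_apply g h l).symm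
  refine ⟨⟨fun w => (Y.map (hinv w).le).comp ((φ (ρ w)).comp (X.map (hinv w).ge)),
    fun {w w'} h x => ?_⟩, ?_⟩
  · change Y.map _ (φ _ (X.map _ (X.map _ x))) = Y.map _ (Y.map _ (φ _ (X.map _ x)))
    have e : X.map (hinv w').ge (X.map h x) = X.map (hρ (hρ h)) (X.map (hinv w).ge x) := by
      simp
    rw [e, nat (hρ h)]
    simp
  · ext v l
    refine LinearMap.ext fun x => ?_
    change ev hρ l (Y.map _ (φ _ (X.map _ x))) = _
    rw [← nat (hinv v).ge, X.map_map, X.map_refl]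
    exact hφ v l x

variable {S : Set P}

theorem dual_fd {X : Rep k P} (hX : X.FD) : (dual hρ X).FD := fun i => by
  have := hX (ρ i)
  change Module.Finite k (Module.Dual k (X.V (ρ i)))
  infer_instance

include hinv in
theorem dual_indecObj {X : Rep k P} (hX : X.FD) (h : IndecObj X) : IndecObj (dual hρ X) := by
  refine ⟨fun h0 => h.1 ?_, fun e he => ?_⟩
  · apply dualHom_injective hρ hinv
    rw [dualHom_id, h0, dualHom_zero]
  · obtain ⟨f, rfl⟩ := dualHom_surjective hρ hinv hX e
    rw [← dualHom_comp] at he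
    rcases h.2 f (dualHom_injective hρ hinv he) with rfl | rfl
    · left; exact dualHom_zero hρ _ _
    · right; rfl

include hinv in
theorem isIso_of_dualHom {X Y : Rep k P} (hX : X.FD) (f : X ⟶ Y)
    (h : IsIso (dualHom hρ f)) : IsIso f := by
  obtain ⟨g, hg⟩ := dualHom_surjective hρ hinv hX (inv (dualHom hρ f))
  refine ⟨g, dualHom_injective hρ hinv ?_, dualHom_injective hρ hinv ?_⟩
  · rw [dualHom_comp, hg, IsIso.inv_hom_id, dualHom_id]
  · rw [dualHom_comp, hg, IsIso.hom_inv_id, dualHom_id]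

theorem isIso_dualHom {X Y : Rep k P} (f : X ⟶ Y) (h : IsIso f) : IsIso (dualHom hρ f) :=
  ⟨dualHom hρ (inv f), by rw [← dualHom_comp, IsIso.inv_hom_id, dualHom_id],
    by rw [← dualHom_comp, IsIso.hom_inv_id, dualHom_id]⟩

include hinv in
theorem dual_ind {X : Rep k P} (h : X.Ind S) : (dual hρ X).Ind (ρ ⁻¹' S) := by
  refine ⟨dual_fd hρ h.1, dual_indecObj hρ hinv h.1 h.2.1, fun i hi l => ?_⟩
  refine LinearMap.ext fun x => ?_
  change ev hρ l x = 0
  rw [h.2.2 _ hi x]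
  exact map_zero (ev hρ l)

include hinv in
theorem dual_chain {X Y : Rep k P} {f : X ⟶ Y} {n : ℕ} (h : Chain (Ind S) f n) :
    Chain (Ind (ρ ⁻¹' S)) (dualHom hρ f) n := by
  induction h with
  | nil f h1 h2 h3 => exact .nil _ (dual_ind hρ hinv h2) (dual_ind hρ hinv h1) (isIso_dualHom hρ f h3)
  | cons f g h1 h2 h3 ih =>
    rw [dualHom_comp]
    exact ih.snoc _ (dual_ind hρ hinv h1) fun hi => h2 (isIso_of_dualHom hρ hinv h1.1 f hi)

end Rep


/-! ## The poset of vertices of a toupie quiver -/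

/-- The vertices of a toupie quiver: source `a`, sink `b`, and `m i l` on the branch `i`,
at distance `l + 1` from the sink. -/
inductive Vtx (n : Fin 3 → ℕ) : Type
  | a : Vtx n
  | m (i : Fin 3) (l : ℕ) (h : l < n i) : Vtx n
  | b : Vtx n

namespace Vtx

variable {n : Fin 3 → ℕ}

/-- The path order: `u ≤ v` if there is a path from `u` to `v`. -/
def Le : Vtx n → Vtx n → Prop
  | a, _ => True
  | _, b => True
  | m i l _, m i' l' _ => i = i' ∧ l' ≤ l
  | _, _ => False

instance : PartialOrder (Vtx n) where
  le := Le
  le_refl v := by cases v <;> simp [Le]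
  le_trans u v w h h' := by
    cases u <;> cases v <;> cases w <;> first
      | trivial
      | exact (id h : False).elim
      | exact (id h' : False).elim
      | exact ⟨h.1.trans h'.1, h'.2.trans h.2⟩
  le_antisymm u v h h' := by
    cases u <;> cases v <;> first
      | rfl
      | exact (id h : False).elim
      | exact (id h' : False).elim
      | skip
    obtain ⟨rfl, h1⟩ := h
    obtain rfl := le_antisymm h1 h'.2
    rfl

theorem a_le (v : Vtx n) : a ≤ v := by cases v <;> trivial

theorem le_b (v : Vtx n) : v ≤ b := by cases v <;> trivial

theorem m_le_m {i : Fin 3} {l l' : ℕ} {h : l < n i} {h' : l' < n i} (hl : l' ≤ l) :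
    m i l h ≤ m i l' h' := ⟨rfl, hl⟩

theorem m_le_m_iff {i i' : Fin 3} {l l' : ℕ} {h : l < n i} {h' : l' < n i'} :
    m i l h ≤ m i' l' h' ↔ i = i' ∧ l' ≤ l := Iff.rfl

theorem not_m_le_a {i : Fin 3} {l : ℕ} {h : l < n i} : ¬ m i l h ≤ a := id

theorem not_b_le_m {i : Fin 3} {l : ℕ} {h : l < n i} : ¬ b ≤ m i l h := id

theorem not_b_le_a : ¬ (b : Vtx n) ≤ a := id

noncomputable instance : Fintype (Vtx n) :=
  Fintype.ofInjective (β := Option (Option (Σ i : Fin 3, Fin (n i))))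
    (fun v => match v with
      | a => none
      | b => some none
      | m i l h => some (some ⟨i, l, h⟩))
    (by
      intro u v h
      cases u <;> cases v <;> simp_all
      obtain ⟨rfl, h⟩ := h
      simpa using h)

/-- The vertex of the branch `i` at distance `l` from the sink. -/
def lv (n : Fin 3 → ℕ) (i : Fin 3) : ℕ → Vtx n
  | 0 => b
  | l + 1 => if h : l < n i then m i l h else a

@[simp] theorem lv_zero (i : Fin 3) : lv n i 0 = b := rfl

theorem lv_succ {i : Fin 3} {l : ℕ} (h : l < n i) : lv n i (l + 1) = m i l h := dif_pos h

theorem lv_top (i : Fin 3) : lv n i (n i + 1) = a := dif_neg (lt_irrefl _)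

theorem lv_anti (i : Fin 3) {l l' : ℕ} (h : l ≤ l') : lv n i l' ≤ lv n i l := by
  cases l with
  | zero => exact le_b _
  | succ l =>
    cases l' with
    | zero => omega
    | succ l' =>
      simp only [lv]
      split_ifs with h1 h2
      · exact m_le_m (by omega)
      · omega
      · exact a_le _
      · exact le_rfl

/-- The order-reversing involution of the vertices. -/
def rev : Vtx n → Vtx n
  | a => b
  | b => a
  | m i l h => m i (n i - 1 - l) (by omega)

theorem rev_anti {u v : Vtx n} (h : u ≤ v) : rev v ≤ rev u := by
  cases u <;> cases v <;> first | exact le_b _ | exact a_le _ | exact (id h : False).elim | skip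
  obtain ⟨rfl, h⟩ := h
  exact m_le_m (by omega)

theorem rev_rev (v : Vtx n) : rev (rev v) = v := by
  cases v with
  | a => rfl
  | b => rfl
  | m i l h =>
    simp only [rev, m.injEq, true_and]
    omega

end Vtx

/-! ## Indecomposable representations of the toupie poset -/

namespace Rep

open Vtx

variable {k : Type} [Field k] {n : Fin 3 → ℕ}

theorem exists_form {V : Type} [AddCommGroup V] [Module k V] {x : V} (hx : x ≠ 0) :
    ∃ l : V →ₗ[k] k, l x = 1 := by
  obtain ⟨l, hl⟩ : ∃ l : Module.Dual k V, l x ≠ 0 := by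
    by_contra hc
    push Not at hc
    exact hx ((Module.forall_dual_apply_eq_zero_iff k x).1 hc)
  exact ⟨(l x)⁻¹ • l, by simp [hl]⟩

theorem exists_section_succ {U U' T : Type} [AddCommGroup U] [Module k U] [AddCommGroup U']
    [Module k U'] [AddCommGroup T] [Module k T] (f : U →ₗ[k] U') (π : U →ₗ[k] T)
    (π' : U' →ₗ[k] T) (hf : ∀ x, π' (f x) = π x) (s : T →ₗ[k] U) (hs : ∀ x, π (s (π x)) = π x) :
    ∃ s' : T →ₗ[k] U', (∀ x, π' (s' (π' x)) = π' x) ∧ ∀ x, f (s (π x)) = s' (π x) := by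
  obtain ⟨g0, hg0⟩ := π'.rangeRestrict.exists_rightInverse_of_surjective
    (LinearMap.range_rangeRestrict π')
  obtain ⟨g, hg⟩ := LinearMap.exists_extend g0
  obtain ⟨p, hp⟩ := LinearMap.exists_extend (LinearMap.id : LinearMap.range π →ₗ[k] _)
  have hg' : ∀ x, π' (g (π' x)) = π' x := fun x => by
    have h1 : g (π' x) = g0 ⟨π' x, x, rfl⟩ := LinearMap.congr_fun hg ⟨π' x, x, rfl⟩
    rw [h1]
    exact congrArg Subtype.val (LinearMap.congr_fun hg0 ⟨π' x, x, rfl⟩)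
  have hp' : ∀ x, (p (π x) : T) = π x := fun x =>
    congrArg Subtype.val (LinearMap.congr_fun hp ⟨π x, x, rfl⟩)
  let q : T →ₗ[k] T := (LinearMap.range π).subtype.comp p
  have hq : ∀ x, q (π x) = π x := hp'
  have hqr : ∀ y, ∃ z, q y = π z := fun y => by
    obtain ⟨z, hz⟩ := (p y).2
    exact ⟨z, hz.symm⟩
  refine ⟨f.comp (s.comp q) + g.comp (LinearMap.id - q), fun x => ?_, fun x => ?_⟩
  · obtain ⟨z, hz⟩ := hqr (π' x)
    have e : π' x - q (π' x) = π' (x - f z) := by rw [map_sub, hf, hz]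
    simp only [LinearMap.add_apply, LinearMap.comp_apply, LinearMap.sub_apply, LinearMap.id_apply,
      map_add]
    rw [e, hg', hz, hf, hs, map_sub, hf]
    abel
  · simp [hq]

theorem exists_sections_of_tower {T : Type} [AddCommGroup T] [Module k T] {U : ℕ → Type}
    [∀ l, AddCommGroup (U l)] [∀ l, Module k (U l)] (F : ∀ l, U (l + 1) →ₗ[k] U l)
    (π : ∀ l, U l →ₗ[k] T) (hF : ∀ l x, π l (F l x) = π (l + 1) x) (N : ℕ)
    (hN : ∀ l, N ≤ l → π l = 0) :
    ∃ s : ∀ l, T →ₗ[k] U l, ∀ l, (∀ x, π l (s l (π l x)) = π l x) ∧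
      ∀ x, F l (s (l + 1) (π (l + 1) x)) = s l (π (l + 1) x) := by
  have key : ∀ d : ℕ, ∃ s : ∀ l, T →ₗ[k] U l, ∀ l, N ≤ l + d →
      (∀ x, π l (s l (π l x)) = π l x) ∧
      ∀ x, F l (s (l + 1) (π (l + 1) x)) = s l (π (l + 1) x) := by
    intro d
    induction d with
    | zero =>
      refine ⟨fun _ => 0, fun l hl => ⟨fun x => ?_, fun x => ?_⟩⟩
      · simp [hN l hl]
      · simp
    | succ d ih =>
      obtain ⟨s, hs⟩ := ih
      by_cases hd : N ≤ d
      · exact ⟨s, fun l _ => hs l (by omega)⟩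
      obtain ⟨l₀, hl₀⟩ : ∃ l₀, l₀ + d + 1 = N := ⟨N - d - 1, by omega⟩
      obtain ⟨s', h1, h2⟩ := exists_section_succ (F l₀) (π (l₀ + 1)) (π l₀) (hF l₀) (s (l₀ + 1))
        (hs (l₀ + 1) (by omega)).1
      refine ⟨Function.update s l₀ s', fun l hl => ?_⟩
      by_cases e : l = l₀
      · subst e
        rw [Function.update_self, Function.update_of_ne (by omega)]
        exact ⟨h1, h2⟩
      · rw [Function.update_of_ne e, Function.update_of_ne (by omega)]
        exact hs l (by omega)
  obtain ⟨s, hs⟩ := key N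
  exact ⟨s, fun l => hs l (by omega)⟩

theorem lv_of_gt {i : Fin 3} {l : ℕ} (h : n i + 1 ≤ l) : lv n i l = a := by
  cases l with
  | zero => omega
  | succ l => exact dif_neg (by omega)

/-- Compatible sections along a branch. -/
theorem exists_sections (X : Rep k (Vtx n)) (h0 : ∀ x, X.map (a_le b) x = 0) (i : Fin 3) :
    ∃ s : ∀ l, X.V b →ₗ[k] X.V (lv n i l),
      (∀ l (x : X.V (lv n i l)), X.map (le_b _) (s l (X.map (le_b _) x)) = X.map (le_b _) x) ∧
      ∀ l l' (h : l ≤ l') (x : X.V (lv n i l')),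
        X.map (lv_anti i h) (s l' (X.map (le_b _) x)) = s l (X.map (le_b _) x) := by
  obtain ⟨s, hs⟩ := exists_sections_of_tower (fun l => X.map (lv_anti i (Nat.le_succ l)))
    (fun l => X.map (le_b (lv n i l))) (fun l x => by simp) (n i + 1) (fun l hl => by
      ext x
      have h1 : lv n i l ≤ a := (lv_of_gt hl).le
      have h2 : X.map (le_b (lv n i l)) x = X.map (a_le b) (X.map h1 x) := by simp
      rw [h2, h0]; rfl)
  refine ⟨s, fun l => (hs l).1, fun l l' h => ?_⟩
  induction l', h using Nat.le_induction with
  | base => intro x; simp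
  | succ l' hl ih =>
    intro x
    have e1 := (hs l').2 x
    have e2 : X.map (lv_anti i (by omega : l ≤ l' + 1)) (s (l' + 1) (X.map (le_b _) x)) =
        X.map (lv_anti i hl) (X.map (lv_anti i (Nat.le_succ l'))
          (s (l' + 1) (X.map (le_b _) x))) := by simp
    rw [e2, e1]
    have e3 : X.map (le_b _) x = X.map (le_b _) (X.map (lv_anti i (Nat.le_succ l')) x) := by simp
    rw [e3, ih]

theorem IndecObj.eq_id {P : Type} [PartialOrder P] {X : Rep k P} (hX : IndecObj X) (e : X ⟶ X)
    (he : ∀ v x, e.app v (e.app v x) = e.app v x) {v : P} {x : X.V v} (hx : e.app v x ≠ 0) :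
    ∀ v x, e.app v x = x := by
  rcases hX.2 e (by ext v x; exact he v x) with rfl | rfl
  · exact absurd rfl hx
  · intro v x; rfl

/-- The case where the sink is in the support but the total map vanishes. -/
theorem injective_of_comp_eq_zero {X : Rep k (Vtx n)} (hX : IndecObj X)
    (h0 : ∀ x, X.map (a_le b) x = 0) {y : X.V b} (hy : y ≠ 0) (v : Vtx n) :
    Function.Injective (X.map (le_b v)) := by
  choose s hs1 hs2 using exists_sections X h0
  have hm : ∀ (i l) (h : l < n i), ∃ t : X.V b →ₗ[k] X.V (m i l h), ∀ x, t x =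
      X.map (lv_succ h).le (s i (l + 1) x) := fun i l h => ⟨_, fun x =>
        LinearMap.comp_apply (X.map (lv_succ h).le) (s i (l + 1)) x⟩
  choose t ht using hm
  have ht1 : ∀ i l h (x : X.V (m i l h)), X.map (le_b _) (t i l h (X.map (le_b _) x)) = X.map (le_b _) x := by
    intro i l h x
    have e : X.map (le_b _) x = X.map (le_b _) (X.map (lv_succ h).ge x) := by simp
    rw [ht, X.map_map, e, hs1]
  have ht2 : ∀ i l h l' h' (hl : l' ≤ l) (x : X.V (m i l h)), X.map (m_le_m hl : _ ≤ m i l' h')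
      (t i l h (X.map (le_b _) x)) = t i l' h' (X.map (le_b _) x) := by
    intro i l h l' h' hl x
    have e : X.map (le_b _) x = X.map (le_b _) (X.map (lv_succ h).ge x) := by simp
    rw [ht, ht, X.map_map, e, ← hs2 i (l' + 1) (l + 1) (by omega), X.map_map, X.map_map]
  let e : X ⟶ X := ⟨fun v => match v with
    | a => 0
    | m i l h => (t i l h).comp (X.map (le_b _))
    | b => LinearMap.id, by
      intro u v huv x
      cases u with
      | a =>
        cases v with
        | a => simp
        | b =>
          have := h0 x
          simpa using this
        | m i l h =>
          have := h0 x
          simp [this]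
      | b =>
        cases v with
        | a => exact huv.elim
        | m i l h => exact huv.elim
        | b => simp
      | m i l h =>
        cases v with
        | a => exact huv.elim
        | b =>
          change X.map _ x = X.map _ (t i l h (X.map _ x))
          rw [ht1]
        | m i' l' h' =>
          obtain ⟨rfl, hl⟩ := id huv
          change t i l' h' (X.map _ (X.map _ x)) = X.map _ (t i l h (X.map _ x))
          have e1 : X.map (le_b _) (X.map huv x) = X.map (le_b _) x := X.map_map _ _ _
          rw [e1]
          exact (ht2 i l h l' h' hl x).symm⟩
  have he : ∀ v x, e.app v x = x := by
    refine IndecObj.eq_id hX e (fun v x => ?_) (v := b) (x := y) hy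
    cases v with
    | a => rfl
    | b => rfl
    | m i l h =>
      change t i l h (X.map _ (t i l h (X.map _ x))) = t i l h (X.map _ x)
      rw [ht1]
  intro x x' hxx
  cases v with
  | a => rw [← he a x, ← he a x']; rfl
  | b => simpa using hxx
  | m i l h =>
    rw [← he _ x, ← he _ x']
    change t i l h (X.map _ x) = t i l h (X.map _ x')
    rw [hxx]

end Rep


namespace Rep

open Vtx

section General

variable {k P : Type} [Field k] [PartialOrder P]

/-- `X` is a thin representation supported on the interval from `p` to `q`. -/
def IsInterval (X : Rep k P) (p q : P) : Prop :=
  ∃ x : X.V p, (∀ v (hp : p ≤ v), v ≤ q →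
      X.map hp x ≠ 0 ∧ ∀ y : X.V v, ∃ c : k, y = c • X.map hp x) ∧
    ∀ v, ¬ (p ≤ v ∧ v ≤ q) → ∀ y : X.V v, y = 0

theorem isInterval_of_map_ne_zero {X : Rep k P} (hX : IndecObj X) {p q : P} (hpq : p ≤ q)
    {x : X.V p} (hx : X.map hpq x ≠ 0)
    (h1 : ∀ v (h : p ≤ v), ¬ v ≤ q → X.map h x = 0)
    (h2 : ∀ v (h : v ≤ q) (y : X.V v), ¬ p ≤ v → X.map h y = 0) : IsInterval X p q := by
  obtain ⟨l, hl⟩ := exists_form (k := k) hx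
  let e0 : ∀ v, X.V v →ₗ[k] X.V v := fun v => if h : p ≤ v ∧ v ≤ q then
    (LinearMap.toSpanSingleton k _ (X.map h.1 x)).comp (l.comp (X.map h.2)) else 0
  have e0_in : ∀ {v} (h : p ≤ v) (h' : v ≤ q) (y : X.V v),
      e0 v y = l (X.map h' y) • X.map h x := fun h h' y => by
    simp only [e0]
    rw [dif_pos ⟨h, h'⟩]; rfl
  have e0_out : ∀ {v} (h : ¬ (p ≤ v ∧ v ≤ q)) (y : X.V v), e0 v y = 0 := fun h y => by
    simp only [e0]
    rw [dif_neg h]; rfl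
  let e : X ⟶ X := ⟨e0, fun {u v} h y => by
    by_cases hu : p ≤ u ∧ u ≤ q
    · rw [e0_in hu.1 hu.2, map_smul, X.map_map]
      by_cases hv : v ≤ q
      · rw [e0_in (hu.1.trans h) hv, X.map_map]
      · rw [e0_out (fun h => hv h.2), h1 _ _ hv, smul_zero]
    · rw [e0_out hu, map_zero]
      by_cases hv : p ≤ v ∧ v ≤ q
      · rw [e0_in hv.1 hv.2, X.map_map, h2 _ _ _ fun h' => hu ⟨h', h.trans hv.2⟩, map_zero,
          zero_smul]
      · rw [e0_out hv]⟩
  have he : ∀ v y, e0 v y = y := by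
    refine IndecObj.eq_id hX e (fun v y => ?_) (v := q) (x := X.map hpq x) ?_
    · change e0 v (e0 v y) = e0 v y
      by_cases hv : p ≤ v ∧ v ≤ q
      · rw [e0_in hv.1 hv.2, e0_in hv.1 hv.2, map_smul, X.map_map, map_smul, hl, smul_eq_mul,
          mul_one]
      · rw [e0_out hv, e0_out hv]
    · change e0 q _ ≠ 0
      rw [e0_in hpq le_rfl, X.map_map, hl, one_smul]
      exact hx
  refine ⟨x, fun v hp hv => ⟨fun h => hx ?_, fun y => ⟨l (X.map hv y), ?_⟩⟩, fun v hv y => ?_⟩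
  · rw [← X.map_map hp hv, h, map_zero]
  · rw [← e0_in hp hv, he]
  · rw [← he v y, e0_out hv]

theorem IsInterval.le {X : Rep k P} {p q : P} (hX : IndecObj X) (h : IsInterval X p q) :
    p ≤ q := by
  obtain ⟨x, h1, h2⟩ := h
  by_contra hpq
  refine hX.1 ?_
  ext v y
  exact (h2 v (fun h => hpq (h.1.trans h.2)) y).trans rfl

/-- A morphism of thin representations which is non-zero at some vertex. -/
theorem IsInterval.of_ne_zero {X Y : Rep k P} {p q p' q' v : P} (hX : IsInterval X p q)
    (hY : IsInterval Y p' q') (f : X ⟶ Y) {y : X.V v} (hy : f.app v y ≠ 0) :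
    (p ≤ v ∧ v ≤ q) ∧ (p' ≤ v ∧ v ≤ q') ∧ p' ≤ p ∧ q' ≤ q := by
  obtain ⟨x, h1, h2⟩ := hX
  obtain ⟨x', h1', h2'⟩ := hY
  have hv : p ≤ v ∧ v ≤ q := by
    by_contra hv
    rw [h2 v hv y, map_zero] at hy
    exact hy rfl
  have hv' : p' ≤ v ∧ v ≤ q' := by
    by_contra hv'
    exact hy (h2' v hv' _)
  refine ⟨hv, hv', ?_, ?_⟩
  · by_contra hp
    obtain ⟨c, rfl⟩ := (h1 v hv.1 hv.2).2 y
    rw [map_smul, nat_apply, h2' p (fun h => hp h.1) (f.app p x), map_zero, smul_zero] at hy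
    exact hy rfl
  · by_contra hq
    obtain ⟨c, hc⟩ := (h1' v hv'.1 hv'.2).2 (f.app v y)
    have h3 : Y.map hv'.2 (f.app v y) = 0 := by
      rw [← nat_apply, h2 _ (fun h => hq h.2) (X.map hv'.2 y), map_zero]
    rw [hc, map_smul, Y.map_map] at h3
    rcases smul_eq_zero.1 h3 with h3 | h3
    · rw [h3, zero_smul] at hc
      exact hy hc
    · exact (h1' q' (hv'.1.trans hv'.2) le_rfl).1 h3

theorem IsInterval.isIso {X Y : Rep k P} {p q v : P} (hX : IsInterval X p q)
    (hY : IsInterval Y p q) (f : X ⟶ Y) {y : X.V v} (hy : f.app v y ≠ 0) : IsIso f := by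
  have hv := (hX.of_ne_zero hY f hy).1
  obtain ⟨x, h1, h2⟩ := hX
  obtain ⟨x', h1', h2'⟩ := hY
  obtain ⟨c, hc⟩ := (h1' p le_rfl (hv.1.trans hv.2)).2 (f.app p x)
  rw [Y.map_refl] at hc
  have key : ∀ w (hw : p ≤ w), f.app w (X.map hw x) = c • Y.map hw x' := fun w hw => by
    rw [nat_apply, hc, map_smul]
  have hc0 : c ≠ 0 := by
    rintro rfl
    obtain ⟨d, rfl⟩ := (h1 v hv.1 hv.2).2 y
    rw [map_smul, key, zero_smul, smul_zero] at hy
    exact hy rfl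
  rw [isIso_iff]
  intro w
  by_cases hw : p ≤ w ∧ w ≤ q
  · obtain ⟨-, h3⟩ := h1 w hw.1 hw.2
    obtain ⟨h4, h5⟩ := h1' w hw.1 hw.2
    refine ⟨(injective_iff_map_eq_zero _).2 fun z hz => ?_, fun z => ?_⟩
    · obtain ⟨d, rfl⟩ := h3 z
      rw [map_smul, key, smul_smul] at hz
      rcases smul_eq_zero.1 hz with hz | hz
      · rcases mul_eq_zero.1 hz with hz | hz
        · rw [hz, zero_smul]
        · exact absurd hz hc0
      · exact absurd hz h4
    · obtain ⟨d, rfl⟩ := h5 z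
      refine ⟨(d * c⁻¹) • X.map hw.1 x, ?_⟩
      rw [map_smul, key, smul_smul, inv_mul_cancel_right₀ hc0]
  · exact ⟨fun z z' _ => (h2 w hw z).trans (h2 w hw z').symm, fun z => ⟨0, (h2' w hw _).trans (h2' w hw z).symm⟩⟩

end General

variable {k : Type} [Field k] {n : Fin 3 → ℕ}

theorem isInterval_of_comp_ne_zero {X : Rep k (Vtx n)} (hX : IndecObj X) {x : X.V a}
    (hx : X.map (a_le b) x ≠ 0) : IsInterval X a b :=
  isInterval_of_map_ne_zero hX (a_le b) hx (fun v _ h => absurd (le_b v) h)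
    (fun v _ _ h => absurd (a_le v) h)

/-- If the sink is in the support, all maps to the sink are injective. -/
theorem injective_of_sink {X : Rep k (Vtx n)} (hX : IndecObj X) {y : X.V b} (hy : y ≠ 0)
    (v : Vtx n) : Function.Injective (X.map (le_b v)) := by
  by_cases h0 : ∀ x, X.map (a_le b) x = 0
  · exact injective_of_comp_eq_zero hX h0 hy v
  push Not at h0
  obtain ⟨x, hx⟩ := h0
  obtain ⟨x, h1, -⟩ := isInterval_of_comp_ne_zero hX hx
  refine (injective_iff_map_eq_zero _).2 fun z hz => ?_
  obtain ⟨c, rfl⟩ := (h1 v (a_le v) (le_b v)).2 z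
  rw [map_smul, X.map_map] at hz
  rcases smul_eq_zero.1 hz with rfl | hz
  · rw [zero_smul]
  · exact absurd hz (h1 b (a_le b) le_rfl).1

/-- If both the source and the sink are in the support, the representation is thin. -/
theorem isInterval_of_source_of_sink {X : Rep k (Vtx n)} (hX : IndecObj X) {x : X.V a}
    (hx : x ≠ 0) {y : X.V b} (hy : y ≠ 0) : IsInterval X a b :=
  isInterval_of_comp_ne_zero hX (x := x) fun h =>
    hx (injective_of_sink hX hy a (by rw [map_zero]; exact h))

/-- If the source is in the support, all maps from the source are surjective. -/
theorem surjective_of_source {X : Rep k (Vtx n)} (hfd : X.FD) (hX : IndecObj X) {x : X.V a}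
    (hx : x ≠ 0) (v : Vtx n) : Function.Surjective (X.map (a_le v)) := by
  by_cases hb : ∀ y : X.V b, y = 0
  · obtain ⟨w, rfl⟩ : ∃ w, rev w = v := ⟨_, rev_rev v⟩
    obtain ⟨l, hl⟩ := exists_form (k := k) hx
    have h1 := injective_of_sink (dual_indecObj (ρ := rev) rev_anti rev_rev hfd hX) (y := l)
      (fun h => by
        have : l = 0 := h
        rw [this] at hl
        simp at hl) w
    exact LinearMap.dualMap_injective_iff.1 h1
  · push Not at hb
    obtain ⟨y, hy⟩ := hb
    obtain ⟨x', h1, -⟩ := isInterval_of_source_of_sink hX hx hy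
    intro z
    obtain ⟨c, rfl⟩ := (h1 v (a_le v) (le_b v)).2 z
    exact ⟨c • x', by rw [map_smul]⟩

theorem eq_zero_of_sink {X Y : Rep k (Vtx n)} (hX : ∀ x : X.V b, x = 0) (hY : IndecObj Y)
    {y : Y.V b} (hy : y ≠ 0) (f : X ⟶ Y) : f = 0 := by
  ext v x
  refine injective_of_sink hY hy v ?_
  rw [zero_app, map_zero, ← nat_apply, hX (X.map _ x), map_zero]

theorem eq_zero_of_source {X Y : Rep k (Vtx n)} (hfd : X.FD) (hX : IndecObj X) {x : X.V a}
    (hx : x ≠ 0) (hY : ∀ y : Y.V a, y = 0) (f : X ⟶ Y) : f = 0 := by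
  ext v z
  obtain ⟨w, rfl⟩ := surjective_of_source hfd hX hx v z
  rw [zero_app, nat_apply, hY (f.app a w), map_zero]

/-- The classification of the indecomposables whose support contains neither the source nor
the sink. -/
theorem exists_isInterval {X : Rep k (Vtx n)} (hX : IndecObj X) (ha : ∀ x : X.V a, x = 0)
    (hb : ∀ x : X.V b, x = 0) : ∃ (i : Fin 3) (lo hi : ℕ) (h : lo ≤ hi) (h' : hi < n i),
      IsInterval X (m i hi h') (m i lo (h.trans_lt h')) := by
  obtain ⟨v, x, hx⟩ := exists_ne_zero hX.1
  rw [id_app] at hx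
  obtain ⟨i, l, hl, rfl⟩ : ∃ i l h, v = m i l h := by
    cases v with
    | a => exact absurd (ha x) hx
    | b => exact absurd (hb x) hx
    | m i l h => exact ⟨i, l, h, rfl⟩
  let p : ℕ → Prop := fun l => ∃ h : l < n i, ∃ y : X.V (m i l h), y ≠ 0
  obtain ⟨hi', ⟨y0, hy0⟩⟩ : p (Nat.findGreatest p (n i)) :=
    Nat.findGreatest_spec (P := p) hl.le ⟨hl, x, hx⟩
  have hmax : ∀ l, Nat.findGreatest p (n i) < l → ¬ p l := fun l h h' =>
    absurd (Nat.le_findGreatest h'.1.le h') (by omega)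
  generalize Nat.findGreatest p (n i) = hi at *
  have hex : ∃ l, ∃ (h : l ≤ hi) (y : X.V (m i hi hi')),
      X.map (m_le_m h : _ ≤ m i l (by omega)) y ≠ 0 := ⟨hi, le_rfl, y0, by rwa [X.map_refl]⟩
  obtain ⟨hlo, y, hy⟩ := Nat.find_spec hex
  have hmin := fun l (hl : l < Nat.find hex) => Nat.find_min hex hl
  generalize Nat.find hex = lo at *
  refine ⟨i, lo, hi, hlo, hi', isInterval_of_map_ne_zero hX _ hy (fun v h hv => ?_)
    (fun v h z hv => ?_)⟩
  · cases v with
    | a => exact absurd h not_m_le_a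
    | b => exact hb _
    | m i' l h2 =>
      obtain ⟨rfl, h3⟩ := id h
      by_contra hc
      exact hmin l (by
        by_contra h4
        exact hv ⟨rfl, by omega⟩) ⟨h3, y, hc⟩
  · have : z = 0 := by
      cases v with
      | a => exact ha z
      | b => exact hb z
      | m i' l h2 =>
        obtain ⟨rfl, h3⟩ := id h
        by_contra hc
        exact hmax l (by
          by_contra h4
          exact hv ⟨rfl, by omega⟩) ⟨h2, z, hc⟩
    rw [this, map_zero]

end Rep


/-! ## Vector spaces with three flags -/

/-- A vector space with three descending flags of subspaces, of lengths `n i`. -/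
structure Flag (k : Type) [Field k] (n : Fin 3 → ℕ) where
  U : Type
  [acg : AddCommGroup U]
  [mod : Module k U]
  W : Fin 3 → ℕ → Submodule k U
  W_zero : ∀ i, W i 0 = ⊤
  W_succ_le : ∀ i j, W i (j + 1) ≤ W i j
  W_of_gt : ∀ i j, n i < j → W i j = ⊥

attribute [instance] Flag.acg Flag.mod

theorem exists_factor {k A B C : Type} [Field k] [AddCommGroup A] [Module k A] [AddCommGroup B]
    [Module k B] [AddCommGroup C] [Module k C] (s : A →ₗ[k] B) (hs : Function.Surjective s)
    (H : A →ₗ[k] C) (hH : ∀ x, s x = 0 → H x = 0) : ∃ f : B →ₗ[k] C, ∀ x, f (s x) = H x := by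
  obtain ⟨g, hg⟩ := s.exists_rightInverse_of_surjective (LinearMap.range_eq_top.2 hs)
  refine ⟨H.comp g, fun x => ?_⟩
  rw [← sub_eq_zero, LinearMap.comp_apply, ← map_sub]
  apply hH
  rw [map_sub, sub_eq_zero]
  exact LinearMap.congr_fun hg (s x)

theorem exists_form_of_notMem {k U : Type} [Field k] [AddCommGroup U] [Module k U]
    {S : Submodule k U} {x : U} (hx : x ∉ S) : ∃ l : U →ₗ[k] k, l x = 1 ∧ ∀ y ∈ S, l y = 0 := by
  obtain ⟨l, hl⟩ := Rep.exists_form (k := k) (x := S.mkQ x) (by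
    rwa [Ne, Submodule.mkQ_apply, Submodule.Quotient.mk_eq_zero])
  refine ⟨l.comp S.mkQ, hl, fun y hy => ?_⟩
  rw [LinearMap.comp_apply, Submodule.mkQ_apply, (Submodule.Quotient.mk_eq_zero S).2 hy, map_zero]

namespace Flag

variable {k : Type} [Field k] {n : Fin 3 → ℕ}

theorem mem_zero (X : Flag k n) (i : Fin 3) (x : X.U) : x ∈ X.W i 0 := by
  rw [X.W_zero]; trivial

theorem W_anti (X : Flag k n) (i : Fin 3) {j j' : ℕ} (h : j ≤ j') : X.W i j' ≤ X.W i j :=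
  antitone_nat_of_succ_le (X.W_succ_le i) h

theorem le_of_mem (X : Flag k n) {i : Fin 3} {j : ℕ} {x : X.U} (hx : x ∈ X.W i j) (h : x ≠ 0) :
    j ≤ n i := by
  by_contra hj
  rw [X.W_of_gt i j (by omega), Submodule.mem_bot] at hx
  exact h hx

/-- Linear maps preserving the flags. -/
@[ext]
structure Hom (X Y : Flag k n) where
  lin : X.U →ₗ[k] Y.U
  mem' : ∀ i j x, x ∈ X.W i j → lin x ∈ Y.W i j

instance : Category (Flag k n) where
  Hom := Hom
  id X := ⟨LinearMap.id, fun _ _ _ => id⟩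
  comp f g := ⟨g.lin.comp f.lin, fun i j x hx => g.mem' i j _ (f.mem' i j x hx)⟩

/-- The linear map underlying a morphism. -/
def lin {X Y : Flag k n} (f : X ⟶ Y) : X.U →ₗ[k] Y.U := Hom.lin f

/-- Constructor for morphisms. -/
def homMk {X Y : Flag k n} (f : X.U →ₗ[k] Y.U) (hf : ∀ i j x, x ∈ X.W i j → f x ∈ Y.W i j) :
    X ⟶ Y := ⟨f, hf⟩

@[simp] theorem lin_homMk {X Y : Flag k n} (f : X.U →ₗ[k] Y.U)
    (hf : ∀ i j x, x ∈ X.W i j → f x ∈ Y.W i j) : lin (homMk f hf) = f := rfl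

theorem lin_mem {X Y : Flag k n} (f : X ⟶ Y) {i : Fin 3} {j : ℕ} {x : X.U} (hx : x ∈ X.W i j) :
    lin f x ∈ Y.W i j := f.mem' i j x hx

@[ext]
theorem hom_ext {X Y : Flag k n} {f g : X ⟶ Y} (h : ∀ x, lin f x = lin g x) : f = g :=
  Hom.ext (LinearMap.ext h)

@[simp] theorem lin_id (X : Flag k n) (x : X.U) : lin (𝟙 X) x = x := rfl

@[simp] theorem lin_comp {X Y Z : Flag k n} (f : X ⟶ Y) (g : Y ⟶ Z) (x : X.U) :
    lin (f ≫ g) x = lin g (lin f x) := rfl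

instance {X Y : Flag k n} : Zero (X ⟶ Y) := ⟨homMk 0 fun _ _ _ _ => by simp⟩

@[simp] theorem lin_zero {X Y : Flag k n} (x : X.U) : lin (0 : X ⟶ Y) x = 0 := rfl

instance : Limits.HasZeroMorphisms (Flag k n) where
  zero X Y := inferInstance
  comp_zero f Z := by ext; simp
  zero_comp X Y Z f := by ext; simp

theorem exists_ne_zero {X Y : Flag k n} {f : X ⟶ Y} (h : f ≠ 0) : ∃ x, lin f x ≠ 0 := by
  by_contra hcon
  push Not at hcon
  exact h (by ext x; simpa using hcon x)

theorem ne_zero_of_apply {X Y : Flag k n} {f : X ⟶ Y} {x : X.U} (h : lin f x ≠ 0) : f ≠ 0 := by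
  rintro rfl
  exact h rfl

theorem iso_hom_inv {X Y : Flag k n} (φ : X ≅ Y) (x : X.U) : lin φ.inv (lin φ.hom x) = x := by
  rw [← lin_comp, φ.hom_inv_id, lin_id]

theorem iso_inv_hom {X Y : Flag k n} (φ : X ≅ Y) (y : Y.U) : lin φ.hom (lin φ.inv y) = y := by
  rw [← lin_comp, φ.inv_hom_id, lin_id]

theorem isIso_of_bijective {X Y : Flag k n} (f : X ⟶ Y) (h : Function.Bijective (lin f))
    (hW : ∀ i j x, lin f x ∈ Y.W i j → x ∈ X.W i j) : IsIso f := by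
  let e := LinearEquiv.ofBijective (lin f) h
  refine ⟨homMk e.symm.toLinearMap fun i j y hy => hW i j _ ?_, ?_, ?_⟩
  · change e (e.symm y) ∈ Y.W i j
    rwa [e.apply_symm_apply]
  · ext x
    exact e.symm_apply_apply x
  · ext x
    exact e.apply_symm_apply x

theorem eq_id {X : Flag k n} (hX : IndecObj X) (e : X ⟶ X)
    (he : ∀ x, lin e (lin e x) = lin e x) {x : X.U} (hx : lin e x ≠ 0) : ∀ x, lin e x = x := by
  rcases hX.2 e (by ext x; exact he x) with rfl | rfl
  · exact absurd rfl hx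
  · intro x; rfl

/-! ### Thin objects -/

/-- The one-dimensional object whose `i`-th flag drops after step `l i`. -/
def thin (k : Type) [Field k] {n : Fin 3 → ℕ} (l : Fin 3 → ℕ) (hl : l ≤ n) : Flag k n where
  U := k
  W i j := if j ≤ l i then ⊤ else ⊥
  W_zero i := if_pos (Nat.zero_le _)
  W_succ_le i j := by
    split_ifs with h1 h2
    · exact le_rfl
    · omega
    · exact bot_le
    · exact le_rfl
  W_of_gt i j h := if_neg fun h' => by
    have : l i ≤ n i := hl i
    omega

/-- The generator of a thin object. -/
def gen {l : Fin 3 → ℕ} {hl : l ≤ n} : (thin k l hl).U := (1 : k)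

theorem mem_thin {l : Fin 3 → ℕ} {hl : l ≤ n} {i : Fin 3} {j : ℕ} (h : j ≤ l i)
    (x : (thin k l hl).U) : x ∈ (thin k l hl).W i j := by
  change x ∈ (if j ≤ l i then ⊤ else ⊥ : Submodule k k)
  rw [if_pos h]
  trivial

theorem thin_eq_zero {l : Fin 3 → ℕ} {hl : l ≤ n} {i : Fin 3} {j : ℕ} (h : l i < j)
    {x : (thin k l hl).U} (hx : x ∈ (thin k l hl).W i j) : x = 0 := by
  change x ∈ (if j ≤ l i then ⊤ else ⊥ : Submodule k k) at hx
  rw [if_neg (by omega)] at hx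
  exact hx

theorem le_of_mem_thin {l : Fin 3 → ℕ} {hl : l ≤ n} {i : Fin 3} {j : ℕ}
    {x : (thin k l hl).U} (hx : x ∈ (thin k l hl).W i j) (h : x ≠ 0) : j ≤ l i := by
  by_contra hj
  exact h (thin_eq_zero (by omega) hx)

theorem gen_ne {l : Fin 3 → ℕ} {hl : l ≤ n} : (gen : (thin k l hl).U) ≠ 0 :=
  one_ne_zero (α := k)

theorem exists_smul_gen {l : Fin 3 → ℕ} {hl : l ≤ n} (x : (thin k l hl).U) :
    ∃ c : k, x = c • gen := ⟨x, (mul_one (show k from x)).symm⟩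

/-- The morphism from a thin object given by an element. -/
def ofElem {l : Fin 3 → ℕ} (hl : l ≤ n) {X : Flag k n} (x : X.U) (hx : ∀ i, x ∈ X.W i (l i)) :
    thin k l hl ⟶ X :=
  homMk (LinearMap.toSpanSingleton k X.U x) fun i j y hy => by
    change (show k from y) • x ∈ X.W i j
    rcases Nat.lt_or_ge (l i) j with h | h
    · have : (show k from y) = 0 := thin_eq_zero h hy
      rw [this, zero_smul]
      exact zero_mem _
    · exact Submodule.smul_mem _ _ (X.W_anti i h (hx i))

@[simp] theorem lin_ofElem {l : Fin 3 → ℕ} (hl : l ≤ n) {X : Flag k n} (x : X.U)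
    (hx : ∀ i, x ∈ X.W i (l i)) : lin (ofElem hl x hx) gen = x := one_smul k x

/-- The morphism to a thin object given by a linear form. -/
def ofForm {l : Fin 3 → ℕ} (hl : l ≤ n) {X : Flag k n} (f : X.U →ₗ[k] k)
    (hf : ∀ i, ∀ x ∈ X.W i (l i + 1), f x = 0) : X ⟶ thin k l hl :=
  homMk (Y := thin k l hl) f fun i j y hy => by
    rcases Nat.lt_or_ge (l i) j with h | h
    · have h1 : f y = 0 := hf i y (X.W_anti i h hy)
      have h2 : (0 : k) ∈ (thin k l hl).W i j := zero_mem ((thin k l hl).W i j)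
      rwa [← h1] at h2
    · exact mem_thin h _

theorem lin_ofForm {l : Fin 3 → ℕ} (hl : l ≤ n) {X : Flag k n} (f : X.U →ₗ[k] k)
    (hf : ∀ i, ∀ x ∈ X.W i (l i + 1), f x = 0) (x : X.U) :
    lin (ofForm hl f hf) x = f x • gen := (mul_one (f x)).symm

theorem nonempty_iso_thin {X : Flag k n} (hX : IndecObj X) {l : Fin 3 → ℕ} (hl : l ≤ n) {x : X.U}
    (hx : ∀ i, x ∈ X.W i (l i)) {f : X.U →ₗ[k] k} (hf : ∀ i, ∀ y ∈ X.W i (l i + 1), f y = 0)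
    (hfx : f x = 1) : Nonempty (X ≅ thin k l hl) := by
  have h1 : ofElem hl x hx ≫ ofForm hl f hf = 𝟙 _ := by
    ext y
    obtain ⟨c, rfl⟩ := exists_smul_gen y
    rw [lin_comp, map_smul, lin_ofElem, map_smul, lin_ofForm, hfx, one_smul, lin_id]
  have h2 : 𝟙 (thin k l hl) ≠ 0 := ne_zero_of_apply (x := gen) gen_ne
  exact ⟨⟨ofForm hl f hf, ofElem hl x hx, hX.isIso_of_retract h2 _ _ h1, h1⟩⟩

theorem indecObj_thin (l : Fin 3 → ℕ) (hl : l ≤ n) : IndecObj (thin k l hl) := by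
  refine ⟨ne_zero_of_apply (x := gen) gen_ne, fun e he => ?_⟩
  obtain ⟨c, hc⟩ := exists_smul_gen (lin e gen)
  have h1 : lin e (lin e gen) = lin e gen := by rw [← lin_comp, he]
  rw [hc, map_smul, hc, smul_smul] at h1
  have h2 : c * c = c := smul_left_injective k (gen_ne (k := k) (hl := hl)) h1
  rcases eq_or_ne c 0 with rfl | h0
  · left
    ext x
    obtain ⟨d, rfl⟩ := exists_smul_gen x
    rw [map_smul, hc, zero_smul, smul_zero, lin_zero]
  · right
    have h3 : c = 1 := mul_left_cancel₀ h0 (by rw [h2, mul_one])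
    ext x
    obtain ⟨d, rfl⟩ := exists_smul_gen x
    rw [map_smul, hc, h3, one_smul, lin_id]

theorem le_of_hom_thin {l l' : Fin 3 → ℕ} {hl : l ≤ n} {hl' : l' ≤ n}
    {f : thin k l hl ⟶ thin k l' hl'} (hf : f ≠ 0) : l ≤ l' ∧ (l = l' → IsIso f) := by
  have hg : lin f gen ≠ 0 := fun h => hf (by
    ext x
    obtain ⟨c, rfl⟩ := exists_smul_gen x
    rw [map_smul, h, smul_zero, lin_zero])
  refine ⟨fun i => le_of_mem_thin (lin_mem f (mem_thin le_rfl gen)) hg, ?_⟩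
  rintro rfl
  obtain ⟨c, hc⟩ := exists_smul_gen (lin f gen)
  have hc0 : c ≠ 0 := by
    rintro rfl
    exact hg (by rw [hc, zero_smul])
  refine isIso_of_bijective f ⟨(injective_iff_map_eq_zero _).2 fun x hx => ?_, fun y => ?_⟩
    fun i j x hx => ?_
  · obtain ⟨d, rfl⟩ := exists_smul_gen x
    rw [map_smul] at hx
    rw [(smul_eq_zero.1 hx).resolve_right hg, zero_smul]
  · obtain ⟨d, rfl⟩ := exists_smul_gen y
    refine ⟨(d * c⁻¹) • gen, ?_⟩
    rw [map_smul, hc, smul_smul, inv_mul_cancel_right₀ hc0]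
  · obtain ⟨d, rfl⟩ := exists_smul_gen x
    rw [map_smul, hc, smul_comm] at hx
    have := ((thin k l hl').W i j).smul_mem c⁻¹ hx
    rwa [inv_smul_smul₀ hc0] at this

/-! ### Alive objects -/

/-- The condition that any two of the first flag subspaces span. -/
def Alive (X : Flag k n) : Prop :=
  ∀ i x, ∃ w : Fin 3 → X.U, (∀ i', w i' ∈ X.W i' 1) ∧ w i = 0 ∧ ∑ i', w i' = x

theorem single_le {i : Fin 3} {j : ℕ} (h : j ≤ n i) : (Pi.single i j : Fin 3 → ℕ) ≤ n := by
  intro i'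
  by_cases e : i' = i
  · subst e; simpa using h
  · simp [e]

/-- An indecomposable object is either alive or of a special thin form. -/
theorem thin_or_alive {X : Flag k n} (hX : IndecObj X) :
    (∃ (i : Fin 3) (j : ℕ) (h : j ≤ n i), Nonempty (X ≅ thin k (Pi.single i j) (single_le h))) ∨
      X.Alive := by
  by_cases ha : X.Alive
  · exact Or.inr ha
  left
  unfold Alive at ha
  push Not at ha
  obtain ⟨i, x0, hx0⟩ := ha
  let S : Submodule k X.U := Submodule.map (∑ i', LinearMap.proj i' : (Fin 3 → X.U) →ₗ[k] X.U)
    (Submodule.pi Set.univ fun i' => if i' = i then ⊥ else X.W i' 1)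
  have hS : ∀ i', i' ≠ i → X.W i' 1 ≤ S := fun i' hi x hx => by
    refine ⟨Pi.single i' x, fun i'' _ => ?_, by simp⟩
    by_cases e : i'' = i'
    · subst e
      change (Pi.single i'' x : Fin 3 → X.U) i'' ∈ (if i'' = i then ⊥ else X.W i'' 1 : Submodule k X.U)
      rw [if_neg hi, Pi.single_eq_same]
      exact hx
    · rw [Pi.single_eq_of_ne e]
      exact zero_mem _
  have hx0S : x0 ∉ S := by
    rintro ⟨w, hw, rfl⟩
    refine hx0 w (fun i' => ?_) ?_ (by simp)
    · have := hw i' trivial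
      dsimp only at this
      split_ifs at this with h
      · rw [(Submodule.mem_bot k).1 this]
        exact zero_mem _
      · exact this
    · have := hw i trivial
      dsimp only at this
      rwa [if_pos rfl] at this
  let p : ℕ → Prop := fun j => ∃ x ∈ X.W i j, x ∉ S
  have hp0 : p 0 := ⟨x0, X.mem_zero i x0, hx0S⟩
  obtain ⟨x, hx, hxS⟩ : p (Nat.findGreatest p (n i)) :=
    Nat.findGreatest_spec (P := p) (Nat.zero_le _) hp0
  have hj := Nat.findGreatest_le (P := p) (n i)
  have hmax : ∀ y ∈ X.W i (Nat.findGreatest p (n i) + 1), y ∈ S := by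
    intro y hy
    by_contra hc
    have h1 : Nat.findGreatest p (n i) + 1 ≤ n i := X.le_of_mem hy (by
      rintro rfl
      exact hc (zero_mem _))
    have h2 := Nat.le_findGreatest (P := p) h1 ⟨y, hy, hc⟩
    omega
  generalize Nat.findGreatest p (n i) = j at *
  obtain ⟨f, hf, hfS⟩ := exists_form_of_notMem hxS
  refine ⟨i, j, hj, nonempty_iso_thin hX _ (x := x) (f := f) (fun i' => ?_) (fun i' y hy => ?_) hf⟩
  · by_cases e : i' = i
    · subst e; simpa using hx
    · rw [Pi.single_eq_of_ne e]
      exact X.mem_zero _ _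
  · apply hfS
    by_cases e : i' = i
    · subst e
      rw [Pi.single_eq_same] at hy
      exact hmax y hy
    · rw [Pi.single_eq_of_ne e] at hy
      exact hS i' e hy

theorem Alive.hom_thin_eq_zero {X : Flag k n} (hX : X.Alive) {i : Fin 3} {j : ℕ}
    {h : (Pi.single i j : Fin 3 → ℕ) ≤ n} (f : X ⟶ thin k (Pi.single i j) h) : f = 0 := by
  ext x
  obtain ⟨w, h1, h2, rfl⟩ := hX i x
  rw [map_sum, lin_zero]
  refine Finset.sum_eq_zero fun i' _ => ?_
  by_cases e : i' = i
  · rw [e, h2, map_zero]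
  · exact thin_eq_zero (by rw [Pi.single_eq_of_ne e]; exact Nat.one_pos) (lin_mem f (h1 i'))

theorem Alive.not_isIso {X : Flag k n} (hX : X.Alive) {i : Fin 3} {j : ℕ}
    {h : (Pi.single i j : Fin 3 → ℕ) ≤ n} (f : thin k (Pi.single i j) h ⟶ X) : ¬ IsIso f := by
  intro hf
  refine (indecObj_thin (k := k) _ h).1 ?_
  rw [← IsIso.hom_inv_id f, hX.hom_thin_eq_zero (inv f), Limits.comp_zero]

end Flag


namespace Flag

variable {k : Type} [Field k] {n : Fin 3 → ℕ}

/-- The finite-dimensional indecomposable objects. -/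
def Ind (X : Flag k n) : Prop := Module.Finite k X.U ∧ IndecObj X

/-! ### The Coxeter transform -/

/-- The triples in the first flag subspaces with vanishing sum. -/
def coxSpace (X : Flag k n) : Submodule k (Fin 3 → X.U) where
  carrier := {x | (∀ i, x i ∈ X.W i 1) ∧ ∑ i, x i = 0}
  add_mem' := fun {x y} hx hy => ⟨fun i => add_mem (hx.1 i) (hy.1 i), by
    rw [Finset.sum_congr rfl fun i _ => Pi.add_apply x y i, Finset.sum_add_distrib, hx.2, hy.2,
      add_zero]⟩
  zero_mem' := ⟨fun i => zero_mem _, by simp⟩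
  smul_mem' := fun c x hx => ⟨fun i => Submodule.smul_mem _ _ (hx.1 i), by
    rw [Finset.sum_congr rfl fun i _ => Pi.smul_apply c x i, ← Finset.smul_sum, hx.2, smul_zero]⟩

/-- The `i`-th component. -/
def comp (X : Flag k n) (i : Fin 3) : X.coxSpace →ₗ[k] X.U :=
  (LinearMap.proj i).comp X.coxSpace.subtype

/-- The Coxeter transform of an object. -/
def cox (X : Flag k n) : Flag k n where
  U := X.coxSpace
  W i j := if j ≤ n i then (X.W i (j + 1)).comap (X.comp i) else ⊥
  W_zero i := by
    rw [if_pos (Nat.zero_le _), eq_top_iff]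
    exact fun x _ => x.2.1 i
  W_succ_le i j := by
    split_ifs with h1 h2
    · exact Submodule.comap_mono (X.W_succ_le i (j + 1))
    · omega
    · exact bot_le
    · exact le_rfl
  W_of_gt i j h := if_neg (by omega)

/-- The components of an element of the Coxeter transform. -/
def co {X : Flag k n} (x : X.cox.U) (i : Fin 3) : X.U := X.comp i x

/-- Elements of the Coxeter transform. -/
def mkCox {X : Flag k n} (x : Fin 3 → X.U) (h : ∀ i, x i ∈ X.W i 1) (h0 : ∑ i, x i = 0) :
    X.cox.U := (⟨x, h, h0⟩ : X.coxSpace)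

@[simp] theorem co_mkCox {X : Flag k n} (x : Fin 3 → X.U) (h : ∀ i, x i ∈ X.W i 1)
    (h0 : ∑ i, x i = 0) (i : Fin 3) : co (mkCox x h h0) i = x i := rfl

theorem co_mem {X : Flag k n} (x : X.cox.U) (i : Fin 3) : co x i ∈ X.W i 1 :=
  (show X.coxSpace from x).2.1 i

theorem sum_co {X : Flag k n} (x : X.cox.U) : ∑ i, co x i = 0 := (show X.coxSpace from x).2.2

theorem cox_ext {X : Flag k n} {x y : X.cox.U} (h : ∀ i, co x i = co y i) : x = y :=
  Subtype.ext (funext h)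

@[simp] theorem co_zero {X : Flag k n} (i : Fin 3) : co (0 : X.cox.U) i = 0 := rfl

@[simp] theorem co_add {X : Flag k n} (x y : X.cox.U) (i : Fin 3) :
    co (x + y) i = co x i + co y i := rfl

@[simp] theorem co_smul {X : Flag k n} (c : k) (x : X.cox.U) (i : Fin 3) :
    co (c • x) i = c • co x i := rfl

theorem mem_cox {X : Flag k n} {i : Fin 3} {j : ℕ} (h : j ≤ n i) {x : X.cox.U} :
    x ∈ X.cox.W i j ↔ co x i ∈ X.W i (j + 1) := by
  change x ∈ (if j ≤ n i then (X.W i (j + 1)).comap (X.comp i) else ⊥) ↔ _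
  rw [if_pos h]
  rfl

/-- The action of the Coxeter transform on morphisms. -/
def coxMap {X Y : Flag k n} (f : X ⟶ Y) : X.cox ⟶ Y.cox :=
  homMk (X := X.cox) (Y := Y.cox)
    { toFun := fun x => mkCox (fun i => lin f (co x i)) (fun i => lin_mem f (co_mem x i)) (by
        rw [← map_sum, sum_co, map_zero])
      map_add' := fun x y => cox_ext fun i => by simp
      map_smul' := fun c x => cox_ext fun i => by simp }
    (fun i j x hx => by
      rcases Nat.lt_or_ge (n i) j with h | h
      · rw [X.cox.W_of_gt i j h, Submodule.mem_bot] at hx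
        rw [hx, map_zero]
        exact zero_mem _
      · exact (mem_cox h).2 (lin_mem f ((mem_cox h).1 hx)))

@[simp] theorem co_coxMap {X Y : Flag k n} (f : X ⟶ Y) (x : X.cox.U) (i : Fin 3) :
    co (lin (coxMap f) x) i = lin f (co x i) := rfl

theorem coxMap_id (X : Flag k n) : coxMap (𝟙 X) = 𝟙 _ := rfl

theorem coxMap_comp {X Y Z : Flag k n} (f : X ⟶ Y) (g : Y ⟶ Z) :
    coxMap (f ≫ g) = coxMap f ≫ coxMap g := rfl

theorem coxMap_zero (X Y : Flag k n) : coxMap (0 : X ⟶ Y) = 0 := rfl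

/-- In an alive object every element of a first flag subspace is a component. -/
theorem Alive.exists_co {X : Flag k n} (hX : X.Alive) {i : Fin 3} {x : X.U} (hx : x ∈ X.W i 1) :
    ∃ y : X.cox.U, co y i = x := by
  obtain ⟨w, h1, h2, h3⟩ := hX i (-x)
  refine ⟨mkCox (w + Pi.single i x) (fun i' => ?_) ?_, ?_⟩
  · by_cases e : i' = i
    · subst e
      simpa [h2] using hx
    · simpa [e] using h1 i'
  · simp [Finset.sum_add_distrib, h3]
  · simp [h2]

theorem Alive.sum_surjective {X : Flag k n} (hX : X.Alive) (x : X.U) :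
    ∃ w : ∀ i, X.W i 1, ∑ i, (w i : X.U) = x := by
  obtain ⟨w, h1, -, h3⟩ := hX 0 x
  exact ⟨fun i => ⟨w i, h1 i⟩, h3⟩

theorem Alive.coxMap_injective {X Y : Flag k n} (hX : X.Alive) {f g : X ⟶ Y}
    (h : coxMap f = coxMap g) : f = g := by
  ext x
  obtain ⟨w, rfl⟩ := hX.sum_surjective x
  rw [map_sum, map_sum]
  refine Finset.sum_congr rfl fun i _ => ?_
  obtain ⟨y, hy⟩ := hX.exists_co (w i).2
  rw [← hy, ← co_coxMap, h, co_coxMap]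

theorem Alive.coxMap_surjective {X Y : Flag k n} (hX : X.Alive) (g : X.cox ⟶ Y.cox) :
    ∃ f : X ⟶ Y, coxMap f = g := by
  have h1 : ∀ i, ∃ h : X.W i 1 →ₗ[k] Y.U, ∀ y : X.cox.U,
      h ⟨co y i, co_mem y i⟩ = co (lin g y) i := fun i =>
    exists_factor (B := X.W i 1)
      ((X.comp i).codRestrict (X.W i 1) fun y => co_mem (X := X) y i)
      (fun x => by
        obtain ⟨y, hy⟩ := hX.exists_co x.2
        exact ⟨y, Subtype.ext hy⟩)
      ((Y.comp i).comp (lin g)) (fun y hy => by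
        have h2 : co y i = 0 := congrArg Subtype.val hy
        have h3 : y ∈ X.cox.W i (n i) := (mem_cox le_rfl).2 (by rw [h2]; exact zero_mem _)
        have h4 := (mem_cox le_rfl).1 (lin_mem g h3)
        rwa [Y.W_of_gt i (n i + 1) (by omega), Submodule.mem_bot] at h4)
  choose h hh using h1
  obtain ⟨f, hf⟩ := exists_factor (A := ∀ i, X.W i 1)
    (∑ i, (X.W i 1).subtype.comp (LinearMap.proj i))
    (fun x => by
      obtain ⟨w, hw⟩ := hX.sum_surjective x
      exact ⟨w, by simpa using hw⟩)
    (∑ i, (h i).comp (LinearMap.proj i)) (fun w hw => by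
      have h2 : ∑ i, (w i : X.U) = 0 := by simpa using hw
      have h3 := sum_co (lin g (mkCox (fun i => (w i : X.U)) (fun i => (w i).2) h2))
      rw [← h3]
      simp only [LinearMap.sum_apply, LinearMap.comp_apply, LinearMap.proj_apply]
      refine Finset.sum_congr rfl fun i _ => ?_
      rw [← hh]
      rfl)
  have hf1 : ∀ i (x : X.W i 1), f x = h i x := fun i x => by
    have := hf (Pi.single i x)
    simp only [LinearMap.sum_apply, LinearMap.comp_apply, LinearMap.proj_apply,
      Submodule.subtype_apply] at this
    rw [Finset.sum_eq_single i, Finset.sum_eq_single i, Pi.single_eq_same] at this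
    · exact this
    · intro i' _ e
      rw [Pi.single_eq_of_ne e, map_zero]
    · simp
    · intro i' _ e
      rw [Pi.single_eq_of_ne e]
      rfl
    · simp
  have hf2 : ∀ (y : X.cox.U) i, f (co y i) = co (lin g y) i := fun y i => by
    rw [← hh, ← hf1]
  refine ⟨homMk f fun i j x hx => ?_, ?_⟩
  · cases j with
    | zero => exact Y.mem_zero _ _
    | succ j =>
      rcases Nat.lt_or_ge (n i) j with hj | hj
      · rw [X.W_of_gt i (j + 1) (by omega), Submodule.mem_bot] at hx
        rw [hx, map_zero]
        exact zero_mem _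
      · obtain ⟨y, rfl⟩ := hX.exists_co (X.W_anti i (by omega : 1 ≤ j + 1) hx)
        rw [hf2]
        exact (mem_cox hj).1 (lin_mem g ((mem_cox hj).2 hx))
  · ext y
    refine cox_ext fun i => ?_
    rw [co_coxMap]
    exact hf2 y i

theorem Alive.indecObj_cox {X : Flag k n} (hX : X.Alive) : IndecObj X.cox ↔ IndecObj X := by
  constructor
  · rintro ⟨h1, h2⟩
    refine ⟨fun h => h1 ?_, fun e he => ?_⟩
    · rw [← coxMap_id, h, coxMap_zero]
    · rcases h2 (coxMap e) (by rw [← coxMap_comp, he]) with h | h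
      · exact Or.inl (hX.coxMap_injective h)
      · exact Or.inr (hX.coxMap_injective h)
  · rintro ⟨h1, h2⟩
    refine ⟨fun h => h1 (hX.coxMap_injective h), fun e he => ?_⟩
    obtain ⟨e, rfl⟩ := hX.coxMap_surjective e
    rcases h2 e (hX.coxMap_injective he) with rfl | rfl
    · exact Or.inl rfl
    · exact Or.inr rfl

theorem Alive.isIso_of_coxMap {X Y : Flag k n} (hX : X.Alive) (hY : Y.Alive) (f : X ⟶ Y)
    (h : IsIso (coxMap f)) : IsIso f := by
  obtain ⟨g, hg⟩ := hY.coxMap_surjective (inv (coxMap f))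
  refine ⟨g, hX.coxMap_injective ?_, hY.coxMap_injective ?_⟩
  · rw [coxMap_comp, hg, IsIso.hom_inv_id, coxMap_id]
  · rw [coxMap_comp, hg, IsIso.inv_hom_id, coxMap_id]

theorem isIso_coxMap {X Y : Flag k n} (f : X ⟶ Y) (h : IsIso f) : IsIso (coxMap f) :=
  ⟨coxMap (inv f), by rw [← coxMap_comp, IsIso.hom_inv_id, coxMap_id],
    by rw [← coxMap_comp, IsIso.inv_hom_id, coxMap_id]⟩

theorem Alive.ind_cox {X : Flag k n} (hX : X.Alive) (h : X.Ind) : X.cox.Ind := by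
  have := h.1
  refine ⟨?_, hX.indecObj_cox.2 h.2⟩
  change Module.Finite k X.coxSpace
  infer_instance

/-! ### Lifting along the Coxeter transform -/

/-- The condition that any two of the last flag subspaces are independent. -/
def CoAlive (X : Flag k n) : Prop := ∀ i x, (∀ i', i' ≠ i → x ∈ X.W i' (n i')) → x = 0

/-- The relations of the inverse Coxeter transform. -/
def liftRel (X : Flag k n) : Submodule k (Fin 3 → X.U) where
  carrier := {x | ∃ u, ∀ i, x i - u ∈ X.W i (n i)}
  add_mem' := by
    rintro x y ⟨u, hu⟩ ⟨v, hv⟩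
    refine ⟨u + v, fun i => ?_⟩
    have := add_mem (hu i) (hv i)
    rwa [sub_add_sub_comm] at this
  zero_mem' := ⟨0, fun i => by simp⟩
  smul_mem' := by
    rintro c x ⟨u, hu⟩
    refine ⟨c • u, fun i => ?_⟩
    have := Submodule.smul_mem _ c (hu i)
    rwa [smul_sub] at this

/-- The inclusion of the `i`-th summand. -/
def inj (X : Flag k n) (i : Fin 3) : X.U →ₗ[k] (Fin 3 → X.U) ⧸ X.liftRel :=
  X.liftRel.mkQ.comp (LinearMap.single k (fun _ => X.U) i)

theorem inj_eq_zero {X : Flag k n} {i : Fin 3} {x : X.U} :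
    X.inj i x = 0 ↔ ∃ u, x - u ∈ X.W i (n i) ∧ ∀ i', i' ≠ i → u ∈ X.W i' (n i') := by
  unfold inj
  rw [LinearMap.comp_apply, Submodule.mkQ_apply, Submodule.Quotient.mk_eq_zero]
  constructor
  · rintro ⟨u, hu⟩
    refine ⟨u, by simpa using hu i, fun i' hi => ?_⟩
    have := hu i'
    rw [LinearMap.single_apply, Pi.single_eq_of_ne hi, zero_sub] at this
    simpa using this
  · rintro ⟨u, h1, h2⟩
    refine ⟨u, fun i' => ?_⟩
    by_cases e : i' = i
    · subst e
      simpa using h1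
    · rw [LinearMap.single_apply, Pi.single_eq_of_ne e, zero_sub]
      exact neg_mem (h2 i' e)

/-- The inverse Coxeter transform. -/
def lift (X : Flag k n) : Flag k n where
  U := (Fin 3 → X.U) ⧸ X.liftRel
  W i j := match j with
    | 0 => ⊤
    | j + 1 => (X.W i j).map (X.inj i)
  W_zero i := rfl
  W_succ_le i j := by
    cases j with
    | zero => exact le_top
    | succ j => exact Submodule.map_mono (X.W_succ_le i j)
  W_of_gt i j h := by
    cases j with
    | zero => omega
    | succ j =>
      change (X.W i j).map (X.inj i) = ⊥
      rw [eq_bot_iff]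
      rintro _ ⟨x, hx, rfl⟩
      exact inj_eq_zero.2 ⟨0, by
        rw [sub_zero]
        exact X.W_anti i (by omega) hx, fun i' _ => zero_mem _⟩

theorem mem_lift {X : Flag k n} {i : Fin 3} {j : ℕ} {y : X.lift.U} :
    y ∈ X.lift.W i (j + 1) ↔ ∃ x ∈ X.W i j, X.inj i x = y := Iff.rfl

theorem sum_inj {X : Flag k n} (x : Fin 3 → X.U) : ∑ i, X.inj i (x i) = X.liftRel.mkQ x := by
  simp only [inj, LinearMap.comp_apply]
  rw [← map_sum]
  congr 1
  ext i
  simp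

theorem sum_inj_const {X : Flag k n} (u : X.U) : ∑ i, X.inj i u = 0 := by
  rw [sum_inj fun _ => u, Submodule.mkQ_apply, Submodule.Quotient.mk_eq_zero]
  exact ⟨u, fun i => by simp⟩

theorem alive_lift (X : Flag k n) : X.lift.Alive := by
  intro i y
  obtain ⟨x, rfl⟩ := X.liftRel.mkQ_surjective y
  refine ⟨fun i' => X.inj i' (x i' - x i), fun i' => ⟨_, X.mem_zero _ _, rfl⟩, ?_, ?_⟩
  · change X.inj i (x i - x i) = 0
    rw [sub_self, map_zero]
  · change ∑ i', X.inj i' (x i' - x i) = _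
    simp only [map_sub]
    rw [Finset.sum_sub_distrib, sum_inj_const, sub_zero, sum_inj]

theorem CoAlive.inj_mem {X : Flag k n} (hX : X.CoAlive) {i : Fin 3} {j : ℕ} (hj : j ≤ n i)
    {x : X.U} (hx : X.inj i x ∈ (X.W i j).map (X.inj i)) : x ∈ X.W i j := by
  obtain ⟨w, hw, h⟩ := hx
  obtain ⟨u, h1, h2⟩ := inj_eq_zero.1 (show X.inj i (x - w) = 0 by rw [map_sub, h, sub_self])
  rw [hX i u h2, sub_zero] at h1
  have := add_mem (X.W_anti i hj h1) hw
  rwa [sub_add_cancel] at this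

theorem CoAlive.nonempty_iso {X : Flag k n} (hX : X.CoAlive) : Nonempty (X ≅ X.lift.cox) := by
  let θ : X.U →ₗ[k] X.lift.cox.U :=
    { toFun := fun u => mkCox (X := X.lift) (fun i => X.inj i u)
        (fun i => ⟨u, X.mem_zero _ _, rfl⟩) (sum_inj_const u)
      map_add' := fun u v => cox_ext fun i => map_add (X.inj i) u v
      map_smul' := fun c u => cox_ext fun i => map_smul (X.inj i) c u }
  have hθ : ∀ u i, co (θ u) i = X.inj i u := fun u i => rfl
  have hinj : Function.Injective θ := (injective_iff_map_eq_zero θ).2 fun u hu => by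
    have h1 : ∀ i, u ∈ X.W i (n i) := fun i => hX.inj_mem le_rfl (by
      rw [← hθ, hu]
      exact zero_mem _)
    exact hX 0 u fun i _ => h1 i
  have hmem : ∀ i j u, θ u ∈ X.lift.cox.W i j ↔ u ∈ X.W i j := fun i j u => by
    rcases Nat.lt_or_ge (n i) j with hj | hj
    · rw [X.lift.cox.W_of_gt i j hj, X.W_of_gt i j hj, Submodule.mem_bot, Submodule.mem_bot,
        map_eq_zero_iff θ hinj]
    · rw [mem_cox hj, mem_lift]
      exact ⟨fun h => hX.inj_mem hj h, fun h => ⟨u, h, rfl⟩⟩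
  have hsurj : Function.Surjective θ := fun y => by
    choose x hx hxy using fun i => mem_lift.1 (co_mem y i)
    have h1 : X.liftRel.mkQ x = 0 := by
      rw [← sum_inj, Finset.sum_congr rfl fun i _ => hxy i]
      exact sum_co y
    rw [Submodule.mkQ_apply, Submodule.Quotient.mk_eq_zero] at h1
    obtain ⟨u, hu⟩ := h1
    refine ⟨u, cox_ext fun i => ?_⟩
    have h2 : X.inj i (x i) = X.inj i u := by
      rw [← sub_eq_zero, ← map_sub]
      exact inj_eq_zero.2 ⟨0, by simpa using hu i, fun i' _ => zero_mem _⟩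
    rw [hθ, ← hxy i]
    exact h2.symm
  have := isIso_of_bijective (homMk θ fun i j u hu => (hmem i j u).2 hu) ⟨hinj, hsurj⟩
    fun i j u hu => (hmem i j u).1 hu
  exact ⟨asIso (homMk θ fun i j u hu => (hmem i j u).2 hu)⟩

theorem exists_alive_of_coAlive {X : Flag k n} (hX : X.Ind) (hc : X.CoAlive) :
    ∃ R : Flag k n, R.Ind ∧ R.Alive ∧ Nonempty (R.cox ≅ X) := by
  obtain ⟨φ⟩ := hc.nonempty_iso
  have := hX.1
  refine ⟨X.lift, ⟨?_, X.alive_lift.indecObj_cox.1 (indecObj_of_iso φ hX.2)⟩, X.alive_lift,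
    ⟨φ.symm⟩⟩
  change Module.Finite k ((Fin 3 → X.U) ⧸ X.liftRel)
  infer_instance

/-- An indecomposable object with a non-zero morphism to a Coxeter transform is coalive. -/
theorem coAlive_of_ne_zero {X Y : Flag k n} (hX : IndecObj X) {f : X ⟶ Y.cox} (hf : f ≠ 0) :
    X.CoAlive := by
  by_contra hc
  unfold CoAlive at hc
  push Not at hc
  obtain ⟨i, x0, hx0, h0⟩ := hc
  let p : ℕ → Prop := fun j => ∃ x ∈ X.W i j, x ≠ 0 ∧ ∀ i', i' ≠ i → x ∈ X.W i' (n i')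
  have hp0 : p 0 := ⟨x0, X.mem_zero i x0, h0, hx0⟩
  obtain ⟨x, hx, hx1, hx2⟩ : p (Nat.findGreatest p (n i)) :=
    Nat.findGreatest_spec (P := p) (Nat.zero_le _) hp0
  have hj := Nat.findGreatest_le (P := p) (n i)
  have hmax : x ∉ X.W i (Nat.findGreatest p (n i) + 1) := by
    intro hc
    have h1 := X.le_of_mem hc hx1
    have h2 := Nat.le_findGreatest (P := p) h1 ⟨x, hc, hx1, hx2⟩
    omega
  generalize Nat.findGreatest p (n i) = j at *
  obtain ⟨l, hl, hl0⟩ := exists_form_of_notMem hmax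
  have hle : Function.update n i j ≤ n := by
    intro i'
    by_cases e : i' = i
    · subst e; simpa using hj
    · simp [e]
  obtain ⟨φ⟩ := nonempty_iso_thin hX hle (x := x) (f := l) (fun i' => by
    by_cases e : i' = i
    · subst e; simpa using hx
    · simpa [e] using hx2 i' e) (fun i' y hy => by
    by_cases e : i' = i
    · subst e
      rw [Function.update_self] at hy
      exact hl0 y hy
    · rw [Function.update_of_ne e, X.W_of_gt i' _ (by omega), Submodule.mem_bot] at hy
      rw [hy, map_zero]) hl
  have h1 : ∀ i', i' ≠ i → co (lin (φ.inv ≫ f) gen) i' = 0 := fun i' e => by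
    have h2 := (mem_cox le_rfl).1 (lin_mem (φ.inv ≫ f)
      (mem_thin (by rw [Function.update_of_ne e]) gen : gen ∈ (thin k _ hle).W i' (n i')))
    rwa [Y.W_of_gt i' _ (by omega), Submodule.mem_bot] at h2
  have h3 : lin (φ.inv ≫ f) gen = 0 := by
    refine cox_ext fun i' => ?_
    by_cases e : i' = i
    · have := sum_co (lin (φ.inv ≫ f) gen)
      rw [Finset.sum_eq_single i (fun i' _ e => h1 i' e) (by simp)] at this
      rw [e, this, co_zero]
    · rw [h1 i' e, co_zero]
  have h4 : φ.inv ≫ f = 0 := by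
    ext y
    obtain ⟨c, rfl⟩ := exists_smul_gen y
    rw [map_smul, h3, smul_zero, lin_zero]
  apply hf
  rw [← Category.id_comp f, ← φ.hom_inv_id, Category.assoc, h4, Limits.comp_zero]

end Flag


namespace Flag

variable {k : Type} [Field k] {n : Fin 3 → ℕ}

/-! ### Levels -/

/-- The level of an object, defined by iterating the Coxeter transform. -/
inductive Lvl : Flag k n → ℕ → Prop
  | thin {X : Flag k n} {i : Fin 3} {j : ℕ} (h : j ≤ n i)
      (φ : X ≅ Flag.thin k (Pi.single i j) (single_le h)) : Lvl X j
  | step {X : Flag k n} {m : ℕ} : X.Alive → Lvl X.cox m → Lvl X (m + 2)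

/-- Objects of level at least a given number. -/
inductive Deep : Flag k n → ℕ → Prop
  | zero (X : Flag k n) : Deep X 0
  | thin {X : Flag k n} {i : Fin 3} {j : ℕ} (h : j ≤ n i)
      (φ : X ≅ Flag.thin k (Pi.single i j) (single_le h)) : Deep X j
  | step {X : Flag k n} {m : ℕ} : X.Alive → Deep X.cox m → Deep X (m + 2)

theorem Lvl.deep {X : Flag k n} {m : ℕ} (h : Lvl X m) : Deep X m := by
  induction h with
  | thin h φ => exact .thin h φ
  | step h _ ih => exact .step h ih

theorem iso_ne_zero {X Y : Flag k n} (φ : X ≅ Y) {x : X.U} (hx : x ≠ 0) : lin φ.hom x ≠ 0 :=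
  fun h => hx (by rw [← iso_hom_inv φ x, h, map_zero])

theorem Alive.exists_lift {X : Flag k n} (hX : X.Alive) {i : Fin 3} {j : ℕ} {x : X.U}
    (hx : x ∈ X.W i (j + 1)) (hj : j ≤ n i) : ∃ y ∈ X.cox.W i j, co y i = x := by
  obtain ⟨y, hy⟩ := hX.exists_co (X.W_anti i (Nat.le_add_left 1 j) hx)
  exact ⟨y, (mem_cox hj).2 (by rwa [hy]), hy⟩

theorem single_apply_le (i i' : Fin 3) (j : ℕ) : (Pi.single i j : Fin 3 → ℕ) i' ≤ j := by
  by_cases e : i' = i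
  · subst e; simp
  · simp [e]

theorem Lvl.le_of_mem {X : Flag k n} {m : ℕ} (h : Lvl X m) {i : Fin 3} {j : ℕ} {x : X.U}
    (hx : x ∈ X.W i j) (h0 : x ≠ 0) : j ≤ m ∧ (X.Alive → j < m) := by
  induction h generalizing j with
  | @thin X i' j' h φ =>
    refine ⟨(le_of_mem_thin (lin_mem φ.hom hx) (iso_ne_zero φ h0)).trans (single_apply_le _ _ _),
      fun ha => absurd ?_ (iso_ne_zero φ h0)⟩
    rw [ha.hom_thin_eq_zero φ.hom, lin_zero]
  | @step X m ha _ ih =>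
    have : j < m + 2 := by
      cases j with
      | zero => omega
      | succ j =>
        have hj := X.le_of_mem hx h0
        obtain ⟨y, hy, rfl⟩ := ha.exists_lift hx (by omega)
        have := (ih hy (by rintro rfl; exact h0 rfl)).1
        omega
    exact ⟨this.le, fun _ => this⟩

theorem Lvl.hom {X Y : Flag k n} {m m' : ℕ} (hX : Lvl X m) (hY : Lvl Y m') {f : X ⟶ Y}
    (hf : f ≠ 0) : m ≤ m' ∧ (m = m' → IsIso f) := by
  induction hX generalizing Y m' with
  | @thin X i j h φ =>
    have hf1 : φ.inv ≫ f ≠ 0 := fun h => hf (by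
      rw [← Category.id_comp f, ← φ.hom_inv_id, Category.assoc, h, Limits.comp_zero])
    cases hY with
    | @thin _ i' j' h' ψ =>
      have hf2 : φ.inv ≫ f ≫ ψ.hom ≠ 0 := fun h => hf1 (by
        rw [← Category.comp_id f, ← ψ.hom_inv_id, ← Category.assoc, ← Category.assoc,
          Category.assoc φ.inv, h, Limits.zero_comp])
      obtain ⟨h1, h2⟩ := le_of_hom_thin hf2
      have h3 : j ≤ (Pi.single i' m' : Fin 3 → ℕ) i := by simpa using h1 i
      refine ⟨h3.trans (single_apply_le _ _ _), ?_⟩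
      rintro rfl
      have h4 : (Pi.single i j : Fin 3 → ℕ) = Pi.single i' j := by
        by_cases e : i = i'
        · rw [e]
        · rw [Pi.single_eq_of_ne e] at h3
          obtain rfl : j = 0 := by omega
          simp
      have := h2 h4
      have h5 : f = φ.hom ≫ (φ.inv ≫ f ≫ ψ.hom) ≫ ψ.inv := by simp
      rw [h5]
      infer_instance
    | @step _ m ha hY =>
      obtain ⟨x, hx⟩ := exists_ne_zero hf1
      have h1 := (Lvl.step ha hY).le_of_mem (lin_mem (φ.inv ≫ f) (mem_thin (i := i) (j := j)
        (by simp) x)) hx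
      have := h1.2 ha
      exact ⟨this.le, fun e => by omega⟩
  | @step X m ha hX ih =>
    cases hY with
    | @thin _ i' j' h' ψ =>
      refine absurd ?_ hf
      rw [← Category.comp_id f, ← ψ.hom_inv_id, ← Category.assoc, ha.hom_thin_eq_zero (f ≫ ψ.hom),
        Limits.zero_comp]
    | @step _ m' hb hY =>
      have h1 : coxMap f ≠ 0 := fun h => hf (ha.coxMap_injective (by rw [h, coxMap_zero]))
      obtain ⟨h2, h3⟩ := ih hY h1
      exact ⟨by omega, fun e => ha.isIso_of_coxMap hb f (h3 (by omega))⟩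

/-! ### Long chains into deep objects -/

theorem chain_lift {X Z : Flag k n} {f : X ⟶ Z} {N : ℕ} (hc : Chain Ind f N) (hf : f ≠ 0)
    {Y : Flag k n} (hY : Y.Alive) (hYI : Y.Ind) (e : Z ≅ Y.cox) :
    ∃ (R : Flag k n) (φ : R.cox ≅ X) (g : R ⟶ Y), R.Alive ∧ Chain Ind g N ∧
      coxMap g = φ.hom ≫ f ≫ e.hom := by
  induction hc with
  | nil f h1 h2 h3 =>
    exact ⟨Y, e.symm ≪≫ (asIso f).symm, 𝟙 Y, hY, .nil _ hYI hYI inferInstance, by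
      simp [coxMap_id]⟩
  | @cons X X1 Z f g N h1 h2 h3 ih =>
    obtain ⟨R1, φ1, g1, ha1, hc1, hg1⟩ := ih (by rintro rfl; exact hf Limits.comp_zero) e
    have h4 : f ≫ g ≫ e.hom ≠ 0 := fun h => hf (by
      rw [← Category.comp_id g, ← e.hom_inv_id, ← Category.assoc g, ← Category.assoc, h,
        Limits.zero_comp])
    obtain ⟨R, hR, ha, ⟨φ⟩⟩ := exists_alive_of_coAlive h1 (coAlive_of_ne_zero h1.2 h4)
    obtain ⟨h, hh⟩ := ha.coxMap_surjective (φ.hom ≫ f ≫ φ1.inv)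
    refine ⟨R, φ, h ≫ g1, ha, .cons h g1 hR (fun hi => h2 ?_) hc1, ?_⟩
    · have := isIso_coxMap h hi
      have h5 : f = φ.inv ≫ coxMap h ≫ φ1.hom := by rw [hh]; simp
      rw [h5]
      infer_instance
    · rw [coxMap_comp, hh, hg1]
      simp

/-- The span of the images of the `j`-th flag subspaces under chains of a given length. -/
def reach (Y : Flag k n) (i : Fin 3) (j N : ℕ) : Submodule k Y.U :=
  Submodule.span k {w | ∃ (X : Flag k n) (f : X ⟶ Y) (x : X.U),
    Chain Ind f N ∧ x ∈ X.W i j ∧ lin f x = w}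

theorem mem_reach {X Y : Flag k n} {i : Fin 3} {j N : ℕ} {f : X ⟶ Y} {x : X.U}
    (hf : Chain Ind f N) (hx : x ∈ X.W i j) : lin f x ∈ Y.reach i j N :=
  Submodule.subset_span ⟨X, f, x, hf, hx, rfl⟩

theorem mem_reach_zero {Y : Flag k n} (hY : Y.Ind) {i : Fin 3} {j : ℕ} {w : Y.U}
    (hw : w ∈ Y.W i j) : w ∈ Y.reach i j 0 :=
  mem_reach (f := 𝟙 Y) (.nil _ hY hY inferInstance) hw

theorem ind_thin (l : Fin 3 → ℕ) (hl : l ≤ n) : (thin k l hl).Ind := by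
  refine ⟨?_, indecObj_thin l hl⟩
  change Module.Finite k k
  infer_instance

theorem not_isIso_thin {l l' : Fin 3 → ℕ} {hl : l ≤ n} {hl' : l' ≤ n} (h : ¬ l' ≤ l)
    (f : thin k l hl ⟶ thin k l' hl') : ¬ IsIso f := by
  intro hf
  refine h (le_of_hom_thin (f := inv f) fun h0 => ?_).1
  refine (indecObj_thin (k := k) l hl).1 ?_
  rw [← IsIso.hom_inv_id f, h0, Limits.comp_zero]

theorem exists_chain_thin (i : Fin 3) {j j' : ℕ} (h : j ≤ j') (h' : j' ≤ n i) :
    ∃ c : thin k (Pi.single i j) (single_le (h.trans h')) ⟶ thin k (Pi.single i j') (single_le h'),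
      Chain Ind c (j' - j) ∧ lin c gen = gen := by
  induction j', h using Nat.le_induction with
  | base =>
    rw [Nat.sub_self]
    exact ⟨𝟙 _, .nil _ (ind_thin _ _) (ind_thin _ _) inferInstance, rfl⟩
  | succ j' hj ih =>
    obtain ⟨c, hc, hg⟩ := ih (by omega)
    rw [show j' + 1 - j = j' - j + 1 by omega]
    refine ⟨c ≫ ofElem _ gen fun i' => mem_thin ?_ _, hc.snoc _ (ind_thin _ _) (not_isIso_thin
      (fun h' => ?_) _), ?_⟩
    · by_cases e : i' = i
      · subst e; simp
      · simp [e]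
    · have := h' i
      simp at this
    · rw [lin_comp, hg, lin_ofElem]

theorem Deep.mem_reach {Y : Flag k n} {m : ℕ} (h : Deep Y m) (hY : Y.Ind) {i : Fin 3} {j : ℕ}
    {w : Y.U} (hw : w ∈ Y.W i j) : w ∈ Y.reach i j (m - j) := by
  induction h generalizing i j with
  | zero => rw [Nat.zero_sub]; exact mem_reach_zero hY hw
  | @thin Y i0 j0 h φ =>
    rcases Nat.lt_or_ge j j0 with hj | hj
    swap
    · rw [Nat.sub_eq_zero_of_le hj]; exact mem_reach_zero hY hw
    by_cases h0 : w = 0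
    · rw [h0]; exact zero_mem _
    obtain ⟨c, hc, hg⟩ := exists_chain_thin (k := k) i0 hj.le h
    obtain ⟨s, hs⟩ := exists_smul_gen (lin φ.hom w)
    have hmem : (gen : (Flag.thin k (Pi.single i0 j) (single_le (n := n) (by omega))).U) ∈
        (Flag.thin k (Pi.single i0 j) (single_le (n := n) (by omega))).W i j := by
      refine mem_thin ?_ _
      have h1 := le_of_mem_thin (lin_mem φ.hom hw) (iso_ne_zero φ h0)
      by_cases e : i = i0
      · subst e; simp
      · rw [Pi.single_eq_of_ne e] at h1 ⊢
        exact h1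
    have h1 := Flag.mem_reach (hc.trans (.nil φ.inv (ind_thin _ _) hY inferInstance)) hmem
    rw [lin_comp, hg, add_zero] at h1
    rw [← iso_hom_inv φ w, hs, map_smul]
    exact Submodule.smul_mem _ _ h1
  | @step Y m ha hd ih =>
    have key : ∀ (i : Fin 3) (j : ℕ) (w : Y.U), w ∈ Y.W i (j + 1) →
        w ∈ Y.reach i (j + 1) (m + 2 - (j + 1)) := fun i j w hw => by
      rcases Nat.lt_or_ge m j with hj | hj
      · rw [Nat.sub_eq_zero_of_le (by omega)]; exact mem_reach_zero hY hw
      rcases Nat.lt_or_ge (n i) (j + 1) with hj' | hj'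
      · rw [Y.W_of_gt i _ hj', Submodule.mem_bot] at hw
        rw [hw]; exact zero_mem _
      obtain ⟨y, hy, rfl⟩ := ha.exists_lift hw (by omega)
      have h1 : Y.cox.reach i j (m - j) ≤
          (Y.reach i (j + 1) (m + 2 - (j + 1))).comap (Y.comp i) := by
        refine Submodule.span_le.2 ?_
        rintro _ ⟨X, f, x, hf, hx, rfl⟩
        change co (lin f x) i ∈ Y.reach i (j + 1) (m + 2 - (j + 1))
        by_cases h0 : co (lin f x) i = 0
        · rw [h0]; exact zero_mem _
        obtain ⟨R, φ, g, hR, hg, hgf⟩ := chain_lift hf (by rintro rfl; exact h0 rfl) ha hY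
          (Iso.refl _)
        have h2 : co (lin φ.inv x) i ∈ R.W i (j + 1) :=
          (mem_cox (by omega)).1 (lin_mem φ.inv hx)
        have h3 : lin g (co (lin φ.inv x) i) = co (lin f x) i := by
          have : co (lin (coxMap g) (lin φ.inv x)) i = co (lin f x) i := by
            rw [hgf, lin_comp, iso_inv_hom]
            rfl
          exact this
        have h4 := Flag.mem_reach (i := i) (j := j + 1) (x := gen)
          (Chain.cons (ofElem (single_le (by omega)) (co (lin φ.inv x) i) fun i' => ?_) g
            (ind_thin (Pi.single i (j + 1)) (single_le hj')) (hR.not_isIso _) hg)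
          (mem_thin (by simp) _)
        · rw [lin_comp, lin_ofElem, h3] at h4
          rwa [show m + 2 - (j + 1) = m - j + 1 by omega]
        · by_cases e : i' = i
          · subst e; simpa using h2
          · rw [Pi.single_eq_of_ne e]; exact R.mem_zero _ _
      exact h1 (ih (ha.ind_cox hY) hy)
    cases j with
    | succ j => exact key i j w hw
    | zero =>
      obtain ⟨u, hu, -, rfl⟩ := ha i w
      refine Submodule.sum_mem _ fun i' _ => ?_
      have h1 : Y.reach i' 1 (m + 1) ≤ Y.reach i 0 (m + 2) := by
        refine Submodule.span_le.2 ?_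
        rintro _ ⟨X, f, x, hf, hx, rfl⟩
        by_cases h0 : x = 0
        · rw [h0, map_zero]; exact zero_mem _
        have h4 := Flag.mem_reach (i := i) (j := 0) (x := gen)
          (Chain.cons (ofElem (single_le (i := i') (Nat.zero_le _)) x fun i' => ?_) f
            (ind_thin (Pi.single i' 0) (single_le (Nat.zero_le _))) (fun hi => ?_) hf)
          (mem_zero _ _ _)
        · rwa [lin_comp, lin_ofElem] at h4
        · rw [Pi.single_zero]; exact X.mem_zero _ _
        · let φ := asIso (ofElem (single_le (i := i') (Nat.zero_le _)) x fun i' => by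
            rw [Pi.single_zero]; exact X.mem_zero _ _)
          refine iso_ne_zero φ.symm h0 (thin_eq_zero (i := i') ?_ (lin_mem φ.inv hx))
          simp
      exact h1 (key i' 0 _ (hu i'))

/-- If sufficiently long chains vanish then every indecomposable object has a level. -/
theorem exists_lvl {N : ℕ} (hN : ∀ (X Y : Flag k n) (f : X ⟶ Y), Chain Ind f N → f = 0)
    {Y : Flag k n} (hY : Y.Ind) : ∃ m, Lvl Y m := by
  have hdeep : ∀ {Y : Flag k n} {m : ℕ}, Y.Ind → Deep Y m → m < N := fun {Y m} hY hd => by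
    by_contra hm
    obtain ⟨w, hw⟩ := exists_ne_zero hY.2.1
    rw [lin_id] at hw
    have h1 := hd.mem_reach hY (Y.mem_zero 0 w)
    refine hw ?_
    rw [← Submodule.mem_bot k]
    refine Submodule.span_le.2 ?_ h1
    rintro _ ⟨X, f, x, hf, hx, rfl⟩
    have hf0 : f = 0 := by
      by_contra h0
      obtain ⟨X', f', h2, h3⟩ := hf.exists_of_le h0 (n := N) (by omega)
      exact h3 (hN _ _ _ h2)
    rw [hf0]
    exact zero_mem _
  have h : ∀ (t : ℕ) (Y : Flag k n), Y.Ind → (∃ m, Lvl Y m) ∨ Deep Y (2 * t) := by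
    intro t
    induction t with
    | zero => exact fun Y _ => Or.inr (.zero Y)
    | succ t ih =>
      intro Y hY
      rcases thin_or_alive hY.2 with ⟨i, j, h, ⟨φ⟩⟩ | ha
      · exact Or.inl ⟨j, .thin h φ⟩
      · rcases ih _ (ha.ind_cox hY) with ⟨m, hm⟩ | hd
        · exact Or.inl ⟨_, .step ha hm⟩
        · exact Or.inr (.step ha hd)
  rcases h N Y hY with h | h
  · exact h
  · have := hdeep hY h
    omega

end Flag


/-! ## Representations of flags -/

namespace Flag

open Vtx

variable {k : Type} [Field k] {n : Fin 3 → ℕ}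

/-- The subspace of a flag object attached to a vertex. -/
def sub (X : Flag k n) : Vtx n → Submodule k X.U
  | .a => ⊥
  | .m i l _ => X.W i (l + 1)
  | .b => ⊤

theorem sub_mono (X : Flag k n) {u v : Vtx n} (h : u ≤ v) : X.sub u ≤ X.sub v := by
  cases u <;> cases v <;> first
    | exact bot_le
    | exact le_top
    | exact (id h : False).elim
    | skip
  obtain ⟨rfl, h⟩ := h
  exact X.W_anti _ (by omega)

theorem lin_mem_sub {X Y : Flag k n} (f : X ⟶ Y) (v : Vtx n) {x : X.U} (hx : x ∈ X.sub v) :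
    lin f x ∈ Y.sub v := by
  cases v with
  | a =>
    rw [(Submodule.mem_bot k).1 hx, map_zero]
    exact zero_mem _
  | m i l h => exact lin_mem f hx
  | b => trivial

/-- The representation of the poset of vertices given by three flags. -/
def rep (X : Flag k n) : Rep k (Vtx n) where
  V v := X.sub v
  map h := Submodule.inclusion (X.sub_mono h)
  map_refl _ _ := rfl
  map_map _ _ _ := rfl

/-- The functor from flags to representations. -/
def toRep (k : Type) [Field k] (n : Fin 3 → ℕ) : Flag k n ⥤ Rep k (Vtx n) where
  obj := rep
  map f := ⟨fun v => (lin f).restrict fun _ hx => lin_mem_sub f v hx, fun _ _ => rfl⟩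
  map_id _ := rfl
  map_comp _ _ := rfl

instance : (toRep k n).Faithful where
  map_injective {X Y f g} h := by
    ext x
    have h1 := congrArg (fun e : (toRep k n).obj X ⟶ (toRep k n).obj Y =>
      (e.app b (⟨x, trivial⟩ : X.sub b) : Y.sub b).1) h
    exact h1

instance : (toRep k n).Full where
  map_surjective {X Y} g := by
    let g' : ∀ v, X.sub v →ₗ[k] Y.sub v := fun v => g.app v
    have hg : ∀ v (x : X.sub v), (g' v x).1 = (g' b ⟨x.1, trivial⟩).1 := fun v x =>
      (congrArg Subtype.val (Rep.nat_apply g (le_b v) x)).symm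
    let L : X.U →ₗ[k] Y.U :=
      { toFun := fun x => (g' b ⟨x, trivial⟩).1
        map_add' := fun x y => congrArg Subtype.val
          (map_add (g' b) (⟨x, trivial⟩ : X.sub b) (⟨y, trivial⟩ : X.sub b))
        map_smul' := fun c x => congrArg Subtype.val
          (map_smul (g' b) c (⟨x, trivial⟩ : X.sub b)) }
    have hL : ∀ x h, (g' b ⟨x, h⟩).1 = L x := fun x h => rfl
    refine ⟨homMk L fun i j x hx => ?_, ?_⟩
    · cases j with
      | zero => exact Y.mem_zero _ _
      | succ l =>
        rcases Nat.lt_or_ge l (n i) with h | h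
        · have := (g' (m i l h) ⟨x, hx⟩).2
          rw [hg] at this
          exact this
        · rw [X.W_of_gt i _ (by omega), Submodule.mem_bot] at hx
          rw [hx, map_zero]
          exact zero_mem _
    · ext v x
      exact Subtype.ext (hg v x).symm

instance : (toRep k n).PreservesZeroMorphisms where
  map_zero X Y := by
    ext v x
    rfl

theorem ind_toRep {X : Flag k n} (hX : X.Ind) : ((toRep k n).obj X).Ind {v | v ≠ a} := by
  have := hX.1
  refine ⟨fun v => ?_, (indecObj_map (toRep k n) X).2 hX.2, fun v hv x => ?_⟩
  · change Module.Finite k (X.sub v)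
    infer_instance
  · rw [Set.mem_ofPred_eq, not_not] at hv
    subst hv
    exact Subtype.ext ((Submodule.mem_bot k).1 (show X.sub a from x).2)

/-- The flags of a representation with zero space at the source. -/
def ofRep (X : Rep k (Vtx n)) (ha : ∀ x : X.V a, x = 0) : Flag k n where
  U := X.V b
  W i j := LinearMap.range (X.map (le_b (lv n i j)))
  W_zero i := LinearMap.range_eq_top.2 fun x => ⟨x, X.map_refl b x⟩
  W_succ_le i j := by
    rintro _ ⟨x, rfl⟩
    exact ⟨X.map (lv_anti i (Nat.le_succ j)) x, X.map_map _ _ _⟩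
  W_of_gt i j h := by
    rw [eq_bot_iff]
    rintro _ ⟨x, rfl⟩
    have : ∀ (v : Vtx n) (_ : v = a) (x : X.V v), X.map (le_b v) x = 0 := by
      rintro _ rfl x
      rw [ha x, map_zero]
    exact this _ (Rep.lv_of_gt (by omega)) x

theorem mem_sub_ofRep {X : Rep k (Vtx n)} {ha : ∀ x : X.V a, x = 0} (v : Vtx n) (y : X.V b) :
    (show (ofRep X ha).U from y) ∈ (ofRep X ha).sub v ↔ ∃ x : X.V v, X.map (le_b v) x = y := by
  cases v with
  | a =>
    refine ⟨fun h => ⟨0, ?_⟩, ?_⟩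
    · rw [map_zero]; exact ((Submodule.mem_bot k).1 h).symm
    · rintro ⟨x, rfl⟩
      rw [ha x, map_zero]
      exact zero_mem _
  | m i l h =>
    have : ∀ v : Vtx n, v = m i l h →
        (y ∈ LinearMap.range (X.map (le_b v)) ↔ ∃ x : X.V (m i l h), X.map (le_b _) x = y) := by
      rintro _ rfl
      rfl
    exact this _ (lv_succ h)
  | b => exact ⟨fun _ => ⟨y, X.map_refl b y⟩, fun _ => trivial⟩

theorem exists_toRep_iso {X : Rep k (Vtx n)} (hX : X.Ind {v | v ≠ a}) {y : X.V b} (hy : y ≠ 0) :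
    ∃ F : Flag k n, F.Ind ∧ Nonempty ((toRep k n).obj F ≅ X) := by
  have ha : ∀ x : X.V a, x = 0 := hX.2.2 a (by simp)
  let F := ofRep X ha
  let θ : X ⟶ (toRep k n).obj F :=
    ⟨fun v => ((X.map (le_b v)).codRestrict (F.sub v) fun x => (mem_sub_ofRep v _).2 ⟨x, rfl⟩ :
      X.V v →ₗ[k] F.sub v), fun {u v} h x => Subtype.ext (X.map_map h (le_b v) x)⟩
  have : IsIso θ := by
    refine (Rep.isIso_iff θ).2 fun v => ⟨fun x x' h => ?_, fun z => ?_⟩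
    · exact Rep.injective_of_sink hX.2.1 hy v (congrArg Subtype.val
        (show (⟨X.map (le_b v) x, _⟩ : F.sub v) = ⟨X.map (le_b v) x', _⟩ from h))
    · obtain ⟨x, hx⟩ := (mem_sub_ofRep v _).1 (show F.sub v from z).2
      exact ⟨x, Subtype.ext hx⟩
  refine ⟨F, ⟨hX.1 b, (indecObj_map (toRep k n) F).1 (indecObj_of_iso (asIso θ) hX.2.1)⟩,
    ⟨(asIso θ).symm⟩⟩

end Flag

/-! ## Simple representations -/

namespace Rep

variable {k P : Type} [Field k] [PartialOrder P]

theorem IsInterval.indecObj {X : Rep k P} {p q : P} (hX : IsInterval X p q) (h : p ≤ q) :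
    IndecObj X := by
  constructor
  · intro h0
    obtain ⟨x, h1, -⟩ := hX
    refine (h1 q h le_rfl).1 ?_
    have : Hom.app (𝟙 X) q (X.map h x) = Hom.app (0 : X ⟶ X) q (X.map h x) := by rw [h0]
    exact this
  · intro e he
    by_cases h0 : e = 0
    · exact Or.inl h0
    obtain ⟨v, y, hy⟩ := exists_ne_zero h0
    have := hX.isIso hX e hy
    right
    rwa [← cancel_epi e, Category.comp_id]

/-- The simple representation at a vertex. -/
noncomputable def simple (k : Type) [Field k] (u : P) : Rep k P where
  V v := (if v = u then ⊤ else ⊥ : Submodule k k)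
  map {i j} _ := if h : i = j then Submodule.inclusion (by rw [h]) else 0
  map_refl i x := by
    rw [dif_pos rfl]
    rfl
  map_map {i j l} h h' x := by
    by_cases e : i = j
    · subst e
      by_cases e' : i = l
      · subst e'
        rw [dif_pos rfl]
        rfl
      · rw [dif_neg e']
        rfl
    · rw [dif_neg e]
      have : i ≠ l := fun e' => e (le_antisymm h (by rw [e']; exact h'))
      rw [dif_neg this, LinearMap.zero_apply, map_zero]
      rfl

/-- The space of the simple representation at its vertex. -/
def sgen (u : P) : (simple k u).V u :=
  (⟨1, by rw [if_pos rfl]; trivial⟩ : (if u = u then ⊤ else ⊥ : Submodule k k))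

theorem simple_eq_zero {u v : P} (h : v ≠ u) (x : (simple k u).V v) : x = 0 := by
  have h1 : ∀ (S : Submodule k k), S = ⊥ → ∀ x : S, x = 0 := by
    rintro _ rfl x
    exact Subsingleton.elim _ _
  exact h1 (if v = u then ⊤ else ⊥) (if_neg h) x

theorem sgen_ne (u : P) : (sgen u : (simple k u).V u) ≠ 0 := fun h =>
  one_ne_zero (α := k) (congrArg Subtype.val h)

theorem simple_smul (u : P) (x : (simple k u).V u) : ∃ c : k, x = c • sgen u :=
  ⟨(show (if u = u then ⊤ else ⊥ : Submodule k k) from x).1, Subtype.ext (mul_one _).symm⟩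

theorem isInterval_simple (u : P) : IsInterval (simple k u) u u := by
  refine ⟨sgen u, fun v h h' => ?_, fun v hv y => simple_eq_zero (fun e => hv ?_) y⟩
  · obtain rfl := le_antisymm h h'
    rw [map_refl]
    exact ⟨sgen_ne u, simple_smul u⟩
  · rw [e]
    exact ⟨le_rfl, le_rfl⟩

theorem fd_simple (u : P) : (simple k u).FD := fun v => by
  change Module.Finite k (if v = u then ⊤ else ⊥ : Submodule k k)
  infer_instance

theorem ind_simple {S : Set P} {u : P} (h : u ∈ S) : (simple k u).Ind S :=
  ⟨fd_simple u, (isInterval_simple u).indecObj le_rfl, fun v hv x =>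
    simple_eq_zero (fun e => hv (by rwa [e])) x⟩

/-- Morphisms into a simple representation. -/
noncomputable def toSimple {X : Rep k P} {u : P} (hX : ∀ v, v ≤ u → v ≠ u → ∀ x : X.V v, x = 0)
    (l : X.V u →ₗ[k] k) : X ⟶ simple k u where
  app v := if h : v = u then
    ((l.comp (X.map h.le)).codRestrict _ fun x => by rw [if_pos h]; trivial :
      X.V v →ₗ[k] (if v = u then ⊤ else ⊥ : Submodule k k)) else 0
  nat {i j} h x := by
    by_cases hj : j = u
    · subst hj
      by_cases hi : i = j
      · subst hi
        rw [map_refl, map_refl]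
      · rw [hX i h hi x, map_zero, map_zero, map_zero, map_zero]
    · exact (simple_eq_zero hj _).trans (simple_eq_zero hj _).symm

theorem toSimple_ne_zero {X : Rep k P} {u : P} (hX : ∀ v, v ≤ u → v ≠ u → ∀ x : X.V v, x = 0)
    (l : X.V u →ₗ[k] k) {x : X.V u} (hx : l x ≠ 0) : (toSimple hX l).app u x ≠ 0 := by
  intro h
  refine hx ?_
  have h1 : (toSimple hX l).app u = ((l.comp (X.map le_rfl)).codRestrict _ fun x => by
      rw [if_pos rfl]; trivial :
      X.V u →ₗ[k] (if u = u then ⊤ else ⊥ : Submodule k k)) := dif_pos rfl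
  rw [h1] at h
  have h2 : l (X.map le_rfl x) = 0 := congrArg Subtype.val h
  rwa [map_refl] at h2

theorem IsInterval.nonempty_iso_simple {X : Rep k P} {u : P} (hX : IsInterval X u u) :
    Nonempty (X ≅ simple k u) := by
  obtain ⟨x, h1, h2⟩ := id hX
  have hx := (h1 u le_rfl le_rfl).1
  rw [map_refl] at hx
  obtain ⟨l, hl⟩ := exists_form (k := k) hx
  let f := toSimple (u := u) (fun v _ hv y => h2 v (fun h => hv (le_antisymm h.2 h.1)) y) l
  have := hX.isIso (isInterval_simple u) f (toSimple_ne_zero _ l (x := x) (by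
    rw [hl]; exact one_ne_zero))
  exact ⟨asIso f⟩

theorem comp_ne_zero_of_simple {X Y : Rep k P} {u : P} {f : X ⟶ simple k u} (hf : f ≠ 0)
    {g : simple k u ⟶ Y} (hg : g ≠ 0) : f ≫ g ≠ 0 := by
  obtain ⟨v, x, hx⟩ := exists_ne_zero hf
  obtain rfl : v = u := by
    by_contra h
    exact hx (simple_eq_zero h _)
  obtain ⟨w, y, hy⟩ := exists_ne_zero hg
  obtain rfl : w = v := by
    by_contra h
    exact hy (by rw [simple_eq_zero h y, map_zero])
  obtain ⟨c, hc⟩ := simple_smul w (f.app w x)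
  obtain ⟨d, rfl⟩ := simple_smul w y
  intro h0
  have h1 : g.app w (f.app w x) = 0 := by rw [← comp_app, h0, zero_app]
  rw [map_smul] at hy
  rw [hc, map_smul] at h1
  rcases smul_eq_zero.1 h1 with rfl | h1
  · exact hx (by rw [hc, zero_smul])
  · exact hy (by rw [h1, smul_zero])

end Rep


/-! ## Chains of representations vanishing at the source -/

section

open Toupie.Vtx Toupie.Flag

variable {k : Type} [Field k] {n : Fin 3 → ℕ}

theorem Flag.level_update_le (hlev : ∀ Y : Flag k n, Y.Ind → ∃ d, Lvl Y d) {m : ℕ}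
    (hm : Lvl (thin k n le_rfl) m) (i : Fin 3) (d : ℕ) {j : ℕ} (h : j + d = n i)
    (hl : Function.update n i j ≤ n) {c : ℕ} (hc : Lvl (thin k (Function.update n i j) hl) c) :
    c + d ≤ m := by
  induction d generalizing j c with
  | zero =>
    have h1 : lin (ofElem hl (X := thin k n le_rfl) gen fun i => mem_thin (hl i) _) gen ≠ 0 := by
      rw [lin_ofElem]
      exact gen_ne
    exact (hc.hom hm (ne_zero_of_apply h1)).1
  | succ d ih =>
    have hl' : Function.update n i (j + 1) ≤ n := by
      intro i'
      by_cases e : i' = i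
      · subst e
        rw [Function.update_self]
        exact (show j + 1 ≤ n i' by omega)
      · rw [Function.update_of_ne e]
    obtain ⟨c', hc'⟩ := hlev _ (ind_thin _ hl')
    have h0 : ∀ i', Function.update n i j i' ≤ Function.update n i (j + 1) i' := fun i' => by
      by_cases e : i' = i
      · subst e; simp
      · simp [e]
    have h1 : lin (ofElem hl (X := thin k _ hl') gen fun i => mem_thin (h0 i) _) gen ≠ 0 := by
      rw [lin_ofElem]
      exact gen_ne
    have h2 := hc.hom hc' (ne_zero_of_apply h1)
    have h3 := ih (by omega) hl' hc'
    have h4 : c ≠ c' := fun e => not_isIso_thin (fun h => by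
      have := h i
      simp at this) _ (h2.2 e)
    omega

/-- A numerical invariant which increases along non-isomorphisms between indecomposable
representations vanishing at the source. -/
def Pot (m : ℕ) (X : Rep k (Vtx n)) (d : ℕ) : Prop :=
  (∃ F : Flag k n, Lvl F d ∧ Nonempty ((toRep k n).obj F ≅ X)) ∨
    ∃ (i : Fin 3) (lo hi : ℕ) (h : lo ≤ hi) (h' : hi < n i),
      Rep.IsInterval X (Vtx.m i hi h') (Vtx.m i lo (h.trans_lt h')) ∧ d + n i = m + hi + lo + 2

variable {m : ℕ}

theorem exists_pot (hlev : ∀ Y : Flag k n, Y.Ind → ∃ d, Lvl Y d)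
    (hm : Lvl (thin k n le_rfl) m) {X : Rep k (Vtx n)} (hX : X.Ind {v | v ≠ a}) :
    ∃ d, Pot m X d := by
  by_cases hb : ∀ x : X.V b, x = 0
  · obtain ⟨i, lo, hi, h, h', hI⟩ := Rep.exists_isInterval hX.2.1 (hX.2.2 a (by simp)) hb
    have := (hm.le_of_mem (mem_thin (le_refl (n i)) gen) gen_ne).1
    exact ⟨m + hi + lo + 2 - n i, Or.inr ⟨i, lo, hi, h, h', hI, by omega⟩⟩
  · push Not at hb
    obtain ⟨y, hy⟩ := hb
    obtain ⟨F, hF, φ⟩ := exists_toRep_iso hX hy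
    obtain ⟨d, hd⟩ := hlev F hF
    exact ⟨d, Or.inl ⟨F, hd, φ⟩⟩

theorem Rep.iso_app_ne_zero {P : Type} [PartialOrder P] {X Y : Rep k P} (φ : X ≅ Y) {v : P}
    {x : X.V v} (hx : x ≠ 0) : φ.hom.app v x ≠ 0 := fun h => hx (by
  have : φ.inv.app v (φ.hom.app v x) = x := by rw [← Rep.comp_app, φ.hom_inv_id, Rep.id_app]
  rw [← this, h, map_zero])

theorem toRep_sink_ne_zero {F : Flag k n} (hF : F.Ind) :
    ∃ y : ((toRep k n).obj F).V b, y ≠ 0 := by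
  obtain ⟨x, hx⟩ := Flag.exists_ne_zero hF.2.1
  exact ⟨(⟨x, trivial⟩ : F.sub b), fun h => hx (congrArg Subtype.val h)⟩

theorem toRep_hom_interval (hlev : ∀ Y : Flag k n, Y.Ind → ∃ d, Lvl Y d)
    (hm : Lvl (thin k n le_rfl) m) {F : Flag k n} {d : ℕ} (hF : Lvl F d) {Y : Rep k (Vtx n)}
    {i : Fin 3} {lo hi : ℕ} {h : lo ≤ hi} {h' : hi < n i}
    (hY : Rep.IsInterval Y (Vtx.m i hi h') (Vtx.m i lo (h.trans_lt h')))
    {f : (toRep k n).obj F ⟶ Y} (hf : f ≠ 0) : d + n i ≤ m + hi + 1 := by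
  obtain ⟨v, x, hx⟩ := Rep.exists_ne_zero hf
  obtain ⟨y0, h1, h2⟩ := hY
  have hv : Vtx.m i hi h' ≤ v ∧ v ≤ Vtx.m i lo (h.trans_lt h') := by
    by_contra hv
    exact hx (h2 v hv _)
  obtain ⟨c, hc⟩ := (h1 v hv.1 hv.2).2 (f.app v x)
  have hc0 : c ≠ 0 := by
    rintro rfl
    exact hx (by rw [hc, zero_smul])
  have h3 : ∃ x : F.W i (lo + 1), f.app (Vtx.m i lo (h.trans_lt h')) x ≠ 0 := by
    refine ⟨((toRep k n).obj F).map hv.2 x, ?_⟩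
    have h4 := Rep.nat_apply f hv.2 x
    rw [hc, map_smul, Rep.map_map] at h4
    intro h5
    have h6 := h4.symm.trans h5
    exact (h1 _ (hv.1.trans hv.2) le_rfl).1 ((smul_eq_zero.1 h6).resolve_left hc0)
  obtain ⟨⟨x, hxW⟩, hx⟩ := h3
  have hx' : x ∉ F.W i (hi + 2) := by
    intro hxm
    rcases Nat.lt_or_ge (hi + 1) (n i) with hh | hh
    · have hv' : Vtx.m i (hi + 1) hh ≤ Vtx.m i lo (h.trans_lt h') := m_le_m (by omega)
      have h4 := Rep.nat_apply f hv' (show ((toRep k n).obj F).V _ from (⟨x, hxm⟩ : F.W i (hi + 2)))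
      rw [h2 (Vtx.m i (hi + 1) hh) (fun h => by
          have := (m_le_m_iff.1 h.1).2
          omega) (f.app _ _), map_zero] at h4
      exact hx h4
    · rw [F.W_of_gt i _ (by omega), Submodule.mem_bot] at hxm
      subst hxm
      exact hx (map_zero (f.app (Vtx.m i lo (h.trans_lt h'))))
  obtain ⟨l, hl, hl0⟩ := exists_form_of_notMem hx'
  have hle : Function.update n i (hi + 1) ≤ n := by
      intro i'
      by_cases e : i' = i
      · subst e
        rw [Function.update_self]
        exact (show hi + 1 ≤ n i' by omega)
      · rw [Function.update_of_ne e]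
  obtain ⟨c', hc'⟩ := hlev _ (ind_thin _ hle)
  have h5 : lin (ofForm hle l fun i' y hy => by
      by_cases e : i' = i
      · subst e
        rw [Function.update_self] at hy
        exact hl0 y hy
      · rw [Function.update_of_ne e, F.W_of_gt i' _ (by omega), Submodule.mem_bot] at hy
        rw [hy, map_zero]) x ≠ 0 := by
    rw [lin_ofForm, hl, one_smul]
    exact gen_ne
  have h6 := (hF.hom hc' (ne_zero_of_apply h5)).1
  have h7 := Flag.level_update_le hlev hm i (n i - (hi + 1)) (by omega) hle hc'
  omega

theorem Pot.hom (hlev : ∀ Y : Flag k n, Y.Ind → ∃ d, Lvl Y d)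
    (hm : Lvl (thin k n le_rfl) m) {X Y : Rep k (Vtx n)} {d d' : ℕ}
    (hX : Pot m X d) (hY : Pot m Y d') (hYI : Y.Ind {v | v ≠ a}) {f : X ⟶ Y} (hf : f ≠ 0) :
    d ≤ d' ∧ (d = d' → IsIso f) := by
  rcases hX with ⟨F, hF, ⟨φ⟩⟩ | ⟨i, lo, hi, h, h', hX, hd⟩
  · have hf1 : φ.hom ≫ f ≠ 0 := fun h => hf (by
      rw [← Category.id_comp f, ← φ.inv_hom_id, Category.assoc, h, Limits.comp_zero])
    rcases hY with ⟨G, hG, ⟨ψ⟩⟩ | ⟨i, lo, hi, h, h', hY, hd'⟩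
    · obtain ⟨g, hg⟩ := (toRep k n).map_surjective (φ.hom ≫ f ≫ ψ.inv)
      have hf2 : f = φ.inv ≫ (toRep k n).map g ≫ ψ.hom := by rw [hg]; simp
      have hg0 : g ≠ 0 := by
        rintro rfl
        exact hf (by rw [hf2]; simp)
      obtain ⟨h1, h2⟩ := hF.hom hG hg0
      refine ⟨h1, fun e => ?_⟩
      have := h2 e
      rw [hf2]
      infer_instance
    · have := toRep_hom_interval (h := h) hlev hm hF hY hf1
      exact ⟨by omega, fun e => by omega⟩
  · rcases hY with ⟨G, hG, ⟨ψ⟩⟩ | ⟨i', lo', hi', g, g', hY, hd'⟩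
    · exfalso
      obtain ⟨y, hy⟩ := toRep_sink_ne_zero ⟨by
        have := hYI.1 b
        exact Module.Finite.of_injective (Rep.Hom.app ψ.hom b ∘ₗ
          (LinearMap.codRestrict (G.sub b) LinearMap.id fun x => trivial))
          (fun x y hxy => by
            have h1 := ((Rep.isIso_iff ψ.hom).1 inferInstance b).1 hxy
            exact congrArg Subtype.val h1),
        (indecObj_map (toRep k n) G).1 (indecObj_of_iso ψ.symm hYI.2.1)⟩
      refine hf (Rep.eq_zero_of_sink (fun x => ?_) hYI.2.1 (Rep.iso_app_ne_zero ψ hy) f)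
      obtain ⟨_, _, h2⟩ := hX
      exact h2 b (fun hb => not_b_le_m hb.2) x
    · obtain ⟨v, x, hx⟩ := Rep.exists_ne_zero hf
      obtain ⟨-, -, h1, h2⟩ := hX.of_ne_zero hY f hx
      obtain ⟨rfl, h1⟩ := m_le_m_iff.1 h1
      obtain ⟨-, h2⟩ := m_le_m_iff.1 h2
      refine ⟨by omega, fun e => ?_⟩
      obtain rfl : hi = hi' := by omega
      obtain rfl : lo = lo' := by omega
      exact hX.isIso hY f hx

theorem Pot.chain (hlev : ∀ Y : Flag k n, Y.Ind → ∃ d, Lvl Y d)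
    (hm : Lvl (thin k n le_rfl) m) {X Y : Rep k (Vtx n)} {f : X ⟶ Y} {N d d' : ℕ}
    (hc : Chain (Rep.Ind {v | v ≠ a}) f N) (hf : f ≠ 0) (hX : Pot m X d) (hY : Pot m Y d') :
    d + N ≤ d' := by
  induction hc generalizing d with
  | nil f h1 h2 h3 => exact (hX.hom hlev hm hY h2 hf).1
  | cons f g h1 h2 h3 ih =>
    obtain ⟨e, he⟩ := exists_pot hlev hm h3.left
    have h4 := ih (by rintro rfl; exact hf Limits.comp_zero) he hY
    have h5 := hX.hom hlev hm he h3.left (f := f) (by rintro rfl; exact hf Limits.zero_comp)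
    have h6 : d ≠ e := fun e => h2 (h5.2 e)
    omega

theorem Pot.le_of_ne_zero {X : Rep k (Vtx n)} {d : ℕ} (hX : Pot m X d) {i : Fin 3} {l : ℕ}
    {hl : l < n i} {x : X.V (Vtx.m i l hl)} (hx : x ≠ 0) (hm : n i ≤ m) : l + 1 ≤ d := by
  rcases hX with ⟨F, hF, ⟨φ⟩⟩ | ⟨i', lo, hi, h, h', ⟨_, _, h2⟩, hd⟩
  · have h1 := Rep.iso_app_ne_zero φ.symm hx
    exact (hF.le_of_mem (i := i) (j := l + 1) (show F.W i (l + 1) from φ.inv.app _ x).2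
      fun h => h1 (Subtype.ext h)).1
  · have hv : Vtx.m i' hi h' ≤ Vtx.m i l hl ∧ Vtx.m i l hl ≤ Vtx.m i' lo (h.trans_lt h') := by
      by_contra hv
      exact hx (h2 _ hv x)
    obtain ⟨rfl, h1⟩ := m_le_m_iff.1 hv.1
    omega

theorem Pot.le_of_sink_ne_zero (hm : Lvl (thin k n le_rfl) m) {X : Rep k (Vtx n)} {d : ℕ} (hX : Pot m X d)
    {x : X.V b} (hx : x ≠ 0) : d ≤ m := by
  rcases hX with ⟨F, hF, ⟨φ⟩⟩ | ⟨i', lo, hi, h, h', ⟨_, _, h2⟩, hd⟩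
  · have h1 := Rep.iso_app_ne_zero φ.symm hx
    obtain ⟨y, hy⟩ : ∃ y : F.U, y ≠ 0 :=
      ⟨(show F.sub b from φ.inv.app _ x).1, fun h => h1 (Subtype.ext h)⟩
    obtain ⟨l, hl⟩ := Rep.exists_form (k := k) hy
    have h2 : lin (ofForm (le_refl n) l fun i y hy => by
        rw [F.W_of_gt i _ (by omega), Submodule.mem_bot] at hy
        rw [hy, map_zero]) y ≠ 0 := by
      rw [lin_ofForm, hl, one_smul]
      exact gen_ne
    exact (hF.hom hm (ne_zero_of_apply h2)).1
  · exact absurd (h2 b (fun hb => not_b_le_m hb.2) x) hx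

theorem Pot.le_of_ne_zero' (hm : Lvl (thin k n le_rfl) m) {X : Rep k (Vtx n)} {d : ℕ} (hX : Pot m X d) {i : Fin 3} {l : ℕ}
    {hl : l < n i} {x : X.V (Vtx.m i l hl)} (hx : x ≠ 0) : d ≤ m + l + 1 := by
  rcases id hX with ⟨F, hF, ⟨φ⟩⟩ | ⟨i', lo, hi, h, h', ⟨_, _, h2⟩, hd⟩
  · have h1 := Rep.iso_app_ne_zero φ.symm hx
    have h2 : (⟨(show F.W i (l + 1) from φ.inv.app _ x).1, trivial⟩ : F.sub b) ≠ 0 := fun h => by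
      have h3 : (show F.W i (l + 1) from φ.inv.app _ x).1 = 0 := congrArg Subtype.val h
      exact h1 (Subtype.ext h3)
    have := hX.le_of_sink_ne_zero hm (Rep.iso_app_ne_zero φ (v := b) h2)
    omega
  · have hv : Vtx.m i' hi h' ≤ Vtx.m i l hl ∧ Vtx.m i l hl ≤ Vtx.m i' lo (h.trans_lt h') := by
      by_contra hv
      exact hx (h2 _ hv x)
    obtain ⟨rfl, h1⟩ := m_le_m_iff.1 hv.2
    omega

/-- Chains of representations vanishing at the source have length at most `m`. -/
theorem chain_le (hlev : ∀ Y : Flag k n, Y.Ind → ∃ d, Lvl Y d)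
    (hm : Lvl (thin k n le_rfl) m) {X Y : Rep k (Vtx n)} {f : X ⟶ Y} {N : ℕ}
    (hc : Chain (Rep.Ind {v | v ≠ a}) f N) (hf : f ≠ 0) : N ≤ m := by
  obtain ⟨d, hX⟩ := exists_pot hlev hm hc.left
  obtain ⟨d', hY⟩ := exists_pot hlev hm hc.right
  have h := Pot.chain hlev hm hc hf hX hY
  obtain ⟨v, x, hx⟩ := Rep.exists_ne_zero hf
  have hx0 : x ≠ 0 := by
    rintro rfl
    exact hx (map_zero _)
  cases v with
  | a => exact absurd (hc.left.2.2 a (by simp) x) hx0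
  | b =>
    have := hY.le_of_sink_ne_zero hm hx
    omega
  | m i l hl =>
    have h1 := hX.le_of_ne_zero hx0 (hm.le_of_mem (mem_thin (le_refl (n i)) gen) gen_ne).1
    have h2 := hY.le_of_ne_zero' hm hx
    omega

/-- There is a chain of length `m` to the simple representation in the branch of length one. -/
theorem exists_chain_to_simple (h0 : n 0 = 1) (hm : Lvl (thin k n le_rfl) m) :
    ∃ (X : Rep k (Vtx n)) (f : X ⟶ Rep.simple k (Vtx.m 0 0 (by omega))),
      Chain (Rep.Ind {v | v ≠ a}) f m ∧ f ≠ 0 := by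
  let I : Flag k n := thin k n le_rfl
  have hI : I.Ind := ind_thin _ _
  have hmem : (gen : I.U) ∈ I.W 0 1 := mem_thin h0.ge _
  have hm1 := (hm.le_of_mem hmem gen_ne).1
  have h1 := hm.deep.mem_reach hI hmem
  obtain ⟨X, f, x, hf, hx, hne⟩ : ∃ (X : Flag k n) (f : X ⟶ I) (x : X.U),
      Chain Ind f (m - 1) ∧ x ∈ X.W 0 1 ∧ lin f x ≠ 0 := by
    by_contra hcon
    push Not at hcon
    refine gen_ne (k := k) (n := n) (l := n) (hl := le_rfl) ?_
    rw [← Submodule.mem_bot k]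
    refine Submodule.span_le.2 ?_ h1
    rintro _ ⟨X, f, x, hf, hx, rfl⟩
    rw [hcon X f x hf hx]
    exact zero_mem _
  let u : Vtx n := Vtx.m 0 0 (by omega)
  let g : (toRep k n).obj I ⟶ Rep.simple k u := Rep.toSimple (fun v hv hvu y => by
      cases v with
      | a => exact (ind_toRep hI).2.2 a (by simp) y
      | b => exact absurd hv not_b_le_m
      | m i l h =>
        obtain ⟨rfl, h1⟩ := m_le_m_iff.1 hv
        exact absurd (by congr; omega) hvu) (I.W 0 1).subtype
  have hg : ∀ y : I.W 0 1, y.1 ≠ 0 → g.app u y ≠ 0 := fun y hy =>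
    Rep.toSimple_ne_zero (X := (toRep k n).obj I) (u := u) _ _ (x := y) hy
  have hc := hf.map (toRep k n) (fun X hX => ind_toRep hX)
  have hc' := hc.snoc g (Rep.ind_simple (by simp [u])) (fun hi => by
    obtain ⟨y, hy⟩ := toRep_sink_ne_zero hI
    have := Rep.iso_app_ne_zero (asIso g) hy
    exact this (Rep.simple_eq_zero (by simp [u]) _))
  rw [Nat.sub_add_cancel hm1] at hc'
  refine ⟨_, _, hc', fun h => hg ⟨lin f x, lin_mem f hx⟩ hne ?_⟩
  have : Rep.Hom.app ((toRep k n).map f ≫ g) u (⟨x, hx⟩ : X.W 0 1) = 0 := by rw [h]; rfl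
  exact this

end


/-! ## The length of chains on either side -/

section

variable {k : Type} [Field k]

theorem Rep.IsInterval.dual {P : Type} [PartialOrder P] {ρ : P → P}
    (hρ : ∀ {i j : P}, i ≤ j → ρ j ≤ ρ i) (hinv : ∀ i, ρ (ρ i) = i) {X : Rep k P} {u : P}
    (hX : X.IsInterval (ρ u) (ρ u)) : (Rep.dual hρ X).IsInterval u u := by
  obtain ⟨x, h1, h2⟩ := hX
  obtain ⟨hx, h1⟩ := h1 _ le_rfl le_rfl
  rw [Rep.map_refl] at hx
  simp only [Rep.map_refl] at h1
  obtain ⟨l, hl⟩ := Rep.exists_form (k := k) hx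
  refine ⟨(show Module.Dual k (X.V (ρ u)) from l), fun v h h' => ?_, fun v hv y => ?_⟩
  · obtain rfl := le_antisymm h h'
    have h4 : ∃ l' : (Rep.dual hρ X).V u, Rep.ev hρ l' = l := ⟨l, rfl⟩
    obtain ⟨l', rfl⟩ := h4
    change (Rep.dual hρ X).map h l' ≠ 0 ∧ ∀ y, ∃ c : k, y = c • (Rep.dual hρ X).map h l'
    rw [Rep.map_refl]
    refine ⟨fun h0 => ?_, fun y => ⟨Rep.ev hρ y x, LinearMap.ext fun z => ?_⟩⟩
    · have h3 : Rep.ev hρ l' x = 0 := congrArg (fun q => Rep.ev hρ q x) h0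
      exact one_ne_zero (hl.symm.trans h3)
    · obtain ⟨c, rfl⟩ := h1 z
      change Rep.ev hρ y (c • x) = Rep.ev hρ y x * Rep.ev hρ l' (c • x)
      rw [map_smul, map_smul, hl, smul_eq_mul, smul_eq_mul, mul_one, mul_comm]
  · refine LinearMap.ext fun z => ?_
    change Rep.ev hρ y z = 0
    rw [h2 (ρ v) (fun h => hv ?_) z, map_zero]
    have := congrArg ρ (le_antisymm h.1 h.2)
    rw [hinv, hinv] at this
    rw [this]
    exact ⟨le_rfl, le_rfl⟩

variable (k) in
/-- The number `m` is the maximal length of a nonzero chain of representations vanishing at the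
source, or at the sink, and is attained by chains through the simple representation at the
middle vertex of the branch of length one. -/
structure IsLength (n : Fin 3 → ℕ) (h0 : n 0 = 1) (m : ℕ) : Prop where
  one_le : 1 ≤ m
  le : ∀ {X Y : Rep k (Vtx n)} (f : X ⟶ Y) {N : ℕ}, Chain (Rep.Ind {v | v ≠ Vtx.a}) f N →
    f ≠ 0 → N ≤ m
  le' : ∀ {X Y : Rep k (Vtx n)} (f : X ⟶ Y) {N : ℕ}, Chain (Rep.Ind {v | v ≠ Vtx.b}) f N →
    f ≠ 0 → N ≤ m
  exists_chain : ∃ (X : Rep k (Vtx n)) (f : X ⟶ Rep.simple k (Vtx.m 0 0 (by omega))),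
    Chain (Rep.Ind {v | v ≠ Vtx.a}) f m ∧ f ≠ 0
  exists_chain' : ∃ (X : Rep k (Vtx n)) (f : Rep.simple k (Vtx.m 0 0 (by omega)) ⟶ X),
    Chain (Rep.Ind {v | v ≠ Vtx.b}) f m ∧ f ≠ 0

variable {n : Fin 3 → ℕ}

theorem rev_preimage_a : Vtx.rev ⁻¹' {v : Vtx n | v ≠ Vtx.a} = {v | v ≠ Vtx.b} := by
  ext v
  cases v <;> simp [Vtx.rev]

theorem rev_preimage_b : Vtx.rev ⁻¹' {v : Vtx n | v ≠ Vtx.b} = {v | v ≠ Vtx.a} := by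
  ext v
  cases v <;> simp [Vtx.rev]

theorem exists_isLength (h0 : n 0 = 1) {M : ℕ} (hM : ∀ (X Y : Rep k (Vtx n)) (f : X ⟶ Y),
    Chain (Rep.Ind {v | v ≠ Vtx.a}) f M → f = 0) : ∃ m, IsLength k n h0 m := by
  have hlev : ∀ Y : Flag k n, Y.Ind → ∃ d, Flag.Lvl Y d := fun Y hY =>
    Flag.exists_lvl (N := M) (fun X Y f hf => by
      have h1 := hM _ _ _ (hf.map (Flag.toRep k n) fun X hX => Flag.ind_toRep hX)
      exact (Flag.toRep k n).map_injective (by rw [h1, Functor.map_zero])) hY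
  obtain ⟨m, hm⟩ := hlev _ (Flag.ind_thin n le_rfl)
  refine ⟨m, h0.symm.le.trans (hm.le_of_mem (Flag.mem_thin (le_refl (n 0)) Flag.gen) Flag.gen_ne).1,
    fun f _ hf h => chain_le hlev hm hf h, fun {X Y} f {N} hf h => ?_,
    exists_chain_to_simple h0 hm, ?_⟩
  · have h1 := Rep.dual_chain Vtx.rev_anti Vtx.rev_rev hf
    rw [rev_preimage_b] at h1
    refine chain_le hlev hm h1 fun h2 => h ?_
    exact Rep.dualHom_injective Vtx.rev_anti Vtx.rev_rev (h2.trans (Rep.dualHom_zero _ _ _).symm)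
  · obtain ⟨X, f, hf, hne⟩ := exists_chain_to_simple h0 hm
    have h1 := Rep.dual_chain Vtx.rev_anti Vtx.rev_rev hf
    rw [rev_preimage_a] at h1
    have hu : Vtx.rev (Vtx.m 0 0 (by omega) : Vtx n) = Vtx.m 0 0 (by omega) := by
      simp [Vtx.rev, h0]
    obtain ⟨φ⟩ := (Rep.IsInterval.dual Vtx.rev_anti Vtx.rev_rev
      (X := Rep.simple k (Vtx.m 0 0 (by omega) : Vtx n)) (u := Vtx.m 0 0 (by omega)) (by
        rw [hu]
        exact Rep.isInterval_simple _)).nonempty_iso_simple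
    refine ⟨_, φ.inv ≫ Rep.dualHom Vtx.rev_anti f,
      h1.iso_comp _ (Rep.ind_simple (by simp)) inferInstance, fun h2 => hne ?_⟩
    have h3 : Rep.dualHom Vtx.rev_anti f = 0 := by
      rw [← Category.id_comp (Rep.dualHom Vtx.rev_anti f), ← φ.hom_inv_id, Category.assoc, h2,
        Limits.comp_zero]
    exact Rep.dualHom_injective Vtx.rev_anti Vtx.rev_rev (h3.trans (Rep.dualHom_zero _ _ _).symm)

theorem exists_isLength' (h0 : n 0 = 1) {M : ℕ} (hM : ∀ (X Y : Rep k (Vtx n)) (f : X ⟶ Y),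
    Chain (Rep.Ind {v | v ≠ Vtx.b}) f M → f = 0) : ∃ m, IsLength k n h0 m := by
  refine exists_isLength h0 (M := M) fun X Y f hf => ?_
  have h1 := Rep.dual_chain Vtx.rev_anti Vtx.rev_rev hf
  rw [rev_preimage_a] at h1
  exact Rep.dualHom_injective Vtx.rev_anti Vtx.rev_rev
    ((hM _ _ _ h1).trans (Rep.dualHom_zero _ _ _).symm)

end


/-! ## Chains over the whole algebra -/

section

open Toupie.Vtx

variable {k : Type} [Field k]

namespace Rep

/-- The image of a morphism of representations. -/
def image {P : Type} [PartialOrder P] {X Y : Rep k P} (f : X ⟶ Y) : Rep k P where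
  V v := LinearMap.range (f.app v)
  map {v w} h := (Y.map h).restrict fun y hy => by
    obtain ⟨x, rfl⟩ := hy
    exact ⟨X.map h x, nat_apply f h x⟩
  map_refl v x := Subtype.ext (Y.map_refl v x.1)
  map_map h h' x := Subtype.ext (Y.map_map h h' x.1)

/-- The canonical morphism onto the image. -/
def toImage {P : Type} [PartialOrder P] {X Y : Rep k P} (f : X ⟶ Y) : X ⟶ image f where
  app v := (f.app v).rangeRestrict
  nat h x := Subtype.ext (nat_apply f h x)

/-- The inclusion of the image. -/
def imageι {P : Type} [PartialOrder P] {X Y : Rep k P} (f : X ⟶ Y) : image f ⟶ Y where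
  app v := (LinearMap.range (f.app v)).subtype
  nat _ _ := rfl

theorem toImage_imageι {P : Type} [PartialOrder P] {X Y : Rep k P} (f : X ⟶ Y) :
    toImage f ≫ imageι f = f := rfl

theorem suppIn_univ {P : Type} [PartialOrder P] (X : Rep k P) : X.SuppIn Set.univ :=
  fun _ h => absurd trivial h

theorem eq_zero_of_isIso {P : Type} [PartialOrder P] {X Y : Rep k P} (f : X ⟶ Y) (hf : IsIso f)
    {v : P} (hY : ∀ y : Y.V v, y = 0) (x : X.V v) : x = 0 := by
  by_contra hx
  exact iso_app_ne_zero (asIso f) hx (hY _)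

theorem eq_zero_of_isIso' {P : Type} [PartialOrder P] {X Y : Rep k P} (f : X ⟶ Y) (hf : IsIso f)
    {v : P} (hX : ∀ x : X.V v, x = 0) (y : Y.V v) : y = 0 :=
  eq_zero_of_isIso (inv f) inferInstance hX y

end Rep

open Toupie.Rep

variable {n : Fin 3 → ℕ} {R : Type} [Ring R] [Algebra k R] [FiniteDimensional k R]

theorem ind_ne {X : Rep k (Vtx n)} (hX : X.Ind Set.univ) {v : Vtx n} (h : ∀ x : X.V v, x = 0) :
    X.Ind {w | w ≠ v} :=
  ⟨hX.1, hX.2.1, fun w hw => by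
    obtain rfl : w = v := by
      by_contra e
      exact hw e
    exact h⟩

/-- A nonzero composite with a vanishing source at the start and a vanishing sink at the end passes
through an indecomposable representation vanishing at both. -/
theorem exists_middle (σ : IncSys k R (Vtx n) Set.univ) {W X Y Z : Rep k (Vtx n)} (p : W ⟶ X)
    (f : X ⟶ Y) (g : Y ⟶ Z) (hY : Y.FD) (hXa : ∀ x : X.V a, x = 0) (hYb : ∀ y : Y.V b, y = 0)
    (h : p ≫ f ≫ g ≠ 0) : ∃ (M : Rep k (Vtx n)) (u : X ⟶ M) (w : M ⟶ Y), M.Ind Set.univ ∧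
      (∀ x : M.V a, x = 0) ∧ (∀ x : M.V b, x = 0) ∧ p ≫ u ≠ 0 ∧ w ≫ g ≠ 0 := by
  obtain ⟨M, i, q, hM, hiq, h1⟩ := σ.exists_ind_summand (suppIn_univ W) (suppIn_univ Z)
    (suppIn_univ (image f)) (fun v => by
      have := hY v
      change Module.Finite k (LinearMap.range (f.app v))
      infer_instance) (p ≫ toImage f) (imageι f ≫ g) (by
      rw [Category.assoc, ← Category.assoc (toImage f), toImage_imageι]
      exact h)
  have h2 : ∀ v, (∀ x : (image f).V v, x = 0) → ∀ x : M.V v, x = 0 := fun v hv x => by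
    have : q.app v (i.app v x) = x := by rw [← comp_app, hiq, id_app]
    rw [← this, hv (i.app v x), map_zero]
  refine ⟨M, toImage f ≫ q, i ≫ imageι f, hM, h2 a ?_, h2 b ?_, fun h3 => h1 ?_, fun h3 => h1 ?_⟩
  · rintro ⟨_, x, rfl⟩
    exact Subtype.ext ((congrArg (f.app a) (hXa x)).trans (map_zero (f.app a)))
  · rintro ⟨y, hy⟩
    exact Subtype.ext (hYb y)
  · rw [← Category.assoc, Category.assoc p, h3, Limits.zero_comp]
  · rw [Category.assoc] at h3
    rw [h3, Limits.comp_zero, Limits.comp_zero]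

theorem chain_of_sink {X Y : Rep k (Vtx n)} {f : X ⟶ Y} {N : ℕ} (h : Chain (Ind Set.univ) f N)
    (hf : f ≠ 0) (hX : ∀ x : X.V b, x = 0) : Chain (Ind {v | v ≠ b}) f N := by
  induction h with
  | nil f h1 h2 h3 => exact .nil _ (ind_ne h1 hX) (ind_ne h2 (eq_zero_of_isIso' f h3 hX)) h3
  | cons f g h1 h2 h3 ih =>
    refine .cons f g (ind_ne h1 hX) h2 (ih (by rintro rfl; exact hf Limits.comp_zero) fun y => ?_)
    by_contra hy
    rw [eq_zero_of_sink hX h3.left.2.1 hy f] at hf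
    exact hf Limits.zero_comp

theorem sink_eq_zero {X Y : Rep k (Vtx n)} (hX : IsInterval X a b) (hY : IndecObj Y) {f : X ⟶ Y}
    (hf : f ≠ 0) (hi : ¬ IsIso f) (y : Y.V b) : y = 0 := by
  by_contra hy
  obtain ⟨v, x, hx⟩ := exists_ne_zero hf
  obtain ⟨x0, h1, -⟩ := id hX
  obtain ⟨c, rfl⟩ := (h1 v (a_le v) (le_b v)).2 x
  have h2 : f.app a x0 ≠ 0 := fun h => hx (by
    rw [map_smul, nat_apply, h, map_zero, smul_zero])
  exact hi (hX.isIso (isInterval_of_source_of_sink hY h2 hy) f h2)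

variable {h0 : n 0 = 1} {m : ℕ}

theorem add_le_of_initial_chain (σ : IncSys k R (Vtx n) Set.univ) (hm : IsLength k n h0 m)
    {X Z : Rep k (Vtx n)} {g : X ⟶ Z} {N : ℕ} (hg : Chain (Ind Set.univ) g N)
    {W : Rep k (Vtx n)} {p : W ⟶ X} {s : ℕ} (hp : Chain (Ind {v | v ≠ a}) p s)
    (hpg : p ≫ g ≠ 0) : s + N ≤ 2 * m := by
  have hm1 := hm.one_le
  induction hg generalizing W s with
  | nil f h1 h2 h3 =>
    have := hm.le p hp (by rintro rfl; exact hpg Limits.zero_comp)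
    omega
  | @cons X Y Z f g N h1 h2 h3 ih =>
    have hp0 : p ≠ 0 := by rintro rfl; exact hpg Limits.zero_comp
    have hs := hm.le p hp hp0
    have hXa : ∀ x : X.V a, x = 0 := hp.right.2.2 a (by simp)
    have hf0 : f ≠ 0 := by rintro rfl; exact hpg (by simp)
    have hg0 : g ≠ 0 := by rintro rfl; exact hpg (by simp)
    by_cases hYa : ∀ y : Y.V a, y = 0
    · have := ih (hp.snoc f (ind_ne h3.left hYa) h2) (by rwa [Category.assoc])
      omega
    push Not at hYa
    obtain ⟨ya, hya⟩ := hYa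
    by_cases hYb : ∀ y : Y.V b, y = 0
    · by_cases hXb : ∀ x : X.V b, x = 0
      · have h4 : f ≫ g ≠ 0 := fun h => hpg (by rw [h, Limits.comp_zero])
        have := hm.le' _ (chain_of_sink (.cons f g h1 h2 h3) h4 hXb) h4
        omega
      · obtain ⟨M, u, w, hM, hMa, hMb, hu, hw⟩ := exists_middle σ p f g h3.left.1 hXa hYb hpg
        have h4 := hm.le _ (hp.snoc u (ind_ne hM hMa) fun hi =>
          hXb (eq_zero_of_isIso u hi hMb)) hu
        have h5 := hm.le' _ (chain_of_sink (.cons w g hM (fun hi =>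
          hya (eq_zero_of_isIso' w hi hMa ya)) h3) hw hMb) hw
        omega
    push Not at hYb
    obtain ⟨yb, hyb⟩ := hYb
    have hY := isInterval_of_source_of_sink h3.left.2.1 hya hyb
    cases h3 with
    | nil => omega
    | @cons _ Y' _ f' g' N h4 h5 h6 =>
      have hf0' : f' ≠ 0 := by rintro rfl; exact hg0 Limits.zero_comp
      have hYb' := sink_eq_zero hY h6.left.2.1 hf0' h5
      obtain ⟨M, u, w, hM, hMa, hMb, hu, hw⟩ := exists_middle σ p (f ≫ f') g' h6.left.1 hXa hYb'
        (by rwa [Category.assoc])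
      have h7 := hm.le _ (hp.snoc u (ind_ne hM hMa) fun hi =>
        hf0 (eq_zero_of_sink (eq_zero_of_isIso u hi hMb) h4.2.1 hyb f)) hu
      have h8 := hm.le' _ (chain_of_sink (.cons w g' hM (fun hi =>
        hf0' (eq_zero_of_source h4.1 h4.2.1 hya (eq_zero_of_isIso' w hi hMa) f')) h6) hw hMb) hw
      omega

theorem le_two_mul (σ : IncSys k R (Vtx n) Set.univ) (hm : IsLength k n h0 m)
    {X Z : Rep k (Vtx n)} {g : X ⟶ Z} {N : ℕ} (hg : Chain (Ind Set.univ) g N)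
    (hg0 : g ≠ 0) : N ≤ 2 * m := by
  have hm1 := hm.one_le
  by_cases hXa : ∀ x : X.V a, x = 0
  · have := add_le_of_initial_chain σ hm hg (p := 𝟙 X) (s := 0)
      (.nil _ (ind_ne hg.left hXa) (ind_ne hg.left hXa) inferInstance) (by rwa [Category.id_comp])
    omega
  by_cases hXb : ∀ x : X.V b, x = 0
  · have := hm.le' _ (chain_of_sink hg hg0 hXb) hg0
    omega
  push Not at hXa hXb
  obtain ⟨xa, hxa⟩ := hXa
  obtain ⟨xb, hxb⟩ := hXb
  have hX := isInterval_of_source_of_sink hg.left.2.1 hxa hxb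
  cases hg with
  | nil => omega
  | cons f g h1 h2 h3 =>
    have hg1 : g ≠ 0 := by rintro rfl; exact hg0 Limits.comp_zero
    have hf1 : f ≠ 0 := by rintro rfl; exact hg0 Limits.zero_comp
    have := hm.le' _ (chain_of_sink h3 hg1 (sink_eq_zero hX h3.left.2.1 hf1 h2)) hg1
    omega

theorem nilpotencyIndex_eq (σ : IncSys k R (Vtx n) Set.univ) (hm : IsLength k n h0 m) {N : ℕ}
    (hN : NilpotencyIndex R N) : N = 2 * m + 1 := by
  obtain ⟨-, h1, h2⟩ := hN
  apply le_antisymm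
  · refine h2 _ ((σ.radVanishes_iff_rep _).2 fun X Y f hf => ?_)
    by_contra h
    have := le_two_mul σ hm hf h
    omega
  · by_contra h
    obtain ⟨X, f, hf, hf0⟩ := hm.exists_chain
    obtain ⟨Y, g, hg, hg0⟩ := hm.exists_chain'
    have h3 := (hf.mono fun X hX => (⟨hX.1, hX.2.1, suppIn_univ X⟩ : X.Ind Set.univ)).trans
      (hg.mono fun X hX => (⟨hX.1, hX.2.1, suppIn_univ X⟩ : X.Ind Set.univ))
    obtain ⟨X', f', hf', h4⟩ := h3.exists_of_le (comp_ne_zero_of_simple hf0 hg0)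
      (n := N) (by omega)
    exact h4 ((σ.radVanishes_iff_rep _).1 h1 _ _ _ hf')

theorem nilpotencyIndex_eq_of_source (σ : IncSys k R (Vtx n) {v | v ≠ a}) (h0 : n 0 = 1) {N : ℕ}
    (hN : NilpotencyIndex R N) : ∃ m, IsLength k n h0 m ∧ N = m + 1 := by
  obtain ⟨-, h1, h2⟩ := hN
  rw [σ.radVanishes_iff_rep] at h1
  obtain ⟨m, hm⟩ := exists_isLength h0 h1
  refine ⟨m, hm, le_antisymm ?_ ?_⟩
  · refine h2 _ ((σ.radVanishes_iff_rep _).2 fun X Y f hf => ?_)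
    by_contra h
    have := hm.le _ hf h
    omega
  · by_contra h
    obtain ⟨X, f, hf, hf0⟩ := hm.exists_chain
    obtain ⟨X', f', hf', h4⟩ := hf.exists_of_le hf0 (n := N) (by omega)
    exact h4 (h1 _ _ _ hf')

theorem nilpotencyIndex_eq_of_sink (σ : IncSys k R (Vtx n) {v | v ≠ b}) (h0 : n 0 = 1) {N : ℕ}
    (hN : NilpotencyIndex R N) : ∃ m, IsLength k n h0 m ∧ N = m + 1 := by
  obtain ⟨-, h1, h2⟩ := hN
  rw [σ.radVanishes_iff_rep] at h1
  obtain ⟨m, hm⟩ := exists_isLength' h0 h1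
  refine ⟨m, hm, le_antisymm ?_ ?_⟩
  · refine h2 _ ((σ.radVanishes_iff_rep _).2 fun X Y f hf => ?_)
    by_contra h
    have := hm.le' _ hf h
    omega
  · by_contra h
    obtain ⟨X, f, hf, hf0⟩ := hm.exists_chain'
    obtain ⟨X', f', hf', h4⟩ := hf.exists_of_le hf0 (n := N) (by omega)
    exact h4 (h1 _ _ _ hf')

end


/-! ## Presentations of the algebras by three arms -/

namespace Vtx

variable {n : Fin 3 → ℕ}

/-- The vertex lies on the arm `i`, the source and the sink being common to all arms. -/
def OnArm (i : Fin 3) : Vtx n → Prop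
  | m i' _ _ => i' = i
  | _ => True

/-- The distance to the sink along the arm `i`. -/
def level (i : Fin 3) : Vtx n → ℕ
  | a => n i + 1
  | m _ l _ => l + 1
  | b => 0

theorem lv_level {i : Fin 3} {v : Vtx n} (h : v.OnArm i) : lv n i (v.level i) = v := by
  cases v with
  | a => exact lv_top i
  | b => rfl
  | m i' l hl =>
    obtain rfl : i' = i := h
    exact lv_succ hl

theorem level_le {i : Fin 3} {v : Vtx n} (h : v.OnArm i) : v.level i ≤ n i + 1 := by
  cases v with
  | a => exact le_rfl
  | b => exact Nat.zero_le _
  | m i' l hl =>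
    obtain rfl : i' = i := h
    exact Nat.succ_le_succ hl.le

theorem level_anti {i : Fin 3} {u v : Vtx n} (hu : u.OnArm i) (hv : v.OnArm i) (h : u ≤ v) :
    v.level i ≤ u.level i := by
  cases v with
  | b => exact Nat.zero_le _
  | a =>
    cases u with
    | a => exact le_rfl
    | b => exact absurd h not_b_le_a
    | m i l hl => exact absurd h not_m_le_a
  | m i' l hl =>
    cases u with
    | a => exact level_le hv
    | b => exact absurd h not_b_le_m
    | m i l hl => exact Nat.succ_le_succ (m_le_m_iff.1 h).2

theorem exists_onArm {u v w : Vtx n} (h : u ≤ v) (h' : v ≤ w) :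
    ∃ i, u.OnArm i ∧ v.OnArm i ∧ w.OnArm i := by
  cases u <;> cases v <;> cases w <;> first
    | exact absurd h not_b_le_a
    | exact absurd h not_b_le_m
    | exact absurd h not_m_le_a
    | exact absurd h' not_b_le_a
    | exact absurd h' not_b_le_m
    | exact absurd h' not_m_le_a
    | exact ⟨0, trivial, trivial, trivial⟩
    | exact ⟨_, trivial, trivial, rfl⟩
    | exact ⟨_, trivial, rfl, trivial⟩
    | exact ⟨_, rfl, trivial, trivial⟩
    | exact ⟨_, trivial, rfl, (m_le_m_iff.1 h').1.symm⟩
    | exact ⟨_, rfl, (m_le_m_iff.1 h).1.symm, trivial⟩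
    | exact ⟨_, rfl, (m_le_m_iff.1 h).1.symm, ((m_le_m_iff.1 h).1.trans (m_le_m_iff.1 h').1).symm⟩

theorem exists_lv {u v w : Vtx n} (h : u ≤ v) (h' : v ≤ w) : ∃ i j d d', j + d + d' ≤ n i + 1 ∧
    u = lv n i (j + d + d') ∧ v = lv n i (j + d) ∧ w = lv n i j := by
  obtain ⟨i, hu, hv, hw⟩ := exists_onArm h h'
  have h1 := level_anti hu hv h
  have h2 := level_anti hv hw h'
  have h3 := level_le hu
  refine ⟨i, w.level i, v.level i - w.level i, u.level i - v.level i, by omega, ?_, ?_, ?_⟩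
  · rw [show w.level i + (v.level i - w.level i) + (u.level i - v.level i) = u.level i by omega,
      lv_level hu]
  · rw [show w.level i + (v.level i - w.level i) = v.level i by omega, lv_level hv]
  · rw [lv_level hw]

end Vtx

open Vtx

section

variable {R : Type} [Ring R] {n : Fin 3 → ℕ}

/-- The product along the arm `i` of `d` arrows, ending at distance `j` from the sink. -/
def armPath (e : Vtx n → R) (c : Fin 3 → ℕ → R) (i : Fin 3) (j : ℕ) : ℕ → R
  | 0 => e (lv n i j)
  | d + 1 => armPath e c i j d * c i (j + d)

end

/-- Idempotents and arrows of an algebra whose quiver is a toupie quiver with commutative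
relations, restricted to a set of vertices. -/
structure Arms (k R : Type) [Field k] [Ring R] [Algebra k R] (n : Fin 3 → ℕ)
    (S : Set (Vtx n)) where
  e : Vtx n → R
  c : Fin 3 → ℕ → R
  e_mul : ∀ u, e u * e u = e u
  e_orth : ∀ u v, u ≠ v → e u * e v = 0
  e_sum : ∑ u, e u = 1
  e_zero : ∀ u, u ∉ S → e u = 0
  c_left : ∀ i j, j ≤ n i → e (lv n i j) * c i j = c i j
  c_right : ∀ i j, j ≤ n i → c i j * e (lv n i (j + 1)) = c i j
  gen : ∀ T : Subalgebra k R, (∀ u, e u ∈ T) → (∀ i j, j ≤ n i → c i j ∈ T) → T = ⊤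

namespace Arms

variable {k R : Type} [Field k] [Ring R] [Algebra k R] {n : Fin 3 → ℕ} {S : Set (Vtx n)}
  (α : Arms k R n S)

/-- The product along a segment of an arm. -/
def path : Fin 3 → ℕ → ℕ → R := armPath α.e α.c

theorem path_zero (i : Fin 3) (j : ℕ) : α.path i j 0 = α.e (lv n i j) := rfl

theorem path_succ (i : Fin 3) (j d : ℕ) : α.path i j (d + 1) = α.path i j d * α.c i (j + d) := rfl

theorem path_mul_e {i : Fin 3} {j d : ℕ} (h : j + d ≤ n i + 1) :
    α.path i j d * α.e (lv n i (j + d)) = α.path i j d := by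
  cases d with
  | zero => exact α.e_mul _
  | succ d => rw [path_succ, mul_assoc, ← add_assoc, α.c_right i (j + d) (by omega)]

theorem e_mul_path (i : Fin 3) (j d : ℕ) : α.e (lv n i j) * α.path i j d = α.path i j d := by
  induction d with
  | zero => exact α.e_mul _
  | succ d ih => rw [path_succ, ← mul_assoc, ih]

theorem path_mul_path {i : Fin 3} {j d d' : ℕ} (h : j + d + d' ≤ n i + 1) :
    α.path i j d * α.path i (j + d) d' = α.path i j (d + d') := by
  induction d' with
  | zero => exact α.path_mul_e (by omega)
  | succ d' ih => rw [path_succ, ← mul_assoc, ih (by omega), ← add_assoc, path_succ, add_assoc]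

theorem path_one {i : Fin 3} {j : ℕ} (h : j ≤ n i) : α.path i j 1 = α.c i j := α.c_left i j h

/-- The product along the path from `u` to `v`. -/
def prod : Vtx n → Vtx n → R
  | a, a => α.e a
  | a, m i l _ => α.path i (l + 1) (n i - l)
  | a, b => α.path 0 0 (n 0 + 1)
  | m i l _, m _ l' _ => α.path i (l' + 1) (l - l')
  | m i l _, b => α.path i 0 (l + 1)
  | b, b => α.e b
  | _, _ => 0

theorem prod_self (u : Vtx n) : α.prod u u = α.e u := by
  cases u with
  | a => rfl
  | b => rfl
  | m i l h =>
    change α.path i (l + 1) (l - l) = _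
    rw [Nat.sub_self, path_zero, lv_succ h]

variable (hc : ∀ i, α.path i 0 (n i + 1) = α.path 0 0 (n 0 + 1))

include hc

theorem prod_lv {i : Fin 3} {j d : ℕ} (h : j + d ≤ n i + 1) :
    α.prod (lv n i (j + d)) (lv n i j) = α.path i j d := by
  rcases d with _ | d
  · rw [add_zero, prod_self, path_zero]
  rcases j with _ | j
  · rw [zero_add]
    rcases Nat.lt_or_ge d (n i) with hd | hd
    · rw [lv_succ hd]
      rfl
    · obtain rfl : d = n i := by omega
      rw [lv_top]
      exact (hc i).symm
  · have hj : j < n i := by omega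
    rw [lv_succ hj, ← add_assoc, show j + 1 + d = (j + d) + 1 by omega]
    rcases Nat.lt_or_ge (j + d + 1) (n i) with hd | hd
    · rw [lv_succ hd]
      change α.path i (j + 1) (j + d + 1 - j) = _
      rw [show j + d + 1 - j = d + 1 by omega]
    · rw [show j + d + 1 + 1 = n i + 1 by omega, lv_top]
      change α.path i (j + 1) (n i - j) = _
      rw [show n i - j = d + 1 by omega]

theorem prod_mul_prod {u v w : Vtx n} (h : u ≤ v) (h' : v ≤ w) :
    α.prod v w * α.prod u v = α.prod u w := by
  obtain ⟨i, j, d, d', hl, rfl, rfl, rfl⟩ := exists_lv h h'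
  rw [α.prod_lv hc hl, α.prod_lv hc (by omega), α.path_mul_path hl, add_assoc,
    α.prod_lv hc (by omega)]

theorem prod_mul_prod_of_ne {u v v' w : Vtx n} (h : u ≤ v) (h' : v' ≤ w) (hv : v ≠ v') :
    α.prod v' w * α.prod u v = 0 := by
  rw [← α.prod_mul_prod hc h le_rfl, ← α.prod_mul_prod hc le_rfl h', mul_assoc,
    ← mul_assoc (α.prod v' v'), prod_self, prod_self, α.e_orth _ _ hv.symm, zero_mul, mul_zero]

theorem span_prod : Submodule.span k {r | ∃ u v, u ≤ v ∧ α.prod u v = r} = ⊤ := by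
  have h1 : ∀ u v, u ≤ v → α.prod u v ∈ Submodule.span k {r | ∃ u v, u ≤ v ∧ α.prod u v = r} :=
    fun u v h => Submodule.subset_span ⟨u, v, h, rfl⟩
  have he : ∀ u, α.e u ∈ Submodule.span k {r | ∃ u v, u ≤ v ∧ α.prod u v = r} := fun u => by
    rw [← prod_self]
    exact h1 _ _ le_rfl
  let T : Subalgebra k R := Submodule.toSubalgebra
    (Submodule.span k {r | ∃ u v, u ≤ v ∧ α.prod u v = r})
    (by rw [← α.e_sum]; exact sum_mem fun u _ => he u) (fun x y hx hy => by
      induction hx using Submodule.span_induction with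
      | zero => rw [zero_mul]; exact zero_mem _
      | add x x' _ _ hx hx' => rw [add_mul]; exact add_mem hx hx'
      | smul r x _ hx => rw [smul_mul_assoc]; exact Submodule.smul_mem _ _ hx
      | mem x hx =>
        induction hy using Submodule.span_induction with
        | zero => rw [mul_zero]; exact zero_mem _
        | add y y' _ _ hy hy' => rw [mul_add]; exact add_mem hy hy'
        | smul r y _ hy => rw [mul_smul_comm]; exact Submodule.smul_mem _ _ hy
        | mem y hy =>
          obtain ⟨v', w, h', rfl⟩ := hx
          obtain ⟨u, v, h, rfl⟩ := hy
          by_cases hv : v = v'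
          · subst hv
            rw [α.prod_mul_prod hc h h']
            exact h1 _ _ (h.trans h')
          · rw [α.prod_mul_prod_of_ne hc h h' hv]
            exact zero_mem _)
  have hT : T = ⊤ := α.gen T he fun i j hj => by
    rw [← α.path_one hj, ← α.prod_lv hc (Nat.succ_le_succ hj)]
    exact h1 _ _ (lv_anti i (Nat.le_succ j))
  exact congrArg Subalgebra.toSubmodule hT

/-- The system of path products. -/
def incSys (hne : ∀ i j d, j + d ≤ n i + 1 → lv n i j ∈ S → lv n i (j + d) ∈ S →
    α.path i j d ≠ 0) : IncSys k R (Vtx n) S where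
  p := α.prod
  mul_same := α.prod_mul_prod hc
  mul_ne := α.prod_mul_prod_of_ne hc
  sum_one := by simp only [prod_self, α.e_sum]
  span_top := α.span_prod hc
  ne_zero {u v} h hu hv := by
    obtain ⟨i, j, d, d', hl, rfl, rfl, hw⟩ := exists_lv h (le_refl v)
    rw [α.prod_lv hc hl]
    exact hne i _ _ hl hv hu
  zero_of_notMem h := by rw [prod_self, α.e_zero _ h]

omit hc in
theorem path_ne_of_full (hne : ∀ i, α.path i 0 (n i + 1) ≠ 0) {i : Fin 3} {j d : ℕ}
    (h : j + d ≤ n i + 1) : α.path i j d ≠ 0 := fun h0 => hne i (by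
  have h1 := α.path_mul_path (i := i) (j := 0) (d := j + d) (d' := n i + 1 - (j + d)) (by omega)
  rw [show j + d + (n i + 1 - (j + d)) = n i + 1 by omega] at h1
  rw [← h1, ← α.path_mul_path (i := i) (j := 0) (d := j) (d' := d) (by omega), zero_add, h0,
    mul_zero, zero_mul])

end Arms


open Vtx

/-! ## Reading off the arms from a quiver presentation -/

/-- A numbering of the vertices in `S` and of the arrows between them, compatible with a given
list of sources and targets. Numbers out of range stand for deleted vertices and arrows. -/
structure Numbering (n : Fin 3 → ℕ) (S : Set (Vtx n)) (N M : ℕ) (ends : Fin M → ℕ × ℕ) where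
  pos : Vtx n → ℕ
  apos : Fin 3 → ℕ → ℕ
  pos_lt_iff : ∀ u, pos u < N ↔ u ∈ S
  pos_inj : ∀ u v, pos u < N → pos u = pos v → u = v
  exists_pos : ∀ x < N, ∃ u, pos u = x
  ends_eq : ∀ i j, j ≤ n i → ∀ h : apos i j < M,
    ends ⟨apos i j, h⟩ = (pos (lv n i (j + 1)), pos (lv n i j))
  exists_apos : ∀ x < M, ∃ i j, j ≤ n i ∧ apos i j = x

namespace Numbering

variable {k R V E : Type} [Field k] [Ring R] [Algebra k R] [Fintype V] [Fintype E]
  {n : Fin 3 → ℕ} {S : Set (Vtx n)} {N M : ℕ} {ends : Fin M → ℕ × ℕ}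

/-- The element numbered by `x`, or `0` if `x` is out of range. -/
def extend {N : ℕ} (f : Fin N → R) (x : ℕ) : R := if h : x < N then f ⟨x, h⟩ else 0

theorem extend_of_lt {f : Fin N → R} {x : ℕ} (h : x < N) : extend f x = f ⟨x, h⟩ := dif_pos h

theorem extend_of_le {f : Fin N → R} {x : ℕ} (h : N ≤ x) : extend f x = 0 :=
  dif_neg (Nat.not_lt.2 h)

variable (ν : Numbering n S N M ends) (P : QuiverPresentation k R V E)
  (v : Fin N ≃ V) (ar : Fin M ≃ E)

theorem sum_extend : ∑ u, extend (fun x => P.idem (v x)) (ν.pos u) = 1 := by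
  choose w hw using fun x : Fin N => ν.exists_pos x x.2
  rw [← P.sum_idem, ← Equiv.sum_comp v]
  refine (Finset.sum_of_injOn w ?_ (fun _ _ => Finset.mem_coe.2 (Finset.mem_univ _)) ?_ ?_).symm
  · intro x _ y _ h
    exact Fin.ext ((hw x).symm.trans ((congrArg ν.pos h).trans (hw y)))
  · intro u _ hu
    refine extend_of_le (Nat.not_lt.1 fun h => hu ⟨⟨_, h⟩, Finset.mem_coe.2 (Finset.mem_univ _), ?_⟩)
    exact (ν.pos_inj _ _ h (hw ⟨_, h⟩).symm).symm
  · intro x _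
    rw [extend_of_lt ((hw x).symm ▸ x.2)]
    exact congrArg (fun y => P.idem (v y)) (Fin.ext (hw x).symm)

variable (hspec : ∀ i : Fin M, ∃ a b : Fin N, (a : ℕ) = (ends i).1 ∧ (b : ℕ) = (ends i).2 ∧
  P.src (ar i) = v a ∧ P.tgt (ar i) = v b)

include hspec

theorem exists_src_tgt {i : Fin 3} {j : ℕ} (hj : j ≤ n i) (h : ν.apos i j < M) :
    ∃ (h1 : ν.pos (lv n i (j + 1)) < N) (h2 : ν.pos (lv n i j) < N),
      P.src (ar ⟨_, h⟩) = v ⟨_, h1⟩ ∧ P.tgt (ar ⟨_, h⟩) = v ⟨_, h2⟩ := by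
  obtain ⟨x, y, hx, hy, hs, ht⟩ := hspec ⟨_, h⟩
  rw [ν.ends_eq i j hj h] at hx hy
  obtain ⟨x, hx'⟩ := x
  obtain ⟨y, hy'⟩ := y
  obtain rfl : x = _ := hx
  obtain rfl : y = _ := hy
  exact ⟨hx', hy', hs, ht⟩

/-- The arms of an algebra presented by a numbered quiver. -/
def arms : Arms k R n S where
  e u := extend (fun x => P.idem (v x)) (ν.pos u)
  c i j := extend (fun x => P.arrow (ar x)) (ν.apos i j)
  e_mul u := by
    rcases Nat.lt_or_ge (ν.pos u) N with h | h
    · rw [extend_of_lt h, P.idem_idem]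
    · rw [extend_of_le h, mul_zero]
  e_orth u u' hne := by
    rcases Nat.lt_or_ge (ν.pos u) N with h | h
    · rcases Nat.lt_or_ge (ν.pos u') N with h' | h'
      · rw [extend_of_lt h, extend_of_lt h']
        exact P.idem_orth _ _ fun he => hne (ν.pos_inj _ _ h (congrArg Fin.val (v.injective he)))
      · rw [extend_of_le h', mul_zero]
    · rw [extend_of_le h, zero_mul]
  e_sum := ν.sum_extend P v
  e_zero u hu := extend_of_le (Nat.not_lt.1 fun h => hu ((ν.pos_lt_iff u).1 h))
  c_left i j hj := by
    rcases Nat.lt_or_ge (ν.apos i j) M with h | h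
    · obtain ⟨h1, h2, hs, ht⟩ := ν.exists_src_tgt P v ar hspec hj h
      rw [extend_of_lt h, extend_of_lt h2, ← ht, ← P.arrow_mem, mul_assoc, ← mul_assoc,
        P.idem_idem]
    · rw [extend_of_le h, mul_zero]
  c_right i j hj := by
    rcases Nat.lt_or_ge (ν.apos i j) M with h | h
    · obtain ⟨h1, h2, hs, ht⟩ := ν.exists_src_tgt P v ar hspec hj h
      rw [extend_of_lt h, extend_of_lt h1, ← hs, ← P.arrow_mem, mul_assoc, P.idem_idem]
    · rw [extend_of_le h, zero_mul]
  gen T he hc := by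
    rw [eq_top_iff, ← P.generates]
    refine Algebra.adjoin_le (Set.union_subset ?_ ?_)
    · rintro _ ⟨y, rfl⟩
      obtain ⟨u, hu⟩ := ν.exists_pos (v.symm y) (v.symm y).2
      have h := he u
      rw [hu, extend_of_lt (v.symm y).2, Fin.eta, Equiv.apply_symm_apply] at h
      exact h
    · rintro _ ⟨y, rfl⟩
      obtain ⟨i, j, hj, hu⟩ := ν.exists_apos (ar.symm y) (ar.symm y).2
      have h := hc i j hj
      rw [hu, extend_of_lt (ar.symm y).2, Fin.eta, Equiv.apply_symm_apply] at h
      exact h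

theorem arms_e {u : Vtx n} (h : ν.pos u < N) :
    (ν.arms P v ar hspec).e u = P.idem (v ⟨ν.pos u, h⟩) :=
  extend_of_lt (f := fun x => P.idem (v x)) h

theorem arms_c {i : Fin 3} {j x : ℕ} (hx : ν.apos i j = x) (h : x < M) :
    (ν.arms P v ar hspec).c i j = P.arrow (ar ⟨x, h⟩) := by
  subst hx
  exact extend_of_lt (f := fun x => P.arrow (ar x)) h

theorem arms_c_of_le {i : Fin 3} {j : ℕ} (h : M ≤ ν.apos i j) :
    (ν.arms P v ar hspec).c i j = 0 :=
  extend_of_le (f := fun x => P.arrow (ar x)) h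

end Numbering

section

variable {n2 n3 : ℕ}

theorem forall_vtx {p : Vtx ![1, n2, n3] → Prop} (ha : p a) (hb : p b)
    (h0 : ∀ h, p (m 0 0 h)) (h1 : ∀ l, l < n2 → ∀ h, p (m 1 l h))
    (h2 : ∀ l, l < n3 → ∀ h, p (m 2 l h)) (u : Vtx ![1, n2, n3]) : p u := by
  cases u with
  | a => exact ha
  | b => exact hb
  | m i l h =>
    match i, h with
    | 0, h =>
      obtain rfl : l = 0 := Nat.lt_one_iff.1 h
      exact h0 h
    | 1, h => exact h1 l h h
    | 2, h => exact h2 l h h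

theorem forall_arrow {p : Fin 3 → ℕ → Prop} (h0 : p 0 0) (h0' : p 0 1)
    (h1 : ∀ j, j ≤ n2 → p 1 j) (h2 : ∀ j, j ≤ n3 → p 2 j) (i : Fin 3) (j : ℕ)
    (h : j ≤ ![1, n2, n3] i) : p i j := by
  match i, h with
  | 0, h =>
    obtain rfl | rfl : j = 0 ∨ j = 1 := Nat.le_one_iff_eq_zero_or_eq_one.1 h
    · exact h0
    · exact h0'
  | 1, h => exact h1 j h
  | 2, h => exact h2 j h

/-- The function on the vertices with the given values. -/
def vtxFun (xa xb x0 : ℕ) (x1 x2 : ℕ → ℕ) : Vtx ![1, n2, n3] → ℕ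
  | a => xa
  | b => xb
  | m i l _ => ![x0, x1 l, x2 l] i

section

variable {xa xb x0 : ℕ} {x1 x2 : ℕ → ℕ} {l : ℕ}

theorem vtxFun_a : (vtxFun xa xb x0 x1 x2 : Vtx ![1, n2, n3] → ℕ) a = xa := rfl

theorem vtxFun_b : (vtxFun xa xb x0 x1 x2 : Vtx ![1, n2, n3] → ℕ) b = xb := rfl

theorem vtxFun_zero (h) : (vtxFun xa xb x0 x1 x2 : Vtx ![1, n2, n3] → ℕ) (m 0 l h) = x0 := rfl

theorem vtxFun_one (h) : (vtxFun xa xb x0 x1 x2 : Vtx ![1, n2, n3] → ℕ) (m 1 l h) = x1 l := rfl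

theorem vtxFun_two (h) : (vtxFun xa xb x0 x1 x2 : Vtx ![1, n2, n3] → ℕ) (m 2 l h) = x2 l := rfl

theorem vtxFun_lv_one : (vtxFun xa xb x0 x1 x2) (lv ![1, n2, n3] 1 l) =
    if l = 0 then xb else if l ≤ n2 then x1 (l - 1) else xa := by
  rcases l with _ | l
  · rfl
  · rw [if_neg (Nat.succ_ne_zero l)]
    split_ifs with h
    · rw [lv_succ (n := ![1, n2, n3]) (i := 1) (show l < n2 from h)]
      rfl
    · exact congrArg (vtxFun xa xb x0 x1 x2) (dif_neg (show ¬ l < ![1, n2, n3] 1 from h))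

theorem vtxFun_lv_two : (vtxFun xa xb x0 x1 x2) (lv ![1, n2, n3] 2 l) =
    if l = 0 then xb else if l ≤ n3 then x2 (l - 1) else xa := by
  rcases l with _ | l
  · rfl
  · rw [if_neg (Nat.succ_ne_zero l)]
    split_ifs with h
    · rw [lv_succ (n := ![1, n2, n3]) (i := 2) (show l < n3 from h)]
      rfl
    · exact congrArg (vtxFun xa xb x0 x1 x2) (dif_neg (show ¬ l < ![1, n2, n3] 2 from h))

end

end

variable (n2 n3 : ℕ)

/-- The standard numbering of the toupie quiver. -/
def numbering : Numbering ![1, n2, n3] Set.univ (n2 + n3 + 3) (n2 + n3 + 4)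
    (toupie3Ends n2 n3) where
  pos := vtxFun 0 (n2 + n3 + 2) 1 (fun l => n2 + 1 - l) (fun l => n2 + n3 + 1 - l)
  apos i j := ![1 - j, n2 + 2 - j, n2 + n3 + 3 - j] i
  pos_lt_iff u := by
    refine iff_of_true ?_ trivial
    induction u using forall_vtx <;>
      simp only [vtxFun_a, vtxFun_b, vtxFun_zero, vtxFun_one, vtxFun_two] <;> omega
  pos_inj u v := by
    induction u using forall_vtx <;> induction v using forall_vtx <;>
      simp only [vtxFun_a, vtxFun_b, vtxFun_zero, vtxFun_one, vtxFun_two, m.injEq,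
        reduceCtorEq, true_and, implies_true, imp_false] <;> grind
  exists_pos x hx := by
    rcases Nat.eq_zero_or_pos x with h | h
    · exact ⟨a, h.symm⟩
    by_cases h1 : x = 1
    · exact ⟨m 0 0 Nat.one_pos, h1.symm⟩
    by_cases h2 : x ≤ n2 + 1
    · exact ⟨m 1 (n2 + 1 - x) (show n2 + 1 - x < n2 by omega),
        show n2 + 1 - (n2 + 1 - x) = x by omega⟩
    by_cases h3 : x ≤ n2 + n3 + 1
    · exact ⟨m 2 (n2 + n3 + 1 - x) (show n2 + n3 + 1 - x < n3 by omega),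
        show n2 + n3 + 1 - (n2 + n3 + 1 - x) = x by omega⟩
    · exact ⟨b, show n2 + n3 + 2 = x by omega⟩
  ends_eq := by
    refine forall_arrow ?_ ?_ ?_ ?_
    · exact fun _ => rfl
    · exact fun _ => rfl
    · intro j hj h
      rw [vtxFun_lv_one, vtxFun_lv_one]
      ext <;> simp [toupie3Ends] <;> grind
    · intro j hj h
      rw [vtxFun_lv_two, vtxFun_lv_two]
      ext <;> simp [toupie3Ends] <;> grind
  exists_apos x hx := by
    by_cases h1 : x ≤ 1
    · exact ⟨0, 1 - x, show 1 - x ≤ 1 by omega, show 1 - (1 - x) = x by omega⟩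
    by_cases h2 : x ≤ n2 + 2
    · exact ⟨1, n2 + 2 - x, show n2 + 2 - x ≤ n2 by omega,
        show n2 + 2 - (n2 + 2 - x) = x by omega⟩
    · exact ⟨2, n2 + n3 + 3 - x, show n2 + n3 + 3 - x ≤ n3 by omega,
        show n2 + n3 + 3 - (n2 + n3 + 3 - x) = x by omega⟩

/-- The standard numbering of the quiver obtained by deleting the source. -/
def numberingDelSrc : Numbering ![1, n2, n3] {v | v ≠ a} (n2 + n3 + 2) (1 + n2 + n3)
    (delSrcEnds n2 n3) where
  pos := vtxFun (n2 + n3 + 2) (n2 + n3 + 1) 0 (fun l => n2 - l) (fun l => n2 + n3 - l)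
  apos i j := ![if j < 1 then 0 else 1 + n2 + n3, if j < n2 then n2 - j else 1 + n2 + n3,
    if j < n3 then n2 + n3 - j else 1 + n2 + n3] i
  pos_lt_iff u := by
    rw [Set.mem_ofPred_eq]
    induction u using forall_vtx <;>
      simp only [vtxFun_a, vtxFun_b, vtxFun_zero, vtxFun_one, vtxFun_two, ne_eq, reduceCtorEq,
        not_true, not_false_iff, iff_true, iff_false] <;> omega
  pos_inj u v := by
    induction u using forall_vtx <;> induction v using forall_vtx <;>
      simp only [vtxFun_a, vtxFun_b, vtxFun_zero, vtxFun_one, vtxFun_two, m.injEq,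
        reduceCtorEq, true_and, implies_true, imp_false] <;> grind
  exists_pos x hx := by
    rcases Nat.eq_zero_or_pos x with h | h
    · exact ⟨m 0 0 Nat.one_pos, h.symm⟩
    by_cases h2 : x ≤ n2
    · exact ⟨m 1 (n2 - x) (show n2 - x < n2 by omega), show n2 - (n2 - x) = x by omega⟩
    by_cases h3 : x ≤ n2 + n3
    · exact ⟨m 2 (n2 + n3 - x) (show n2 + n3 - x < n3 by omega),
        show n2 + n3 - (n2 + n3 - x) = x by omega⟩
    · exact ⟨b, show n2 + n3 + 1 = x by omega⟩
  ends_eq := by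
    refine forall_arrow ?_ ?_ ?_ ?_
    · exact fun _ => rfl
    · exact fun h => absurd h (lt_irrefl _)
    · intro j hj h
      rw [vtxFun_lv_one, vtxFun_lv_one]
      have hj' : j < n2 := lt_of_not_ge fun h' => lt_irrefl (1 + n2 + n3) (by
        simp [Nat.not_lt.2 h'] at h)
      ext <;> simp [delSrcEnds, hj'] <;> grind
    · intro j hj h
      rw [vtxFun_lv_two, vtxFun_lv_two]
      have hj' : j < n3 := lt_of_not_ge fun h' => lt_irrefl (1 + n2 + n3) (by
        simp [Nat.not_lt.2 h'] at h)
      ext <;> simp [delSrcEnds, hj'] <;> grind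
  exists_apos x hx := by
    rcases Nat.eq_zero_or_pos x with h | h
    · exact ⟨0, 0, Nat.zero_le 1, h.symm⟩
    by_cases h2 : x ≤ n2
    · exact ⟨1, n2 - x, show n2 - x ≤ n2 by omega,
        (if_pos (show n2 - x < n2 by omega)).trans (by omega)⟩
    · exact ⟨2, n2 + n3 - x, show n2 + n3 - x ≤ n3 by omega,
        (if_pos (show n2 + n3 - x < n3 by omega)).trans (by omega)⟩

/-- The standard numbering of the quiver obtained by deleting the sink. -/
def numberingDelSnk : Numbering ![1, n2, n3] {v | v ≠ b} (n2 + n3 + 2) (1 + n2 + n3)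
    (delSnkEnds n2 n3) where
  pos := vtxFun 0 (n2 + n3 + 2) 1 (fun l => n2 + 1 - l) (fun l => n2 + n3 + 1 - l)
  apos i j := ![if j = 0 then 1 + n2 + n3 else 0, if j = 0 then 1 + n2 + n3 else n2 + 1 - j,
    if j = 0 then 1 + n2 + n3 else n2 + n3 + 1 - j] i
  pos_lt_iff u := by
    rw [Set.mem_ofPred_eq]
    induction u using forall_vtx <;>
      simp only [vtxFun_a, vtxFun_b, vtxFun_zero, vtxFun_one, vtxFun_two, ne_eq, reduceCtorEq,
        not_true, not_false_iff, iff_true, iff_false] <;> omega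
  pos_inj u v := by
    induction u using forall_vtx <;> induction v using forall_vtx <;>
      simp only [vtxFun_a, vtxFun_b, vtxFun_zero, vtxFun_one, vtxFun_two, m.injEq,
        reduceCtorEq, true_and, implies_true, imp_false] <;> grind
  exists_pos x hx := by
    rcases Nat.eq_zero_or_pos x with h | h
    · exact ⟨a, h.symm⟩
    by_cases h1 : x = 1
    · exact ⟨m 0 0 Nat.one_pos, h1.symm⟩
    by_cases h2 : x ≤ n2 + 1
    · exact ⟨m 1 (n2 + 1 - x) (show n2 + 1 - x < n2 by omega),
        show n2 + 1 - (n2 + 1 - x) = x by omega⟩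
    · exact ⟨m 2 (n2 + n3 + 1 - x) (show n2 + n3 + 1 - x < n3 by omega),
        show n2 + n3 + 1 - (n2 + n3 + 1 - x) = x by omega⟩
  ends_eq := by
    refine forall_arrow ?_ ?_ ?_ ?_
    · exact fun h => absurd h (lt_irrefl _)
    · exact fun _ => rfl
    · intro j hj h
      rw [vtxFun_lv_one, vtxFun_lv_one]
      have hj' : j ≠ 0 := fun h' => lt_irrefl (1 + n2 + n3) (by simp [h'] at h)
      ext <;> simp [delSnkEnds, hj'] <;> grind
    · intro j hj h
      rw [vtxFun_lv_two, vtxFun_lv_two]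
      have hj' : j ≠ 0 := fun h' => lt_irrefl (1 + n2 + n3) (by simp [h'] at h)
      ext <;> simp [delSnkEnds, hj'] <;> grind
  exists_apos x hx := by
    rcases Nat.eq_zero_or_pos x with h | h
    · exact ⟨0, 1, le_refl 1, h.symm⟩
    by_cases h2 : x ≤ n2
    · exact ⟨1, n2 + 1 - x, show n2 + 1 - x ≤ n2 by omega,
        (if_neg (show n2 + 1 - x ≠ 0 by omega)).trans (by omega)⟩
    · exact ⟨2, n2 + n3 + 1 - x, show n2 + n3 + 1 - x ≤ n3 by omega,
        (if_neg (show n2 + n3 + 1 - x ≠ 0 by omega)).trans (by omega)⟩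


open Vtx

/-! ## The toupie algebra -/

theorem reverse_ofFn {α : Type} {d : ℕ} (f : Fin d → α) :
    (List.ofFn f).reverse = List.ofFn fun j => f j.rev := by
  apply List.ext_getElem
  · simp
  · intro j h h'
    simp [Fin.rev]
    congr 1
    ext
    simp
    omega

theorem Arms.path_eq_prod {k R : Type} [Field k] [Ring R] [Algebra k R] {n : Fin 3 → ℕ}
    {S : Set (Vtx n)} (α : Arms k R n S) (i : Fin 3) (d : ℕ) :
    α.path i 0 d = α.e b * (List.ofFn fun j : Fin d => α.c i j).prod := by
  induction d with
  | zero => simp [path_zero]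
  | succ d ih => rw [path_succ, ih, List.ofFn_succ_last, List.prod_append, mul_assoc]; simp

section

variable {k R V E : Type} [Field k] [Ring R] [Algebra k R] [Fintype V] [Fintype E]
  (P : QuiverPresentation k R V E)

theorem wprod_ofFn {d : ℕ} (f : Fin d → E) :
    P.wprod (List.ofFn f) = (List.ofFn fun j => P.arrow (f j.rev)).prod := by
  rw [QuiverPresentation.wprod, List.map_ofFn, reverse_ofFn]
  rfl

variable {P} {n2 n3 : ℕ} {v : Fin (n2 + n3 + 3) ≃ V} {ar : Fin (n2 + n3 + 4) ≃ E}
  (hends : ∀ i : Fin (n2 + n3 + 4), ∃ a b : Fin (n2 + n3 + 3),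
      (a : ℕ) = (toupie3Ends n2 n3 i).1 ∧ (b : ℕ) = (toupie3Ends n2 n3 i).2 ∧
      P.src (ar i) = v a ∧ P.tgt (ar i) = v b)
    {h0 : 0 < n2 + n3 + 4} {h1 : 1 < n2 + n3 + 4}
    {h2 : ∀ j : Fin (n2 + 1), (j : ℕ) + 2 < n2 + n3 + 4}
    {h3 : ∀ j : Fin (n3 + 1), (j : ℕ) + n2 + 3 < n2 + n3 + 4}
    (hcomm1 : P.arrow (ar ⟨1, h1⟩) * P.arrow (ar ⟨0, h0⟩) =
      P.wprod (List.ofFn fun j => ar ⟨(j : ℕ) + 2, h2 j⟩))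
    (hcomm2 : P.wprod (List.ofFn fun j => ar ⟨(j : ℕ) + 2, h2 j⟩) =
      P.wprod (List.ofFn fun j => ar ⟨(j : ℕ) + n2 + 3, h3 j⟩))
    (hcne : P.arrow (ar ⟨1, h1⟩) * P.arrow (ar ⟨0, h0⟩) ≠ 0)

include hcomm1 hcomm2 in
theorem path_full_eq (i : Fin 3) :
    ((numbering n2 n3).arms P v ar hends).path i 0 (![1, n2, n3] i + 1) =
      P.arrow (ar ⟨1, h1⟩) * P.arrow (ar ⟨0, h0⟩) := by
  set α := (numbering n2 n3).arms P v ar hends with hα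
  have hp : α.path 0 0 2 = P.arrow (ar ⟨1, h1⟩) * P.arrow (ar ⟨0, h0⟩) := by
    have h : α.path 0 0 1 = _ := α.path_one (Nat.zero_le _)
    rw [α.path_succ, h]
    exact congrArg₂ _ (Numbering.arms_c _ P v ar hends (i := 0) (j := 0) rfl _)
      (Numbering.arms_c _ P v ar hends (i := 0) (j := 0 + 1) rfl _)
  have hb : α.e b * (P.arrow (ar ⟨1, h1⟩) * P.arrow (ar ⟨0, h0⟩)) =
      P.arrow (ar ⟨1, h1⟩) * P.arrow (ar ⟨0, h0⟩) := by
    rw [← hp]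
    exact α.e_mul_path 0 0 2
  match i with
  | 0 => exact hp
  | 1 =>
    refine (α.path_eq_prod 1 (n2 + 1)).trans ((congrArg (α.e b * ·) ?_).trans hb)
    rw [hcomm1, wprod_ofFn]
    refine congrArg (fun f => (List.ofFn f).prod) (funext fun j => ?_)
    refine (Numbering.arms_c _ P v ar hends (i := 1) (j := j) rfl
      (show n2 + 2 - (j : ℕ) < n2 + n3 + 4 by omega)).trans ?_
    exact congrArg (fun y => P.arrow (ar y)) (Fin.ext
      (show n2 + 2 - (j : ℕ) = (j.rev : ℕ) + 2 by rw [Fin.val_rev]; omega))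
  | 2 =>
    refine (α.path_eq_prod 2 (n3 + 1)).trans ((congrArg (α.e b * ·) ?_).trans hb)
    rw [hcomm1, hcomm2, wprod_ofFn]
    refine congrArg (fun f => (List.ofFn f).prod) (funext fun j => ?_)
    refine (Numbering.arms_c _ P v ar hends (i := 2) (j := j) rfl
      (show n2 + n3 + 3 - (j : ℕ) < n2 + n3 + 4 by omega)).trans ?_
    exact congrArg (fun y => P.arrow (ar y)) (Fin.ext
      (show n2 + n3 + 3 - (j : ℕ) = (j.rev : ℕ) + n2 + 3 by rw [Fin.val_rev]; omega))

/-- The system of path products of the toupie algebra. -/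
def incSys : IncSys k R (Vtx ![1, n2, n3]) Set.univ :=
  ((numbering n2 n3).arms P v ar hends).incSys
    (fun i => (path_full_eq hends hcomm1 hcomm2 i).trans
      (path_full_eq hends hcomm1 hcomm2 0).symm)
    (fun _ _ _ h _ _ => Arms.path_ne_of_full _
      (fun i hi => hcne ((path_full_eq hends hcomm1 hcomm2 i).symm.trans hi)) h)

end

/-! ## Hereditary algebras -/

section

variable {k R V E : Type} [Field k] [Ring R] [Algebra k R] [Fintype V] [Fintype E]
  {P : QuiverPresentation k R V E}

/-- In a hereditary algebra, right multiplication by an arrow is injective. -/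
theorem eq_zero_of_mul_arrow (hR : Hereditary R) {y : E} {x : R}
    (hx : x * P.idem (P.tgt y) = x) (hxy : x * P.arrow y = 0) : x = 0 := by
  let f : R →ₗ[R] R := LinearMap.toSpanSingleton R R (P.arrow y)
  have := hR (LinearMap.range f)
  obtain ⟨s, hs⟩ := Module.projective_lifting_property f.rangeRestrict LinearMap.id
    f.surjective_rangeRestrict
  let r : LinearMap.range f := ⟨P.arrow y, 1, one_mul _⟩
  have hz : s r * P.arrow y = P.arrow y := congrArg Subtype.val (LinearMap.congr_fun hs r)
  have hsm : ∀ z : R, z * P.arrow y = 0 → z * s r = 0 := fun z h => by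
    rw [← smul_eq_mul, ← map_smul, show z • r = 0 from Subtype.ext h, map_zero]
  set e := P.idem (P.tgt y) with he
  have hee : e * e = e := P.idem_idem _
  have ha : e * P.arrow y = P.arrow y := by
    rw [← P.arrow_mem, mul_assoc, ← mul_assoc, hee]
  have hez : e * s r = s r := by
    have := hsm (1 - e) (by rw [sub_mul, one_mul, ha, sub_self])
    rw [sub_mul, one_mul, sub_eq_zero] at this
    exact this.symm
  have hzz : s r * s r = s r := by
    have := hsm (1 - s r) (by rw [sub_mul, one_mul, hz, sub_self])
    rw [sub_mul, one_mul, sub_eq_zero] at this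
    exact this.symm
  have hu : s r * e * (s r * e) = s r * e := by
    rw [mul_assoc, ← mul_assoc e, hez, ← mul_assoc, hzz]
  have heu : e * (s r * e) = s r * e := by rw [← mul_assoc, hez]
  have hue : s r * e * e = s r * e := by rw [mul_assoc, hee]
  rcases P.idem_primitive (P.tgt y) (s r * e) (e - s r * e) hu
    (by rw [sub_mul, mul_sub, mul_sub, hee, heu, hue, hu, sub_self, sub_zero])
    (by rw [mul_sub, hue, hu, sub_self]) (by rw [sub_mul, heu, hu, sub_self])
    (add_sub_cancel _ _) with h | h
  · refine absurd ?_ (P.arrow_ne y)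
    rw [← hz, ← ha, ← mul_assoc, h, zero_mul]
  · rw [sub_eq_zero] at h
    rw [← hx, h, ← mul_assoc, hsm x hxy, zero_mul]

variable {n : Fin 3 → ℕ} {S : Set (Vtx n)} {N M : ℕ} {ends : Fin M → ℕ × ℕ}
  (ν : Numbering n S N M ends) {v : Fin N ≃ V} {ar : Fin M ≃ E}
  (hspec : ∀ i : Fin M, ∃ a b : Fin N, (a : ℕ) = (ends i).1 ∧ (b : ℕ) = (ends i).2 ∧
    P.src (ar i) = v a ∧ P.tgt (ar i) = v b)

theorem path_ne_of_hereditary (hR : Hereditary R) {i : Fin 3} {j : ℕ} (hj : lv n i j ∈ S)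
    {d : ℕ} (h : j + d ≤ n i + 1) (hd : ∀ d' < d, ν.apos i (j + d') < M) :
    (ν.arms P v ar hspec).path i j d ≠ 0 := by
  induction d with
  | zero =>
    rw [Arms.path_zero]
    intro h0
    exact P.idem_ne _ ((ν.arms_e P v ar hspec ((ν.pos_lt_iff _).2 hj)).symm.trans h0)
  | succ d ih =>
    have hM := hd d (Nat.lt_succ_self d)
    obtain ⟨-, h2, -, ht⟩ := ν.exists_src_tgt P v ar hspec (by omega : j + d ≤ n i) hM
    intro h0
    refine ih (by omega) (fun d' h' => hd d' (by omega))
      (eq_zero_of_mul_arrow (P := P) hR (y := ar ⟨_, hM⟩) ?_ ?_)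
    · rw [ht]
      exact (congrArg ((ν.arms P v ar hspec).path i j d * ·) (ν.arms_e P v ar hspec h2).symm).trans
        (Arms.path_mul_e _ (by omega))
    · exact (congrArg ((ν.arms P v ar hspec).path i j d * ·)
        (ν.arms_c P v ar hspec rfl hM).symm).trans h0

end

section

variable {k R V E : Type} [Field k] [Ring R] [Algebra k R] [Fintype V] [Fintype E]
  {P : QuiverPresentation k R V E} {n2 n3 : ℕ} {v : Fin (n2 + n3 + 2) ≃ V}
  {ar : Fin (1 + n2 + n3) ≃ E}

/-- The system of path products of the hereditary algebra obtained by deleting the source. -/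
def incSysDelSrc (hR : Hereditary R) (hspec : ∀ i : Fin (1 + n2 + n3),
      ∃ a b : Fin (n2 + n3 + 2), (a : ℕ) = (delSrcEnds n2 n3 i).1 ∧
        (b : ℕ) = (delSrcEnds n2 n3 i).2 ∧ P.src (ar i) = v a ∧ P.tgt (ar i) = v b) :
    IncSys k R (Vtx ![1, n2, n3]) {v | v ≠ a} :=
  ((numberingDelSrc n2 n3).arms P v ar hspec).incSys
    (by
      have h : ∀ i, ((numberingDelSrc n2 n3).arms P v ar hspec).path i 0
          (![1, n2, n3] i + 1) = 0 := fun i => by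
        rw [Arms.path_succ, Numbering.arms_c_of_le, mul_zero]
        match i with
        | 0 => exact le_rfl
        | 1 => exact (if_neg (show ¬ 0 + n2 < n2 by omega)).ge
        | 2 => exact (if_neg (show ¬ 0 + n3 < n3 by omega)).ge
      exact fun i => (h i).trans (h 0).symm)
    (by
      intro i j d h hj hjd
      refine path_ne_of_hereditary _ _ hR hj h fun d' hd' => ?_
      have hd : j + d ≤ ![1, n2, n3] i := Nat.le_of_lt_succ (lt_of_le_of_ne h fun h' =>
        hjd (by rw [h', lv_top]))
      have hd2 : j + d' < ![1, n2, n3] i := by omega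
      clear hj hjd h hd
      match i, hd2 with
      | 0, hd => exact (if_pos hd).trans_lt (by omega)
      | 1, hd => exact (if_pos hd).trans_lt (by omega)
      | 2, hd =>
        have hd' : j + d' < n3 := hd
        exact (if_pos hd').trans_lt (by omega))

/-- The system of path products of the hereditary algebra obtained by deleting the sink. -/
def incSysDelSnk (hR : Hereditary R) (hspec : ∀ i : Fin (1 + n2 + n3),
      ∃ a b : Fin (n2 + n3 + 2), (a : ℕ) = (delSnkEnds n2 n3 i).1 ∧
        (b : ℕ) = (delSnkEnds n2 n3 i).2 ∧ P.src (ar i) = v a ∧ P.tgt (ar i) = v b) :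
    IncSys k R (Vtx ![1, n2, n3]) {v | v ≠ b} :=
  ((numberingDelSnk n2 n3).arms P v ar hspec).incSys
    (by
      have h : ∀ i d, ((numberingDelSnk n2 n3).arms P v ar hspec).path i 0 d = 0 := fun i d => by
        rw [← Arms.e_mul_path, lv_zero, Arms.e_zero _ b (fun h : b ≠ b => h rfl), zero_mul]
      exact fun i => (h i _).trans (h 0 _).symm)
    (fun i j d h hj hjd => path_ne_of_hereditary _ _ hR hj h fun d' hd' => by
      have hj0 : j + d' ≠ 0 := fun h' => hj (by
        rw [Nat.eq_zero_of_add_eq_zero_right h', lv_zero])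
      match i with
      | 0 => exact (if_neg hj0).trans_lt (by omega)
      | 1 => exact (if_neg hj0).trans_lt (by omega)
      | 2 => exact (if_neg hj0).trans_lt (by omega))

end

end Toupie

/-- Theorem: for a representation-finite toupie algebra with three branches of lengths
`1, n2, n3` and only commutative relations, `r_A = 2 r_(B_1) - 1 = 2 r_(B_2) - 1` where
`B_1` (resp. `B_2`) is the hereditary algebra obtained by deleting the source
(resp. the sink). -/
theorem nilpotency_index_toupie_three_branches (k A : Type) [Field k] [IsAlgClosed k] [Ring A] [Algebra k A]
    [FiniteDimensional k A] (V E : Type) [Fintype V] [Fintype E]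
    (P : QuiverPresentation k A V E) (hadm : P.Admissible) (hmin : P.Minimal)
    (n2 n3 : ℕ) (h2 : 1 ≤ n2) (h3 : 1 ≤ n3)
    (v : Fin (n2 + n3 + 3) ≃ V) (ar : Fin (n2 + n3 + 4) ≃ E)
    (hends : ∀ i : Fin (n2 + n3 + 4), ∃ a b : Fin (n2 + n3 + 3),
      (a : ℕ) = (toupie3Ends n2 n3 i).1 ∧ (b : ℕ) = (toupie3Ends n2 n3 i).2 ∧
      P.src (ar i) = v a ∧ P.tgt (ar i) = v b)
    (hcomm1 : P.arrow (ar ⟨1, by omega⟩) * P.arrow (ar ⟨0, by omega⟩) =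
      P.wprod (List.ofFn fun j : Fin (n2 + 1) =>
        ar ⟨(j : ℕ) + 2, by have := j.isLt; omega⟩))
    (hcomm2 : P.wprod (List.ofFn fun j : Fin (n2 + 1) =>
        ar ⟨(j : ℕ) + 2, by have := j.isLt; omega⟩) =
      P.wprod (List.ofFn fun j : Fin (n3 + 1) =>
        ar ⟨(j : ℕ) + n2 + 3, by have := j.isLt; omega⟩))
    (hcne : P.arrow (ar ⟨1, by omega⟩) * P.arrow (ar ⟨0, by omega⟩) ≠ 0)
    (hdim : Module.finrank k A = (n2 + 2) * (n2 + 3) / 2 + (n3 + 2) * (n3 + 3) / 2)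
    (hrf : RepFinite A) :
    (∀ (B : Type) [Ring B] [Algebra k B] [FiniteDimensional k B]
      (VB EB : Type) [Fintype VB] [Fintype EB] (PB : QuiverPresentation k B VB EB),
      PB.Admissible → PB.Minimal → Hereditary B →
      PB.DirGraphSpec (n2 + n3 + 2) (1 + n2 + n3) (delSrcEnds n2 n3) →
      ∀ mB mA : ℕ, NilpotencyIndex B mB → NilpotencyIndex A mA → mA = 2 * mB - 1) ∧
    (∀ (B : Type) [Ring B] [Algebra k B] [FiniteDimensional k B]
      (VB EB : Type) [Fintype VB] [Fintype EB] (PB : QuiverPresentation k B VB EB),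
      PB.Admissible → PB.Minimal → Hereditary B →
      PB.DirGraphSpec (n2 + n3 + 2) (1 + n2 + n3) (delSnkEnds n2 n3) →
      ∀ mB mA : ℕ, NilpotencyIndex B mB → NilpotencyIndex A mA → mA = 2 * mB - 1) := by
  have key : ∀ m mA : ℕ, Toupie.IsLength k ![1, n2, n3] rfl m → NilpotencyIndex A mA →
      mA = 2 * (m + 1) - 1 := fun m mA hm hA =>
    Toupie.nilpotencyIndex_eq (Toupie.incSys hends hcomm1 hcomm2 hcne) hm hA
  refine ⟨fun B _ _ _ VB EB _ _ PB _ _ hB hspec mB mA hmB hmA => ?_,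
    fun B _ _ _ VB EB _ _ PB _ _ hB hspec mB mA hmB hmA => ?_⟩
  · obtain ⟨vB, arB, hspec⟩ := hspec
    obtain ⟨m, hm, rfl⟩ := Toupie.nilpotencyIndex_eq_of_source
      (Toupie.incSysDelSrc hB hspec) rfl hmB
    exact key m mA hm hmA
  · obtain ⟨vB, arB, hspec⟩ := hspec
    obtain ⟨m, hm, rfl⟩ := Toupie.nilpotencyIndex_eq_of_sink
      (Toupie.incSysDelSnk hB hspec) rfl hmB
    exact key m mA hm hmA
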